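/- arXiv:1905.07426 — 4 statements merged into one kernel-verified Lean document; each statement's English description precedes it below -/
import Mathlib

section
/- Let α ∈ (0,1) and let r satisfy 1 ≤ r ≤ (2−α)/α. Let {t_j}_{j=0}^M be a temporal mesh on [0,T] that is quasi-graded with parameter r and constants c_0 ≤ C_0, and let {t'_k}_{k=0}^{M'} be any temporal mesh on [0,T] obtained by adding new nodes to {t_j} (i.e. {t_j}_{j=0}^M ⊆ {t'_k}_{k=0}^{M'}) under the condition that the first mesh interval remains unchanged (t'_1 = t_1). Then there exist constants c, C > 0, depending only on α, r, T, c_0, C_0, and a real sequence B'^0,...,B'^{M'} such that B'^0 = 0, 0 ≤ B'^k ≤ C (t'_k)^{α−1} for all k = 1,...,M', and δ'^α_t B'^k ≥ c τ^α (t'_k)^{−α−1} for all k = 1,...,M', where τ := t_1 and δ'^α_t denotes the L1 discrete fractional-derivative operator associated with the mesh {t'_k}. -/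
open Real MeasureTheory Set

/-- The L1 discrete fractional-derivative operator associated with the mesh `t`,
applied to the sequence `V`, at time level `m`. -/
noncomputable def deltaL1 (α : ℝ) (t : ℕ → ℝ) (V : ℕ → ℝ) (m : ℕ) : ℝ :=
  (1 / Real.Gamma (1 - α)) *
    ∑ j ∈ Finset.Icc 1 m,
      ((V j - V (j - 1)) / (t j - t (j - 1))) *
        ∫ s in (t (j - 1))..(t j), (t m - s) ^ (-α)

/-- `t 0 = 0 < t 1 < ... < t M = T` with `M ≥ 2`. -/
def IsMesh (T : ℝ) (M : ℕ) (t : ℕ → ℝ) : Prop :=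
  2 ≤ M ∧ t 0 = 0 ∧ (∀ j, j < M → t j < t (j + 1)) ∧ t M = T

/-- Quasi-graded mesh with parameter `r` and constants `c0 ≤ C0`. -/
def QuasiGraded (r c0 C0 : ℝ) (M : ℕ) (t : ℕ → ℝ) : Prop :=
  (c0 * (M : ℝ) ^ (-r) ≤ t 1 ∧ t 1 ≤ C0 * (M : ℝ) ^ (-r)) ∧
  (∀ j : ℕ, 1 ≤ j → j ≤ M →
    c0 * (t 1 * (j : ℝ) ^ r) ≤ t j ∧ t j ≤ C0 * (t 1 * (j : ℝ) ^ r)) ∧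
  (∀ j : ℕ, 1 ≤ j → j ≤ M →
    c0 * ((t 1) ^ (1 / r) * (t j) ^ (1 - 1 / r)) ≤ t j - t (j - 1) ∧
    t j - t (j - 1) ≤ C0 * ((t 1) ^ (1 / r) * (t j) ^ (1 - 1 / r)))

/-- The stability majorant `𝒱^j`. -/
noncomputable def Vcal (α γ τ tj : ℝ) : ℝ :=
  if 0 < γ then τ * tj ^ (α - 1)
  else if γ = 0 then τ * tj ^ (α - 1) * (1 + Real.log (tj / τ))
  else τ * tj ^ (α - 1) * (τ / tj) ^ γ

theorem rpow_neg_sub_rpow_neg_le {x y β : ℝ} (hx : 0 < x) (hxy : x ≤ y) (hβ : 0 ≤ β) :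
    x ^ (-β) - y ^ (-β) ≤ β * (y - x) * x ^ (-β - 1) := by
  have hy : 0 < y := hx.trans_le hxy
  have hz : 0 < y / x := div_pos hy hx
  have h1 : 1 - β * (y / x - 1) ≤ (y / x) ^ (-β) := by
    rw [Real.rpow_def_of_pos hz]
    have h2 := Real.add_one_le_exp (Real.log (y / x) * -β)
    nlinarith [mul_le_mul_of_nonneg_left (Real.log_le_sub_one_of_pos hz) hβ]
  have hxβ : 0 < x ^ (-β) := Real.rpow_pos_of_pos hx _
  have h3 : (y / x) ^ (-β) * x ^ (-β) = y ^ (-β) := by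
    rw [← Real.mul_rpow hz.le hx.le, div_mul_cancel₀ _ hx.ne']
  rw [Real.rpow_sub_one hx.ne', ← h3]
  have h4 : β * (y - x) * (x ^ (-β) / x) = β * (y / x - 1) * x ^ (-β) := by
    field_simp
  rw [h4]
  nlinarith

/-- A primitive, in `s`, of the kernel `(t - s) ^ (-α)`. -/
noncomputable def kernelPrimitive (α t s : ℝ) : ℝ := -((t - s) ^ (1 - α) / (1 - α))

theorem integral_kernel {α t p q : ℝ} (hα : α < 1) :
    ∫ s in p..q, (t - s) ^ (-α) = kernelPrimitive α t q - kernelPrimitive α t p := by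
  rw [intervalIntegral.integral_comp_sub_left (fun x => x ^ (-α)) t,
    integral_rpow (Or.inl (by linarith)), kernelPrimitive, kernelPrimitive,
    show -α + 1 = 1 - α by ring]
  ring

theorem hasDerivAt_kernelPrimitive {α t s : ℝ} (hα : α < 1) (hs : s < t) :
    HasDerivAt (kernelPrimitive α t) ((t - s) ^ (-α)) s := by
  have h := ((((hasDerivAt_id s).const_sub t).rpow_const (p := 1 - α)
    (Or.inl (sub_pos.2 hs).ne')).div_const (1 - α)).neg
  have h1 : (1 : ℝ) - α ≠ 0 := by linarith
  refine h.congr_deriv ?_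
  simp only [id]
  rw [show 1 - α - 1 = -α by ring]
  field_simp

/-- A bounded increasing function of `u ≥ 0` whose derivative dominates
`min (u ^ (-α)) (H * u ^ (-α - 1))`. -/
noncomputable def minPrimitive (α H u : ℝ) : ℝ :=
  4 / (1 - α) * H ^ (1 - α) * (u / (u + H)) ^ (1 - α) - 4 / α * H * (u + H) ^ (-α)

/-- The derivative of `minPrimitive α H`. -/
noncomputable def minPrimitiveDeriv (α H u : ℝ) : ℝ :=
  4 * H ^ (2 - α) * u ^ (-α) * (u + H) ^ (α - 2) + 4 * H * (u + H) ^ (-α - 1)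

theorem hasDerivAt_minPrimitive {α H u : ℝ} (hα0 : 0 < α) (hα1 : α < 1) (hH : 0 < H)
    (hu : 0 < u) : HasDerivAt (minPrimitive α H) (minPrimitiveDeriv α H u) u := by
  have huH : 0 < u + H := by positivity
  have h1 : HasDerivAt (fun u : ℝ => u + H) 1 u := (hasDerivAt_id u).add_const H
  have h2 := (((hasDerivAt_id u).div h1 huH.ne').rpow_const (p := 1 - α)
    (Or.inl (div_pos hu huH).ne')).const_mul (4 / (1 - α) * H ^ (1 - α))
  have h3 := (h1.rpow_const (p := -α) (Or.inl huH.ne')).const_mul (4 / α * H)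
  refine (h2.sub h3).congr_deriv ?_
  have h4 : (1 : ℝ) - α ≠ 0 := by linarith
  simp only [id, Pi.div_apply, minPrimitiveDeriv]
  rw [show 1 - α - 1 = -α by ring, Real.div_rpow hu.le huH.le, Real.rpow_neg huH.le,
    show 2 - α = (1 - α) + 1 by ring, Real.rpow_add_one hH.ne', show α - 2 = α - (2 : ℕ) by norm_num,
    Real.rpow_sub_natCast huH.ne']
  have h5 : (u + H) ^ α ≠ 0 := (Real.rpow_pos_of_pos huH _).ne'
  field_simp
  ring

theorem min_le_minPrimitiveDeriv {α H u : ℝ} (hα0 : 0 < α) (hα1 : α < 1) (hH : 0 < H)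
    (hu : 0 < u) : min (u ^ (-α)) (H * u ^ (-α - 1)) ≤ minPrimitiveDeriv α H u := by
  have huH : 0 < u + H := by positivity
  rw [minPrimitiveDeriv]
  rcases le_total u H with h | h
  · refine (min_le_left _ _).trans ?_
    have h1 : (2 * H) ^ (α - 2) ≤ (u + H) ^ (α - 2) :=
      Real.rpow_le_rpow_of_nonpos huH (by linarith) (by linarith)
    have h2 : (2 : ℝ) ^ (-2 : ℝ) ≤ 2 ^ (α - 2) :=
      Real.rpow_le_rpow_of_exponent_le (by norm_num) (by linarith)
    rw [Real.mul_rpow (by norm_num) hH.le] at h1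
    have h3 : H ^ (2 - α) * H ^ (α - 2) = 1 := by
      rw [← Real.rpow_add hH]; simp
    have h4 : (2 : ℝ) ^ (-2 : ℝ) = 1 / 4 := by
      rw [Real.rpow_neg (by norm_num)]; norm_num
    have h5 : 0 < H ^ (α - 2) := Real.rpow_pos_of_pos hH _
    have h6 : 0 < H ^ (2 - α) := Real.rpow_pos_of_pos hH _
    have h7 : 1 / 4 ≤ H ^ (2 - α) * (u + H) ^ (α - 2) := by
      calc 1 / 4 = 1 / 4 * (H ^ (2 - α) * H ^ (α - 2)) := by rw [h3]; norm_num
        _ ≤ 2 ^ (α - 2) * (H ^ (2 - α) * H ^ (α - 2)) := by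
          rw [h4] at h2; gcongr
        _ = H ^ (2 - α) * (2 ^ (α - 2) * H ^ (α - 2)) := by ring
        _ ≤ _ := by gcongr
    have h8 : 0 < u ^ (-α) := Real.rpow_pos_of_pos hu _
    have h9 : 0 < 4 * H * (u + H) ^ (-α - 1) := by positivity
    nlinarith [mul_le_mul_of_nonneg_right h7 h8.le]
  · refine (min_le_right _ _).trans ?_
    have h1 : (2 * u) ^ (-α - 1) ≤ (u + H) ^ (-α - 1) :=
      Real.rpow_le_rpow_of_nonpos huH (by linarith) (by linarith)
    have h2 : (2 : ℝ) ^ (-2 : ℝ) ≤ 2 ^ (-α - 1) :=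
      Real.rpow_le_rpow_of_exponent_le (by norm_num) (by linarith)
    have h4 : (2 : ℝ) ^ (-2 : ℝ) = 1 / 4 := by
      rw [Real.rpow_neg (by norm_num)]; norm_num
    rw [Real.mul_rpow (by norm_num) hu.le] at h1
    rw [h4] at h2
    have h5 : 0 < u ^ (-α - 1) := Real.rpow_pos_of_pos hu _
    have h6 : 1 / 4 * u ^ (-α - 1) ≤ (u + H) ^ (-α - 1) :=
      (mul_le_mul_of_nonneg_right h2 h5.le).trans h1
    have h7 : 0 < 4 * H ^ (2 - α) * u ^ (-α) * (u + H) ^ (α - 2) := by positivity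
    nlinarith [mul_le_mul_of_nonneg_left h6 hH.le]

theorem minPrimitive_sub_le {α H u : ℝ} (hα0 : 0 < α) (hα1 : α < 1) (hH : 0 < H)
    (hu : 0 ≤ u) :
    minPrimitive α H u - minPrimitive α H 0 ≤ (4 / (1 - α) + 4 / α) * H ^ (1 - α) := by
  have h1 : 0 < 1 - α := by linarith
  have h2 : (u / (u + H)) ^ (1 - α) ≤ 1 :=
    Real.rpow_le_one (by positivity) (div_le_one_of_le₀ (by linarith) (by positivity)) h1.le
  have h3 : 0 ≤ 4 / α * H * (u + H) ^ (-α) := by positivity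
  have h4 : 4 / (1 - α) * H ^ (1 - α) * (u / (u + H)) ^ (1 - α)
      ≤ 4 / (1 - α) * H ^ (1 - α) * 1 := by gcongr
  have h5 : H ^ (1 - α) = H * H ^ (-α) := by
    rw [show 1 - α = -α + 1 by ring, Real.rpow_add_one hH.ne']; ring
  simp only [minPrimitive, zero_add, zero_div, Real.zero_rpow h1.ne', mul_zero, zero_sub]
  have h6 : 4 / α * H * H ^ (-α) = 4 / α * H ^ (1 - α) := by rw [h5]; ring
  linarith

theorem continuousOn_minPrimitive {α H : ℝ} (hα1 : α < 1) (hH : 0 < H) :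
    ContinuousOn (minPrimitive α H) (Ici 0) := by
  intro u hu
  have hu' : (0 : ℝ) ≤ u := hu
  have h : u + H ≠ 0 := by positivity
  have h1 : ContinuousAt (fun u : ℝ => u / (u + H)) u := by fun_prop (disch := exact h)
  have h2 : ContinuousAt (fun u : ℝ => u + H) u := by fun_prop
  exact ((continuousAt_const.mul (h1.rpow_const (Or.inr (by linarith)))).sub
    (continuousAt_const.mul (h2.rpow_const (Or.inl h)))).continuousWithinAt

/-- A lower primitive, in `s`, of the derivative of `s ^ (α - 1)` times `(t - s) ^ (-α)`: it is the
exact primitive corrected by a majorant of the interpolation error. -/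
noncomputable def lowerPrimitive (α μ K τ t s : ℝ) : ℝ :=
  ((t - s) / s) ^ (1 - α) / t
    + 8 * (1 + K) ^ 5 * τ ^ (2 * μ) * t ^ (-α - 1) * (s ^ (α - 2 * μ) / (2 * μ - α))
    + 16 * (1 + K) ^ 3 * t ^ (α - 3) * (K * τ ^ μ * t ^ (1 - μ))
      * minPrimitive α (K * τ ^ μ * t ^ (1 - μ)) (t - s)

/-- The majorant of the interpolation error used in `lowerPrimitive`. -/
noncomputable def interpolationMajorant (α μ K τ t s : ℝ) : ℝ :=
  8 * (1 + K) ^ 5 * τ ^ (2 * μ) * t ^ (-α - 1) * s ^ (α - 2 * μ - 1)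
    + 16 * (1 + K) ^ 3 * t ^ (α - 3) * (K * τ ^ μ * t ^ (1 - μ))
      * minPrimitiveDeriv α (K * τ ^ μ * t ^ (1 - μ)) (t - s)

theorem hasDerivAt_lowerPrimitive {α μ K τ t s : ℝ} (hα0 : 0 < α) (hα1 : α < 1)
    (hμ : α < 2 * μ) (hK : 0 < K) (hτ : 0 < τ) (hs : 0 < s) (hst : s < t) :
    HasDerivAt (lowerPrimitive α μ K τ t)
      ((α - 1) * s ^ (α - 2) * (t - s) ^ (-α) - interpolationMajorant α μ K τ t s) s := by
  have ht : 0 < t := hs.trans hst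
  have hu : 0 < t - s := sub_pos.2 hst
  have hH : 0 < K * τ ^ μ * t ^ (1 - μ) := by positivity
  have hsub : HasDerivAt (fun s : ℝ => t - s) (-1) s := (hasDerivAt_id s).const_sub t
  have h1 := ((hsub.div (hasDerivAt_id s) hs.ne').rpow_const (p := 1 - α)
    (Or.inl (div_pos hu hs).ne')).div_const t
  have h2 := (((hasDerivAt_id s).rpow_const (p := α - 2 * μ) (Or.inl hs.ne')).div_const
    (2 * μ - α)).const_mul (8 * (1 + K) ^ 5 * τ ^ (2 * μ) * t ^ (-α - 1))
  have h3 := ((hasDerivAt_minPrimitive hα0 hα1 hH hu).comp s hsub).const_mul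
    (16 * (1 + K) ^ 3 * t ^ (α - 3) * (K * τ ^ μ * t ^ (1 - μ)))
  refine ((h1.add h2).add h3).congr_deriv ?_
  have h4 : 2 * μ - α ≠ 0 := by linarith
  simp only [id, Pi.div_apply, interpolationMajorant]
  have h5 : ((-1 * s - (t - s) * 1) / s ^ 2 * (1 - α) * ((t - s) / s) ^ (1 - α - 1)) / t
      = (α - 1) * s ^ (α - 2) * (t - s) ^ (-α) := by
    rw [show 1 - α - 1 = -α by ring, Real.div_rpow hu.le hs.le, Real.rpow_neg hs.le,
      show α - 2 = α - (2 : ℕ) by norm_num, Real.rpow_sub_natCast hs.ne']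
    have h6 : s ^ α ≠ 0 := (Real.rpow_pos_of_pos hs _).ne'
    field_simp
    ring
  rw [h5]
  field_simp
  ring

theorem continuousOn_lowerPrimitive {α μ K τ t p q : ℝ} (hα1 : α < 1)
    (hK : 0 < K) (hτ : 0 < τ) (hp : 0 < p) (ht : 0 < t) (hqt : q ≤ t) :
    ContinuousOn (lowerPrimitive α μ K τ t) (Icc p q) := by
  have hH : 0 < K * τ ^ μ * t ^ (1 - μ) := by positivity
  have hne : ∀ s ∈ Icc p q, s ≠ 0 := fun s hs => (hp.trans_le hs.1).ne'
  have h1 : ContinuousOn (fun s => ((t - s) / s) ^ (1 - α) / t) (Icc p q) :=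
    (ContinuousOn.rpow_const ((continuousOn_const.sub continuousOn_id).div continuousOn_id hne)
      fun s _ => Or.inr (by linarith)).div_const t
  have h2 : ContinuousOn (fun s : ℝ => s ^ (α - 2 * μ) / (2 * μ - α)) (Icc p q) :=
    (ContinuousOn.rpow_const continuousOn_id fun s hs => Or.inl (hne s hs)).div_const _
  have h3 : ContinuousOn (fun s => minPrimitive α (K * τ ^ μ * t ^ (1 - μ)) (t - s)) (Icc p q) :=
    (continuousOn_minPrimitive hα1 hH).comp (continuousOn_const.sub continuousOn_id)
      fun s hs => sub_nonneg.2 (hs.2.trans hqt)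
  exact (h1.add (continuousOn_const.mul h2)).add (continuousOn_const.mul h3)

theorem mul_sub_le_interpolationMajorant {α μ K τ t p s : ℝ} (hα0 : 0 < α) (hα1 : α < 1)
    (hμ0 : 0 < μ) (hμ1 : μ < 1) (hK : 0 < K) (hτ : 0 < τ) (hτp : τ ≤ p)
    (hps : p < s) (hst : s < t) (hstep : s - p ≤ K * τ ^ μ * p ^ (1 - μ)) :
    (1 - α) * (p ^ (α - 2) - s ^ (α - 2)) * ((t - s) ^ (-α) - (t - p) ^ (-α))
      ≤ interpolationMajorant α μ K τ t s := by
  have hp : 0 < p := hτ.trans_le hτp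
  have hs : 0 < s := hp.trans hps
  have ht : 0 < t := hs.trans hst
  have hu : 0 < t - s := sub_pos.2 hst
  have hH : 0 < K * τ ^ μ * t ^ (1 - μ) := by positivity
  have hHs : 0 < K * τ ^ μ * s ^ (1 - μ) := by positivity
  have hstep' : s - p ≤ K * τ ^ μ * s ^ (1 - μ) := by
    refine hstep.trans ?_
    gcongr
  have hs_le : s ≤ (1 + K) * p := by
    have h1 : τ ^ μ * p ^ (1 - μ) ≤ p ^ μ * p ^ (1 - μ) := by gcongr
    rw [← Real.rpow_add hp, show μ + (1 - μ) = 1 by ring, Real.rpow_one] at h1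
    nlinarith [mul_le_mul_of_nonneg_left h1 hK.le]
  have hcurv : (1 - α) * (p ^ (α - 2) - s ^ (α - 2))
      ≤ 2 * (1 + K) ^ 3 * s ^ (α - 3) * (K * τ ^ μ * s ^ (1 - μ)) := by
    have h1 := rpow_neg_sub_rpow_neg_le (β := 2 - α) hp hps.le (by linarith)
    rw [show -(2 - α) = α - 2 by ring, show α - 2 - 1 = α - 3 by ring] at h1
    have h2 : p ^ (α - 3) ≤ (1 + K) ^ 3 * s ^ (α - 3) := by
      have h3 : (s / (1 + K)) ≤ p := by rw [div_le_iff₀ (by positivity)]; linarith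
      have h4 : p ^ (α - 3) ≤ (s / (1 + K)) ^ (α - 3) :=
        Real.rpow_le_rpow_of_nonpos (by positivity) h3 (by linarith)
      have h5 : (1 + K) ^ (3 - α) ≤ (1 + K) ^ (3 : ℝ) :=
        Real.rpow_le_rpow_of_exponent_le (by linarith) (by linarith)
      rw [Real.div_rpow hs.le (by positivity), div_eq_mul_inv,
        ← Real.rpow_neg (by positivity), show -(α - 3) = 3 - α by ring] at h4
      refine h4.trans ?_
      rw [mul_comm]
      gcongr
      exact_mod_cast h5
    have h6 : 0 < p ^ (α - 3) := Real.rpow_pos_of_pos hp _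
    calc (1 - α) * (p ^ (α - 2) - s ^ (α - 2))
        ≤ (1 - α) * ((2 - α) * (s - p) * p ^ (α - 3)) := by
          have : 0 ≤ 1 - α := by linarith
          gcongr
      _ = (1 - α) * (2 - α) * ((s - p) * p ^ (α - 3)) := by ring
      _ ≤ 2 * ((s - p) * p ^ (α - 3)) := by
          have : 0 ≤ (s - p) * p ^ (α - 3) := mul_nonneg (by linarith) h6.le
          gcongr
          nlinarith
      _ ≤ 2 * ((K * τ ^ μ * s ^ (1 - μ)) * ((1 + K) ^ 3 * s ^ (α - 3))) := by gcongr
      _ = _ := by ring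
  have hD0 : 0 ≤ (t - s) ^ (-α) - (t - p) ^ (-α) :=
    sub_nonneg.2 (Real.rpow_le_rpow_of_nonpos hu (by linarith) (by linarith))
  have hD1 : (t - s) ^ (-α) - (t - p) ^ (-α) ≤ (t - s) ^ (-α) := by
    have : 0 < (t - p) ^ (-α) := Real.rpow_pos_of_pos (by linarith) _
    linarith
  have hD2 : (t - s) ^ (-α) - (t - p) ^ (-α)
      ≤ K * τ ^ μ * s ^ (1 - μ) * (t - s) ^ (-α - 1) := by
    refine (rpow_neg_sub_rpow_neg_le hu (by linarith) hα0.le).trans ?_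
    have h1 : α * (t - p - (t - s)) ≤ K * τ ^ μ * s ^ (1 - μ) := by nlinarith
    gcongr
  have hcoef : 0 ≤ 2 * (1 + K) ^ 3 * s ^ (α - 3) * (K * τ ^ μ * s ^ (1 - μ)) := by positivity
  refine (mul_le_mul_of_nonneg_right hcurv hD0).trans ?_
  rw [interpolationMajorant]
  have hmin := min_le_minPrimitiveDeriv hα0 hα1 hH hu
  rcases le_total s (t / 2) with h | h
  · have hpos : 0 ≤ minPrimitiveDeriv α (K * τ ^ μ * t ^ (1 - μ)) (t - s) :=
      (le_min (by positivity) (by positivity)).trans hmin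
    have h1 : (t - s) ^ (-α - 1) ≤ 4 * t ^ (-α - 1) := by
      have h2 : (t - s) ^ (-α - 1) ≤ (t * (1 / 2)) ^ (-α - 1) :=
        Real.rpow_le_rpow_of_nonpos (by positivity) (by linarith) (by linarith)
      have h3 : (1 / 2 : ℝ) ^ (-α - 1) ≤ (1 / 2) ^ (-2 : ℝ) :=
        Real.rpow_le_rpow_of_exponent_ge (by norm_num) (by norm_num) (by linarith)
      have h4 : (1 / 2 : ℝ) ^ (-2 : ℝ) = 4 := by
        rw [Real.rpow_neg (by norm_num)]; norm_num
      rw [Real.mul_rpow ht.le (by norm_num)] at h2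
      refine h2.trans ?_
      rw [mul_comm, ← h4]
      gcongr
    have h5 : s ^ (α - 3) * s ^ (1 - μ) * s ^ (1 - μ) = s ^ (α - 2 * μ - 1) := by
      rw [← Real.rpow_add hs, ← Real.rpow_add hs]; ring_nf
    have h6 : τ ^ μ * τ ^ μ = τ ^ (2 * μ) := by
      rw [← Real.rpow_add hτ]; ring_nf
    have h7 : (1 + K) ^ 3 * K ^ 2 ≤ (1 + K) ^ 5 := by
      rw [show (1 + K) ^ 5 = (1 + K) ^ 3 * (1 + K) ^ 2 by ring]
      gcongr
      linarith
    refine le_add_of_le_of_nonneg ?_ (by positivity)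
    calc 2 * (1 + K) ^ 3 * s ^ (α - 3) * (K * τ ^ μ * s ^ (1 - μ))
          * ((t - s) ^ (-α) - (t - p) ^ (-α))
        ≤ 2 * (1 + K) ^ 3 * s ^ (α - 3) * (K * τ ^ μ * s ^ (1 - μ))
          * (K * τ ^ μ * s ^ (1 - μ) * (4 * t ^ (-α - 1))) := by
          refine mul_le_mul_of_nonneg_left (hD2.trans ?_) hcoef
          gcongr
      _ = 8 * ((1 + K) ^ 3 * K ^ 2) * (τ ^ μ * τ ^ μ) * t ^ (-α - 1)
          * (s ^ (α - 3) * s ^ (1 - μ) * s ^ (1 - μ)) := by ring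
      _ ≤ _ := by
          rw [h5, h6]
          gcongr
  · have h1 : s ^ (α - 3) ≤ 8 * t ^ (α - 3) := by
      have h2 : s ^ (α - 3) ≤ (t * (1 / 2)) ^ (α - 3) :=
        Real.rpow_le_rpow_of_nonpos (by positivity) (by linarith) (by linarith)
      have h3 : (1 / 2 : ℝ) ^ (α - 3) ≤ (1 / 2) ^ (-3 : ℝ) :=
        Real.rpow_le_rpow_of_exponent_ge (by norm_num) (by norm_num) (by linarith)
      have h4 : (1 / 2 : ℝ) ^ (-3 : ℝ) = 8 := by
        rw [Real.rpow_neg (by norm_num)]; norm_num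
      rw [Real.mul_rpow ht.le (by norm_num)] at h2
      refine h2.trans ?_
      rw [mul_comm, ← h4]
      gcongr
    have h5 : K * τ ^ μ * s ^ (1 - μ) ≤ K * τ ^ μ * t ^ (1 - μ) := by
      gcongr
    refine le_add_of_nonneg_of_le (by positivity) ?_
    have h6 : (t - s) ^ (-α) - (t - p) ^ (-α)
        ≤ minPrimitiveDeriv α (K * τ ^ μ * t ^ (1 - μ)) (t - s) := by
      refine le_trans (le_min hD1 (hD2.trans ?_)) hmin
      gcongr
    calc 2 * (1 + K) ^ 3 * s ^ (α - 3) * (K * τ ^ μ * s ^ (1 - μ))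
          * ((t - s) ^ (-α) - (t - p) ^ (-α))
        ≤ 2 * (1 + K) ^ 3 * (8 * t ^ (α - 3)) * (K * τ ^ μ * t ^ (1 - μ))
          * minPrimitiveDeriv α (K * τ ^ μ * t ^ (1 - μ)) (t - s) := by gcongr
      _ = _ := by ring

theorem lowerPrimitive_sub_le {α μ K τ t p q : ℝ} (hα0 : 0 < α) (hα1 : α < 1)
    (hμ : α < 2 * μ) (hμ1 : μ < 1) (hK : 0 < K) (hτ : 0 < τ) (hτp : τ ≤ p)
    (hpq : p < q) (hqt : q ≤ t) (hstep : q - p ≤ K * τ ^ μ * p ^ (1 - μ)) :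
    lowerPrimitive α μ K τ t q - lowerPrimitive α μ K τ t p
      ≤ (q ^ (α - 1) - p ^ (α - 1)) / (q - p)
        * (kernelPrimitive α t q - kernelPrimitive α t p) := by
  have hp : 0 < p := hτ.trans_le hτp
  have ht : 0 < t := hp.trans (hpq.trans_le hqt)
  set σ := (q ^ (α - 1) - p ^ (α - 1)) / (q - p) with hσ
  have hσ_mul : σ * (q - p) = q ^ (α - 1) - p ^ (α - 1) :=
    div_mul_cancel₀ _ (sub_pos.2 hpq).ne'
  have hσ_ge : (α - 1) * p ^ (α - 2) ≤ σ := by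
    rw [hσ, le_div_iff₀ (sub_pos.2 hpq)]
    have h1 := rpow_neg_sub_rpow_neg_le (β := 1 - α) hp hpq.le (by linarith)
    rw [show -(1 - α) = α - 1 by ring, show α - 1 - 1 = α - 2 by ring] at h1
    linarith
  have hmono : MonotoneOn (fun s => σ * kernelPrimitive α t s - lowerPrimitive α μ K τ t s
      - (t - p) ^ (-α) * (σ * s - s ^ (α - 1))) (Icc p q) := by
    have hcW : ContinuousOn (kernelPrimitive α t) (Icc p q) := by
      have h1 : Continuous fun s : ℝ => (t - s) ^ (1 - α) :=
        (continuous_const.sub continuous_id).rpow_const fun _ => Or.inr (by linarith)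
      exact (h1.div_const _).neg.continuousOn
    have hcψ : ContinuousOn (fun s : ℝ => s ^ (α - 1)) (Icc p q) :=
      ContinuousOn.rpow_const continuousOn_id fun s hs => Or.inl (hp.trans_le hs.1).ne'
    refine monotoneOn_of_hasDerivWithinAt_nonneg (convex_Icc p q)
      (((continuousOn_const.mul hcW).sub
        (continuousOn_lowerPrimitive hα1 hK hτ hp ht hqt)).sub
        (continuousOn_const.mul ((continuousOn_const.mul continuousOn_id).sub hcψ)))
      (f' := fun s => σ * (t - s) ^ (-α)
        - ((α - 1) * s ^ (α - 2) * (t - s) ^ (-α) - interpolationMajorant α μ K τ t s)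
        - (t - p) ^ (-α) * (σ - (α - 1) * s ^ (α - 2))) ?_ ?_
    · intro s hs
      rw [interior_Icc] at hs
      have hs0 : 0 < s := hp.trans hs.1
      have hst : s < t := hs.2.trans_le hqt
      have h1 := (hasDerivAt_kernelPrimitive hα1 hst).const_mul σ
      have h2 := hasDerivAt_lowerPrimitive hα0 hα1 hμ hK hτ hs0 hst
      have h3 := (((hasDerivAt_id s).const_mul σ).sub
        (Real.hasDerivAt_rpow_const (p := α - 1) (Or.inl hs0.ne'))).const_mul ((t - p) ^ (-α))
      rw [mul_one, show α - 1 - 1 = α - 2 by ring] at h3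
      exact ((h1.sub h2).sub h3).hasDerivWithinAt
    · intro s hs
      rw [interior_Icc] at hs
      have hst : s < t := hs.2.trans_le hqt
      have h1 := mul_sub_le_interpolationMajorant hα0 hα1 (by linarith) hμ1 hK hτ hτp hs.1 hst
        (by linarith [hs.2] : s - p ≤ K * τ ^ μ * p ^ (1 - μ))
      have h2 : 0 ≤ (t - s) ^ (-α) - (t - p) ^ (-α) :=
        sub_nonneg.2 (Real.rpow_le_rpow_of_nonpos (by linarith) (by linarith [hs.1])
          (by linarith))
      have h3 := mul_le_mul_of_nonneg_right hσ_ge h2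
      linarith
  have h := hmono (left_mem_Icc.2 hpq.le) (right_mem_Icc.2 hpq.le) hpq.le
  have h4 : (t - p) ^ (-α) * (σ * q - q ^ (α - 1))
      = (t - p) ^ (-α) * (σ * p - p ^ (α - 1)) := by
    rw [show σ * q - q ^ (α - 1) = σ * p - p ^ (α - 1) by linarith]
  simp only at h
  linarith

theorem le_lowerPrimitive_sub {α K τ t a : ℝ} (hα0 : 0 < α) (hα1 : α < 1)
    (hK : 0 < K) (hτ : 0 < τ) (hτa : τ ≤ a) (hat : a ≤ t) :
    -(((t - a) / a) ^ (1 - α) / t)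
        - (8 * (1 + K) ^ 5 / (2 * (α / (2 - α)) - α)
          + 16 * (1 + K) ^ 3 * (4 / (1 - α) + 4 / α) * K ^ (2 - α)) * (τ ^ α * t ^ (-α - 1))
      ≤ lowerPrimitive α (α / (2 - α)) K τ t t - lowerPrimitive α (α / (2 - α)) K τ t a := by
  have ha : 0 < a := hτ.trans_le hτa
  have ht : 0 < t := ha.trans_le hat
  have h2α : 0 < 2 - α := by linarith
  have h1α : 0 < 1 - α := by linarith
  set μ := α / (2 - α) with hμdef
  have hμmul : μ * (2 - α) = α := div_mul_cancel₀ _ h2α.ne'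
  have hμ0 : 0 < μ := by positivity
  have hκ : 0 < 2 * μ - α := by nlinarith
  have hH : 0 < K * τ ^ μ * t ^ (1 - μ) := by positivity
  have hfar : τ ^ (2 * μ) * a ^ (α - 2 * μ) ≤ τ ^ α := by
    have h1 : a ^ (α - 2 * μ) ≤ τ ^ (α - 2 * μ) :=
      Real.rpow_le_rpow_of_nonpos hτ hτa (by linarith)
    calc τ ^ (2 * μ) * a ^ (α - 2 * μ) ≤ τ ^ (2 * μ) * τ ^ (α - 2 * μ) := by gcongr
      _ = τ ^ α := by rw [← Real.rpow_add hτ]; ring_nf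
  have hnear : t ^ (α - 3) * ((K * τ ^ μ * t ^ (1 - μ)) * (K * τ ^ μ * t ^ (1 - μ)) ^ (1 - α))
      = K ^ (2 - α) * (τ ^ α * t ^ (-α - 1)) := by
    rw [mul_comm (K * τ ^ μ * t ^ (1 - μ)), ← Real.rpow_add_one hH.ne',
      show 1 - α + 1 = 2 - α by ring, Real.mul_rpow (by positivity) (by positivity),
      Real.mul_rpow hK.le (by positivity), ← Real.rpow_mul hτ.le, ← Real.rpow_mul ht.le,
      hμmul, show (1 - μ) * (2 - α) = 2 - 2 * α by linarith,
      show -α - 1 = (α - 3) + (2 - 2 * α) by ring, Real.rpow_add ht]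
    ring
  have hmin := minPrimitive_sub_le hα0 hα1 hH (sub_nonneg.2 hat)
  have hpos : 0 ≤ 16 * (1 + K) ^ 3 * t ^ (α - 3) * (K * τ ^ μ * t ^ (1 - μ)) := by positivity
  have h1 := mul_le_mul_of_nonneg_left hmin hpos
  have h2 : 16 * (1 + K) ^ 3 * t ^ (α - 3) * (K * τ ^ μ * t ^ (1 - μ))
      * ((4 / (1 - α) + 4 / α) * (K * τ ^ μ * t ^ (1 - μ)) ^ (1 - α))
      = 16 * (1 + K) ^ 3 * (4 / (1 - α) + 4 / α) * K ^ (2 - α) * (τ ^ α * t ^ (-α - 1)) := by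
    rw [mul_assoc _ (K ^ (2 - α)), ← hnear]; ring
  have h3 : 8 * (1 + K) ^ 5 * τ ^ (2 * μ) * t ^ (-α - 1) * (a ^ (α - 2 * μ) / (2 * μ - α))
      ≤ 8 * (1 + K) ^ 5 / (2 * μ - α) * (τ ^ α * t ^ (-α - 1)) := by
    calc _ = 8 * (1 + K) ^ 5 / (2 * μ - α) * (τ ^ (2 * μ) * a ^ (α - 2 * μ) * t ^ (-α - 1)) := by
          ring
      _ ≤ _ := by gcongr
  have h4 : 0 ≤ 8 * (1 + K) ^ 5 * τ ^ (2 * μ) * t ^ (-α - 1)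
      * (t ^ (α - 2 * μ) / (2 * μ - α)) := by positivity
  rw [lowerPrimitive, lowerPrimitive, sub_self, zero_div, Real.zero_rpow h1α.ne', zero_div]
  linarith

theorem caputo_barrier_lower_bound {α t a : ℝ} (hα0 : 0 < α) (hα1 : α < 1)
    (ha : 0 < a) (hat : a ≤ t) :
    (1 - α) * (a ^ α * t ^ (-α - 1))
      ≤ a ^ (α - 2) * (kernelPrimitive α t a - kernelPrimitive α t 0)
        - ((t - a) / a) ^ (1 - α) / t := by
  have ht : 0 < t := ha.trans_le hat
  have h1α : 0 < 1 - α := by linarith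
  set x := a / t with hx
  have hx0 : 0 < x := div_pos ha ht
  have hx1 : x ≤ 1 := div_le_one_of_le₀ hat ht.le
  have hax : a = x * t := by rw [hx]; field_simp
  have hber : (1 - x) ^ (1 - α) ≤ 1 - (1 - α) * x := by
    have := rpow_one_add_le_one_add_mul_self (s := -x) (by linarith) h1α.le
      (by linarith : 1 - α ≤ 1)
    rw [← sub_eq_add_neg] at this
    linarith
  have h1 : a ^ α * t ^ (-α - 1) = x ^ α / t := by
    rw [hax, Real.mul_rpow hx0.le ht.le, show -α - 1 = -α + -1 by ring, Real.rpow_add ht,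
      Real.rpow_neg ht.le, Real.rpow_neg_one]
    have : t ^ α ≠ 0 := (Real.rpow_pos_of_pos ht _).ne'
    field_simp
  have h2 : ((t - a) / a) ^ (1 - α) / t = x ^ (α - 2) / t * (x * (1 - x) ^ (1 - α)) := by
    rw [show (t - a) / a = (1 - x) / x by rw [hax]; field_simp,
      Real.div_rpow (by linarith) hx0.le, show α - 2 = -(1 - α) - 1 by ring,
      Real.rpow_sub_one hx0.ne', Real.rpow_neg hx0.le]
    have : x ^ (1 - α) ≠ 0 := (Real.rpow_pos_of_pos hx0 _).ne'
    field_simp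
  have h3 : a ^ (α - 2) * (kernelPrimitive α t a - kernelPrimitive α t 0)
      = x ^ (α - 2) / t * ((1 - (1 - x) ^ (1 - α)) / (1 - α)) := by
    rw [kernelPrimitive, kernelPrimitive, sub_zero,
      show t - a = t * (1 - x) by rw [hax]; ring, Real.mul_rpow ht.le (by linarith), hax,
      Real.mul_rpow hx0.le ht.le, show α - 2 = -(1 - α) - 1 by ring, Real.rpow_sub_one ht.ne',
      Real.rpow_neg ht.le]
    have : t ^ (1 - α) ≠ 0 := (Real.rpow_pos_of_pos ht _).ne'
    field_simp
    ring
  have h4 : x ^ α = x ^ (α - 2) * x ^ 2 := by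
    rw [← Real.rpow_natCast x 2, ← Real.rpow_add hx0]; norm_num
  rw [h1, h2, h3, h4]
  have h5 : x ≤ (1 - (1 - x) ^ (1 - α)) / (1 - α) := by
    rw [le_div_iff₀ h1α]; linarith
  have h6 : x * (1 - x) ^ (1 - α) ≤ x * (1 - (1 - α) * x) := by gcongr
  have h7 : (1 - α) * x ^ 2 ≤ (1 - (1 - x) ^ (1 - α)) / (1 - α) - x * (1 - x) ^ (1 - α) := by
    linarith
  have h8 : 0 ≤ x ^ (α - 2) / t := by positivity
  calc _ = x ^ (α - 2) / t * ((1 - α) * x ^ 2) := by ring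
    _ ≤ x ^ (α - 2) / t
        * ((1 - (1 - x) ^ (1 - α)) / (1 - α) - x * (1 - x) ^ (1 - α)) := by gcongr
    _ = _ := by ring

/-- The barrier: `s ^ (α - 1)` for `s > a`, continued linearly to `0` on `[0, a]`. -/
noncomputable def barrier (α a s : ℝ) : ℝ := if s ≤ a then a ^ (α - 2) * s else s ^ (α - 1)

theorem barrier_of_le {α a s : ℝ} (h : s ≤ a) : barrier α a s = a ^ (α - 2) * s := if_pos h

theorem barrier_of_ge {α a s : ℝ} (ha : 0 < a) (h : a ≤ s) : barrier α a s = s ^ (α - 1) := by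
  rcases h.eq_or_lt with rfl | h
  · rw [barrier_of_le le_rfl, ← Real.rpow_add_one ha.ne', show α - 2 + 1 = α - 1 by ring]
  · exact if_neg h.not_ge

theorem barrier_nonneg {α a s : ℝ} (ha : 0 < a) (hs : 0 < s) : 0 ≤ barrier α a s := by
  rw [barrier]
  split_ifs <;> positivity

theorem barrier_le {α a s : ℝ} (hα1 : α < 1) (hs : 0 < s) :
    barrier α a s ≤ s ^ (α - 1) := by
  rw [barrier]
  split_ifs with h
  · have h1 : a ^ (α - 2) ≤ s ^ (α - 2) :=
      Real.rpow_le_rpow_of_nonpos hs h (by linarith)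
    calc a ^ (α - 2) * s ≤ s ^ (α - 2) * s := by gcongr
      _ = s ^ (α - 1) := by rw [← Real.rpow_add_one hs.ne', show α - 2 + 1 = α - 1 by ring]
  · exact le_rfl

theorem IsMesh.lt {T : ℝ} {M : ℕ} {t : ℕ → ℝ} (h : IsMesh T M t) {i j : ℕ} (hij : i < j)
    (hj : j ≤ M) : t i < t j := by
  induction j, hij using Nat.le_induction with
  | base => exact h.2.2.1 i (by omega)
  | succ n hn ih => exact (ih (by omega)).trans (h.2.2.1 n (by omega))

theorem IsMesh.le {T : ℝ} {M : ℕ} {t : ℕ → ℝ} (h : IsMesh T M t) {i j : ℕ} (hij : i ≤ j)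
    (hj : j ≤ M) : t i ≤ t j := by
  rcases hij.eq_or_lt with rfl | hij
  · exact le_rfl
  · exact (h.lt hij hj).le

theorem IsMesh.pos {T : ℝ} {M : ℕ} {t : ℕ → ℝ} (h : IsMesh T M t) {j : ℕ} (hj1 : 1 ≤ j)
    (hj : j ≤ M) : 0 < t j := h.2.1 ▸ h.lt hj1 hj

theorem IsMesh.lt_of_lt {T : ℝ} {M : ℕ} {t : ℕ → ℝ} (h : IsMesh T M t) {i j : ℕ}
    (hi : i ≤ M) (hij : t i < t j) : i < j := by
  by_contra! hji
  exact (h.le hji hi).not_gt hij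

theorem sum_barrier_linear {T α a θ : ℝ} {N n : ℕ} {t : ℕ → ℝ} (hα1 : α < 1)
    (ht : IsMesh T N t) (hn : n ≤ N) (hna : t n ≤ a) :
    ∑ j ∈ Finset.Icc 1 n, ((barrier α a (t j) - barrier α a (t (j - 1))) / (t j - t (j - 1)))
        * ∫ s in (t (j - 1))..(t j), (θ - s) ^ (-α)
      = a ^ (α - 2) * (kernelPrimitive α θ (t n) - kernelPrimitive α θ 0) := by
  induction n with
  | zero => simp [ht.2.1]
  | succ n ih =>
    have hlt : t n < t (n + 1) := ht.lt n.lt_succ_self hn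
    rw [Finset.sum_Icc_succ_top (by omega), ih (by omega) (by linarith), Nat.add_sub_cancel,
      barrier_of_le hna, barrier_of_le (hlt.le.trans hna), integral_kernel hα1, ← mul_sub,
      mul_div_cancel_right₀ _ (sub_pos.2 hlt).ne']
    ring

theorem le_sum_barrier {T α μ K τ θ : ℝ} {N k n : ℕ} {t : ℕ → ℝ} (hα0 : 0 < α) (hα1 : α < 1)
    (hμ : α < 2 * μ) (hμ1 : μ < 1) (hK : 0 < K) (hτ : 0 < τ) (ht : IsMesh T N t)
    (hτk : τ ≤ t k) (hkn : k ≤ n) (hn : n ≤ N) (hnθ : t n ≤ θ)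
    (hstep : ∀ j, k ≤ j → j < n → t (j + 1) - t j ≤ K * τ ^ μ * t j ^ (1 - μ)) :
    t k ^ (α - 2) * (kernelPrimitive α θ (t k) - kernelPrimitive α θ 0)
        + (lowerPrimitive α μ K τ θ (t n) - lowerPrimitive α μ K τ θ (t k))
      ≤ ∑ j ∈ Finset.Icc 1 n,
          ((barrier α (t k) (t j) - barrier α (t k) (t (j - 1))) / (t j - t (j - 1)))
            * ∫ s in (t (j - 1))..(t j), (θ - s) ^ (-α) := by
  induction n, hkn using Nat.le_induction with
  | base => rw [sum_barrier_linear hα1 ht hn le_rfl]; simp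
  | succ n hkn ih =>
    have hlt : t n < t (n + 1) := ht.lt n.lt_succ_self hn
    have hle : t k ≤ t n := ht.le hkn (by omega)
    have hk : 0 < t k := hτ.trans_le hτk
    have h1 := ih (by omega) (by linarith) fun j hj hjn => hstep j hj (by omega)
    have h2 := lowerPrimitive_sub_le hα0 hα1 hμ hμ1 hK hτ (hτk.trans hle) hlt hnθ
      (hstep n hkn n.lt_succ_self)
    rw [Finset.sum_Icc_succ_top (by omega), Nat.add_sub_cancel, barrier_of_ge hk hle,
      barrier_of_ge hk (hle.trans hlt.le), integral_kernel hα1]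
    linarith

theorem QuasiGraded.refined_step_le {α r c0 C0 T : ℝ} {M M' : ℕ} {t t' : ℕ → ℝ}
    (hα0 : 0 < α) (hα1 : α < 1) (hr1 : 1 ≤ r) (hr2 : r ≤ (2 - α) / α)
    (hc0 : 0 < c0) (hcC : c0 ≤ C0) (ht : IsMesh T M t) (hq : QuasiGraded r c0 C0 M t)
    (ht' : IsMesh T M' t') (hsub : ∀ j : ℕ, j ≤ M → ∃ k : ℕ, k ≤ M' ∧ t' k = t j)
    {j : ℕ} (hj : j < M') (h1j : t 1 ≤ t' j) :
    t' (j + 1) - t' j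
      ≤ C0 * (C0 / c0 * 2 ^ r) * t 1 ^ (α / (2 - α)) * t' j ^ (1 - α / (2 - α)) := by
  have hC0 : 0 < C0 := hc0.trans_le hcC
  have hM : 2 ≤ M := ht.1
  have hτ : 0 < t 1 := ht.pos le_rfl (by omega)
  have hp : 0 < t' j := hτ.trans_le h1j
  have hlt : t' j < t' (j + 1) := ht'.lt j.lt_succ_self hj
  have hex : ∃ i, i ≤ M ∧ t' (j + 1) ≤ t i := by
    refine ⟨M, le_rfl, ?_⟩
    rw [ht.2.2.2, ← ht'.2.2.2]
    exact ht'.le hj le_rfl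
  classical
  obtain ⟨i, ⟨hiM, hi⟩, hmin⟩ : ∃ i, (i ≤ M ∧ t' (j + 1) ≤ t i) ∧
      ∀ n < i, ¬(n ≤ M ∧ t' (j + 1) ≤ t n) :=
    ⟨Nat.find hex, Nat.find_spec hex, fun _ => Nat.find_min hex⟩
  have hi1 : 1 < i := ht.lt_of_lt (by omega) (by linarith)
  obtain ⟨l, rfl⟩ : ∃ l, i = l + 1 := ⟨i - 1, by omega⟩
  have hl : t l < t' (j + 1) := by
    by_contra! h
    exact hmin l l.lt_succ_self ⟨by omega, h⟩
  obtain ⟨k, hk, hkl⟩ := hsub l (by omega)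
  have hlj : t l ≤ t' j := by
    have h1 : k < j + 1 := ht'.lt_of_lt hk (hkl ▸ hl)
    rw [← hkl]
    exact ht'.le (by omega) hj.le
  have hlow := (hq.2.1 l (by omega) (by omega)).1
  have hupp := (hq.2.1 (l + 1) (by omega) hiM).2
  have hstep := (hq.2.2 (l + 1) (by omega) hiM).2
  rw [Nat.add_sub_cancel] at hstep
  have h2r : (1 : ℝ) ≤ C0 / c0 * 2 ^ r := by
    have h1 : 1 ≤ C0 / c0 := by rwa [one_le_div hc0]
    have h2 : (1 : ℝ) ≤ 2 ^ r := Real.one_le_rpow (by norm_num) (by linarith)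
    nlinarith
  have hratio : t (l + 1) ≤ C0 / c0 * 2 ^ r * t' j := by
    have h1 : ((l + 1 : ℕ) : ℝ) ^ r ≤ 2 ^ r * (l : ℝ) ^ r := by
      rw [← Real.mul_rpow (by norm_num) (by positivity)]
      refine Real.rpow_le_rpow (by positivity) ?_ (by linarith)
      exact_mod_cast (by omega : l + 1 ≤ 2 * l)
    calc t (l + 1) ≤ C0 * (t 1 * ((l + 1 : ℕ) : ℝ) ^ r) := hupp
      _ ≤ C0 * (t 1 * (2 ^ r * (l : ℝ) ^ r)) := by gcongr
      _ = C0 / c0 * 2 ^ r * (c0 * (t 1 * (l : ℝ) ^ r)) := by field_simp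
      _ ≤ C0 / c0 * 2 ^ r * t' j := by gcongr; linarith
  have hr0 : 0 < r := by linarith
  have hir : 1 / r ≤ 1 := by rw [div_le_one hr0]; exact hr1
  have hμr : α / (2 - α) ≤ 1 / r := by
    rw [div_le_div_iff₀ (by linarith) hr0]
    rw [le_div_iff₀ hα0] at hr2
    linarith
  have hpow : t (l + 1) ^ (1 - 1 / r) ≤ C0 / c0 * 2 ^ r * t' j ^ (1 - 1 / r) := by
    calc t (l + 1) ^ (1 - 1 / r) ≤ (C0 / c0 * 2 ^ r * t' j) ^ (1 - 1 / r) :=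
          Real.rpow_le_rpow (ht.pos (by omega) hiM).le hratio (by linarith)
      _ = (C0 / c0 * 2 ^ r) ^ (1 - 1 / r) * t' j ^ (1 - 1 / r) :=
          Real.mul_rpow (by positivity) hp.le
      _ ≤ (C0 / c0 * 2 ^ r) ^ (1 : ℝ) * t' j ^ (1 - 1 / r) := by
          have : 0 < 1 / r := by positivity
          gcongr
          linarith
      _ = _ := by rw [Real.rpow_one]
  have hexch : t 1 ^ (1 / r) * t' j ^ (1 - 1 / r)
      ≤ t 1 ^ (α / (2 - α)) * t' j ^ (1 - α / (2 - α)) := by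
    set μ := α / (2 - α)
    calc t 1 ^ (1 / r) * t' j ^ (1 - 1 / r)
        = t 1 ^ μ * t 1 ^ (1 / r - μ) * t' j ^ (1 - 1 / r) := by
          rw [← Real.rpow_add hτ]; ring_nf
      _ ≤ t 1 ^ μ * t' j ^ (1 / r - μ) * t' j ^ (1 - 1 / r) := by
          gcongr
      _ = t 1 ^ μ * t' j ^ (1 - μ) := by
          rw [mul_assoc, ← Real.rpow_add hp]; ring_nf
  calc t' (j + 1) - t' j ≤ C0 * (t 1 ^ (1 / r) * t (l + 1) ^ (1 - 1 / r)) := by linarith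
    _ ≤ C0 * (t 1 ^ (1 / r) * (C0 / c0 * 2 ^ r * t' j ^ (1 - 1 / r))) := by gcongr
    _ = C0 * (C0 / c0 * 2 ^ r) * (t 1 ^ (1 / r) * t' j ^ (1 - 1 / r)) := by ring
    _ ≤ C0 * (C0 / c0 * 2 ^ r) * (t 1 ^ (α / (2 - α)) * t' j ^ (1 - α / (2 - α))) := by gcongr
    _ = _ := by ring

/-- Barrier function on a mesh obtained by adding nodes to a quasi-graded mesh,
with the first mesh interval unchanged (Corollary 2.5). -/
theorem stmt4 (α r T c0 C0 : ℝ)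
    (hα0 : 0 < α) (hα1 : α < 1)
    (hr1 : 1 ≤ r) (hr2 : r ≤ (2 - α) / α)
    (hT : 0 < T) (hc0 : 0 < c0) (hcC : c0 ≤ C0) :
    ∃ c C : ℝ, 0 < c ∧ 0 < C ∧
      ∀ (M : ℕ) (t : ℕ → ℝ) (M' : ℕ) (t' : ℕ → ℝ),
        IsMesh T M t → QuasiGraded r c0 C0 M t →
        IsMesh T M' t' →
        (∀ j : ℕ, j ≤ M → ∃ k : ℕ, k ≤ M' ∧ t' k = t j) →
        t' 1 = t 1 →
        ∃ B : ℕ → ℝ, B 0 = 0 ∧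
          (∀ k : ℕ, 1 ≤ k → k ≤ M' → 0 ≤ B k ∧ B k ≤ C * (t' k) ^ (α - 1)) ∧
          (∀ k : ℕ, 1 ≤ k → k ≤ M' →
            c * ((t 1) ^ α * (t' k) ^ (-α - 1)) ≤ deltaL1 α t' B k) := by
  have h1α : 0 < 1 - α := by linarith
  have h2α : 0 < 2 - α := by linarith
  have hC0 : 0 < C0 := hc0.trans_le hcC
  have hΓ : 0 < Real.Gamma (1 - α) := Real.Gamma_pos_of_pos h1α
  set μ := α / (2 - α) with hμdef
  have hμmul : μ * (2 - α) = α := div_mul_cancel₀ _ h2α.ne'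
  have hμ0 : 0 < μ := by positivity
  have hμ : α < 2 * μ := by nlinarith
  have hμ1 : μ < 1 := by rw [hμdef, div_lt_one h2α]; linarith
  set K := C0 * (C0 / c0 * 2 ^ r) with hKdef
  have hK : 0 < K := by positivity
  set E := 8 * (1 + K) ^ 5 / (2 * μ - α)
    + 16 * (1 + K) ^ 3 * (4 / (1 - α) + 4 / α) * K ^ (2 - α) with hE
  have hE0 : 0 < E := by
    have : 0 < 2 * μ - α := by linarith
    positivity
  obtain ⟨p, hp⟩ := exists_nat_ge (max 1 (((E + 1) / (1 - α)) ^ (1 / α) / c0))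
  have hp1 : (1 : ℝ) ≤ p := (le_max_left _ _).trans hp
  have hp1' : 1 ≤ p := by exact_mod_cast hp1
  have hpr : (p : ℝ) ≤ (p : ℝ) ^ r := Real.self_le_rpow_of_one_le hp1 hr1
  have hpR : ((E + 1) / (1 - α)) ^ (1 / α) ≤ c0 * (p : ℝ) ^ r := by
    have := (le_max_right _ _).trans hp
    rw [div_le_iff₀ hc0] at this
    nlinarith
  set A := C0 * (p : ℝ) ^ r with hA
  have hA0 : 0 < A := by positivity
  refine ⟨min (1 / Real.Gamma (1 - α)) (1 / Real.Gamma (1 - α) * (A ^ (α - 2) / (1 - α))), 1,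
    by positivity, one_pos, ?_⟩
  intro M t M' t' ht hq ht' hsub hfirst
  have hM := ht.1
  have hτ : 0 < t 1 := ht.pos le_rfl (by omega)
  set i := min p M with hi
  have hi1 : 1 ≤ i := by omega
  have hiM : i ≤ M := min_le_right _ _
  obtain ⟨k, hkM, hk⟩ := hsub i hiM
  have hτa : t 1 ≤ t' k := by rw [hk]; exact ht.le hi1 hiM
  have ha : 0 < t' k := hτ.trans_le hτa
  have haA : t' k ≤ A * t 1 := by
    rw [hk]
    refine (hq.2.1 i hi1 hiM).2.trans ?_
    have : (i : ℝ) ≤ p := by exact_mod_cast min_le_left _ _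
    rw [hA, mul_assoc, mul_comm (t 1)]
    gcongr
  refine ⟨fun j => barrier α (t' k) (t' j), ?_, ?_, ?_⟩
  · simp only [ht'.2.1]
    rw [barrier_of_le ha.le, mul_zero]
  · intro j hj1 hj
    have hpos := ht'.pos hj1 hj
    exact ⟨barrier_nonneg ha hpos, by rw [one_mul]; exact barrier_le hα1 hpos⟩
  intro m hm1 hm
  have hθ : 0 < t' m := ht'.pos hm1 hm
  have hτθ : t 1 ≤ t' m := hfirst ▸ ht'.le hm1 hm
  have hX : 0 < t 1 ^ α * t' m ^ (-α - 1) := by positivity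
  rw [deltaL1]
  rcases le_or_gt (t' m) (t' k) with h | h
  · rw [sum_barrier_linear hα1 ht' hm h]
    refine (mul_le_mul_of_nonneg_right (min_le_right _ _) hX.le).trans ?_
    rw [mul_assoc]
    refine mul_le_mul_of_nonneg_left ?_ (by positivity)
    rw [kernelPrimitive, kernelPrimitive, sub_self, Real.zero_rpow h1α.ne', sub_zero, zero_div,
      neg_zero, zero_sub, neg_neg]
    have h1 : A ^ (α - 2) * t 1 ^ (α - 2) ≤ t' k ^ (α - 2) := by
      rw [← Real.mul_rpow hA0.le hτ.le]
      exact Real.rpow_le_rpow_of_nonpos ha haA (by linarith)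
    have h2 : t 1 ^ α * t' m ^ (-α - 1) ≤ t 1 ^ (α - 2) * t' m ^ (1 - α) := by
      have h3 : t 1 ^ α = t 1 ^ (α - 2) * t 1 ^ (2 : ℝ) := by rw [← Real.rpow_add hτ]; ring_nf
      have h4 : t' m ^ (1 - α) = t' m ^ (2 : ℝ) * t' m ^ (-α - 1) := by
        rw [← Real.rpow_add hθ]; ring_nf
      rw [h3, h4, mul_assoc]
      gcongr
    calc A ^ (α - 2) / (1 - α) * (t 1 ^ α * t' m ^ (-α - 1))
        ≤ A ^ (α - 2) / (1 - α) * (t 1 ^ (α - 2) * t' m ^ (1 - α)) := by gcongr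
      _ = A ^ (α - 2) * t 1 ^ (α - 2) * (t' m ^ (1 - α) / (1 - α)) := by ring
      _ ≤ _ := by gcongr
  · have hkm : k < m := ht'.lt_of_lt hkM h
    have hip : i = p := by
      by_contra hne
      have hiM' : i = M := by omega
      rw [hk, hiM', ht.2.2.2, ← ht'.2.2.2] at h
      exact (ht'.le hm le_rfl).not_gt h
    have hbig : (E + 1) * t 1 ^ α ≤ (1 - α) * t' k ^ α := by
      have h1 : ((E + 1) / (1 - α)) ^ (1 / α) * t 1 ≤ t' k := by
        rw [hk]
        refine le_trans ?_ (hq.2.1 i hi1 hiM).1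
        rw [hip, mul_comm (t 1), ← mul_assoc]
        gcongr
      have h2 := Real.rpow_le_rpow (by positivity) h1 hα0.le
      rw [Real.mul_rpow (by positivity) hτ.le, ← Real.rpow_mul (by positivity),
        one_div_mul_cancel hα0.ne', Real.rpow_one, div_mul_eq_mul_div, div_le_iff₀ h1α] at h2
      linarith
    refine (mul_le_mul_of_nonneg_right (min_le_left _ _) hX.le).trans ?_
    refine mul_le_mul_of_nonneg_left ?_ (by positivity)
    refine le_trans ?_ (le_sum_barrier hα0 hα1 hμ hμ1 hK hτ ht' hτa hkm.le hm le_rfl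
      fun j hkj hjm => hq.refined_step_le hα0 hα1 hr1 hr2 hc0 hcC ht ht' hsub
        (hjm.trans_le hm) (hτa.trans (ht'.le hkj (by omega))))
    have h1 := le_lowerPrimitive_sub hα0 hα1 hK hτ hτa h.le
    have h2 := caputo_barrier_lower_bound hα0 hα1 ha h.le
    have h3 := mul_le_mul_of_nonneg_right hbig
      (Real.rpow_pos_of_pos hθ (-α - 1)).le
    rw [← hμdef, ← hE] at h1
    linarith
end

section
/- Let α ∈ (0,1), β := 1−α, and t_p > 0. Define B(s) := min{ s·t_p^{−β−1}, s^{−β} } for s > 0 and B(0) := 0. Then for every t > t_p, Γ(1−α)·D_t^α B(t) ≥ β t_p^{α} t^{−α−1}, where D_t^α B(t) = (1/Γ(1−α)) ∫_0^t (t−s)^{−α} B′(s) ds is the Caputo derivative (B is piecewise smooth, with B′(s) = t_p^{−β−1} for 0 < s < t_p and B′(s) = −β s^{−β−1} for s > t_p). -/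
open Real MeasureTheory Set

/-- Fundamental theorem of calculus for an antiderivative whose derivative is nonnegative in the
open interval; integrability of the derivative is part of the conclusion. -/
theorem intervalIntegrable_and_integral_eq_sub_of_hasDerivAt_of_nonneg {f f' : ℝ → ℝ} {a b : ℝ}
    (hab : a ≤ b) (hcont : ContinuousOn f (Icc a b))
    (hderiv : ∀ x ∈ Ioo a b, HasDerivAt f (f' x) x) (hpos : ∀ x ∈ Ioo a b, 0 ≤ f' x) :
    IntervalIntegrable f' volume a b ∧ ∫ x in a..b, f' x = f b - f a := by
  have hint : IntervalIntegrable f' volume a b := by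
    apply intervalIntegral.intervalIntegrable_deriv_of_nonneg (g := f)
    · rwa [uIcc_of_le hab]
    · rwa [min_eq_left hab, max_eq_right hab]
    · rwa [min_eq_left hab, max_eq_right hab]
  exact ⟨hint, intervalIntegral.integral_eq_sub_of_hasDerivAt_of_le hab hcont hderiv hint⟩

theorem hasDerivAt_sub_rpow_div {α t s : ℝ} (hα1 : α < 1) (hs : s < t) :
    HasDerivAt (fun s : ℝ => -((t - s) ^ (1 - α) / (1 - α))) ((t - s) ^ (-α)) s := by
  have h1 : HasDerivAt (fun s : ℝ => t - s) (-1) s := by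
    simpa using (hasDerivAt_id s).const_sub t
  have h2 := ((h1.rpow_const (p := 1 - α) (Or.inl (sub_pos.2 hs).ne')).div_const (1 - α)).neg
  refine h2.congr_deriv ?_
  have : 1 - α ≠ 0 := (sub_pos.2 hα1).ne'
  rw [show 1 - α - 1 = -α by ring]
  field_simp

theorem hasDerivAt_rpow_div_sub_one {α t s : ℝ} (hs0 : 0 < s) (hs : s < t) :
    HasDerivAt (fun s : ℝ => -(1 / t * ((t - s) / s) ^ (1 - α)))
      ((t - s) ^ (-α) * ((1 - α) * s ^ (-(1 - α) - 1))) s := by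
  have ht : 0 < t := hs0.trans hs
  have h1 : HasDerivAt (fun s : ℝ => t - s) (-1) s := by
    simpa using (hasDerivAt_id s).const_sub t
  have h2 := h1.div (hasDerivAt_id s) hs0.ne'
  have h3 := ((h2.rpow_const (p := 1 - α)
    (Or.inl (div_pos (sub_pos.2 hs) hs0).ne')).const_mul (1 / t)).neg
  refine h3.congr_deriv ?_
  simp only [Pi.div_apply, id]
  rw [show 1 - α - 1 = -α by ring, div_rpow (sub_pos.2 hs).le hs0.le,
    show -(1 - α) - 1 = -(-α) - (2 : ℕ) by push_cast; ring, rpow_sub_natCast hs0.ne',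
    rpow_neg hs0.le (-α)]
  have := (rpow_pos_of_pos hs0 (-α)).ne'
  field_simp
  ring

theorem integral_rpow_mul_deriv_barrier {α p t : ℝ} (hα1 : α < 1) (hp : 0 < p) (hpt : p < t) :
    ∫ s in (0:ℝ)..t, (t - s) ^ (-α) *
        (if s < p then p ^ (-(1 - α) - 1) else -(1 - α) * s ^ (-(1 - α) - 1)) =
      p ^ (-(1 - α) - 1) * ((t ^ (1 - α) - (t - p) ^ (1 - α)) / (1 - α)) -
        1 / t * ((t - p) / p) ^ (1 - α) := by
  have hβ : 0 < 1 - α := sub_pos.2 hα1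
  set f : ℝ → ℝ := fun s => (t - s) ^ (-α) *
    (if s < p then p ^ (-(1 - α) - 1) else -(1 - α) * s ^ (-(1 - α) - 1)) with hf
  obtain ⟨hi1, he1⟩ := intervalIntegrable_and_integral_eq_sub_of_hasDerivAt_of_nonneg
    (f := fun s => -((t - s) ^ (1 - α) / (1 - α)) * p ^ (-(1 - α) - 1)) (f' := f) hp.le
    (by
      refine ContinuousOn.mul (ContinuousOn.neg (ContinuousOn.div_const ?_ _)) continuousOn_const
      exact ContinuousOn.rpow_const (by fun_prop) fun _ _ => Or.inr hβ.le)
    (fun s hs => by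
      simpa [hf, hs.2] using
        (hasDerivAt_sub_rpow_div hα1 (hs.2.trans hpt)).mul_const (p ^ (-(1 - α) - 1)))
    (fun s hs => by
      have := sub_pos.2 (hs.2.trans hpt)
      simp only [hf, hs.2, if_true]
      positivity)
  obtain ⟨hi2, he2⟩ := intervalIntegrable_and_integral_eq_sub_of_hasDerivAt_of_nonneg
    (f := fun s => -(1 / t * ((t - s) / s) ^ (1 - α))) (f' := fun s => -f s) hpt.le
    (by
      refine ContinuousOn.neg (ContinuousOn.mul continuousOn_const ?_)
      refine ContinuousOn.rpow_const ?_ fun _ _ => Or.inr hβ.le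
      exact ContinuousOn.div (by fun_prop) continuousOn_id fun s hs => (hp.trans_le hs.1).ne')
    (fun s hs => by
      refine (hasDerivAt_rpow_div_sub_one (hp.trans hs.1) hs.2).congr_deriv ?_
      simp only [hf, not_lt.2 hs.1.le, if_false]
      ring)
    (fun s hs => by
      have h1 := sub_pos.2 hs.2
      have h2 := hp.trans hs.1
      have h3 : -f s = (t - s) ^ (-α) * ((1 - α) * s ^ (-(1 - α) - 1)) := by
        simp only [hf, not_lt.2 hs.1.le, if_false]
        ring
      rw [h3]
      positivity)
  have hi2' : IntervalIntegrable f volume p t := by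
    simpa [Pi.neg_def] using hi2.neg
  rw [intervalIntegral.integral_neg] at he2
  rw [← intervalIntegral.integral_add_adjacent_intervals hi1 hi2', he1, neg_eq_iff_eq_neg.1 he2]
  simp only [sub_self, zero_div, zero_rpow hβ.ne', sub_zero]
  ring

/-- A quadratic improvement of Bernoulli's inequality `(1 - x) ^ β ≤ 1 - β * x`. -/
theorem sq_le_of_bernoulli {β x : ℝ} (hβ0 : 0 < β) (hβ1 : β ≤ 1) (hx0 : 0 ≤ x) (hx1 : x ≤ 1) :
    β * x ^ 2 ≤ (1 - (1 - x) ^ β) / β - x * (1 - x) ^ β := by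
  have h : (1 - x) ^ β ≤ 1 - β * x := by
    simpa [sub_eq_add_neg] using
      rpow_one_add_le_one_add_mul_self (s := -x) (by linarith) hβ0.le hβ1
  have hpos : 0 ≤ 1 + β * x := by positivity
  rw [le_sub_iff_add_le, le_div_iff₀ hβ0]
  nlinarith [mul_le_mul_of_nonneg_right h hpos]

/-- Lower bound on the Caputo derivative of the barrier function
`B(s) = min { s t_p^{-β-1}, s^{-β} }` for `t > t_p`, where `β = 1 - α`
(inequality (2.5)): `Γ(1-α) D_t^α B(t) ≥ β t_p^α t^{-α-1}`. Here
`B'(s) = t_p^{-β-1}` for `0 < s < t_p` and `B'(s) = -β s^{-β-1}` for `s > t_p`. -/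
theorem stmt5 (α tp : ℝ) (hα0 : 0 < α) (hα1 : α < 1) (htp : 0 < tp) :
    ∀ t : ℝ, tp < t →
      (1 - α) * tp ^ α * t ^ (-α - 1) ≤
        Real.Gamma (1 - α) *
          ((1 / Real.Gamma (1 - α)) *
            ∫ s in (0:ℝ)..t, (t - s) ^ (-α) *
              (if s < tp then tp ^ (-(1 - α) - 1)
               else -(1 - α) * s ^ (-(1 - α) - 1))) := by
  intro t ht
  have hβ : 0 < 1 - α := sub_pos.2 hα1
  have ht0 : 0 < t := htp.trans ht
  have hx1 : tp / t ≤ 1 := (div_le_one ht0).2 ht.le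
  rw [← mul_assoc, mul_one_div_cancel (Gamma_pos_of_pos hβ).ne', one_mul,
    integral_rpow_mul_deriv_barrier hα1 htp ht]
  have key := mul_le_mul_of_nonneg_left
    (sq_le_of_bernoulli hβ (by linarith) (div_pos htp ht0).le hx1)
    (by positivity : 0 ≤ tp ^ (-(1 - α) - 1) * t ^ (1 - α))
  have e1 : (t - tp) ^ (1 - α) = t ^ (1 - α) * (1 - tp / t) ^ (1 - α) := by
    rw [← mul_rpow ht0.le (sub_nonneg.2 hx1)]
    congr 1
    field_simp
  have e2 : tp ^ (-(1 - α) - 1) = tp ^ α / tp ^ 2 := by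
    rw [← rpow_sub_natCast htp.ne']
    congr 1
    push_cast
    ring
  have e3 : tp ^ (1 - α) = tp / tp ^ α := by rw [rpow_sub htp, rpow_one]
  have e4 : t ^ (-α - 1) = t ^ (1 - α) / t ^ 2 := by
    rw [← rpow_sub_natCast ht0.ne']
    congr 1
    push_cast
    ring
  have hA := (rpow_pos_of_pos htp α).ne'
  rw [div_rpow (sub_pos.2 ht).le htp.le, e1, e3, e4, e2]
  rw [e2] at key
  generalize (1 - tp / t) ^ (1 - α) = y at key ⊢
  refine le_of_eq_of_le ?_ (key.trans_eq ?_)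
  · field_simp
  · field_simp
end

section
/- Let α ∈ (0,1), let r satisfy 1 ≤ r ≤ (2−α)/α, and let γ ∈ (0,α). Let the temporal mesh be quasi-graded with parameter r and constants c_0 ≤ C_0. Then there exist constants c, C > 0, depending only on α, γ, r, T, c_0, C_0, and a real sequence B̄^0,...,B̄^M such that B̄^0 = 0, 0 ≤ B̄^j ≤ C t_j^{α−1} for all j = 1,...,M, and δ_t^α B̄^j ≥ c τ^γ t_j^{−γ−1} for all j = 1,...,M. -/
open Real MeasureTheory Set

lemma rpow_neg_tangent_le {x y e : ℝ} (hx : 0 < x) (hy : 0 < y) (he : 0 ≤ e) :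
    y ^ (-e) - e * (x - y) * y ^ (-e - 1) ≤ x ^ (-e) := by
  have h1 : 1 - e * (x / y - 1) ≤ (x / y) ^ (-e) := by
    have hxy : 0 < x / y := div_pos hx hy
    rw [Real.rpow_def_of_pos hxy]
    have h2 := Real.add_one_le_exp (Real.log (x / y) * -e)
    have h3 := mul_le_mul_of_nonneg_left (Real.log_le_sub_one_of_pos hxy) he
    linarith
  have hye : 0 < y ^ (-e) := Real.rpow_pos_of_pos hy _
  rw [Real.div_rpow hx.le hy.le, le_div_iff₀ hye] at h1
  rw [Real.rpow_sub_one hy.ne']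
  calc y ^ (-e) - e * (x - y) * (y ^ (-e) / y) = (1 - e * (x / y - 1)) * y ^ (-e) := by
        field_simp
    _ ≤ _ := h1

lemma rpow_le_tangent {x y e : ℝ} (hx : 0 ≤ x) (hy : 0 < y) (he : 0 ≤ e) (he1 : e ≤ 1) :
    x ^ e ≤ y ^ e + e * (x - y) * y ^ (e - 1) := by
  have h1 : (1 + (x / y - 1)) ^ e ≤ 1 + e * (x / y - 1) :=
    rpow_one_add_le_one_add_mul_self (by linarith [div_nonneg hx hy.le]) he he1
  rw [add_sub_cancel, Real.div_rpow hx hy.le, div_le_iff₀ (Real.rpow_pos_of_pos hy _)] at h1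
  rw [Real.rpow_sub_one hy.ne']
  calc x ^ e ≤ _ := h1
    _ = _ := by field_simp

/-- The value of `∫ s in a..b, (T - s) ^ (-α)`. -/
noncomputable def kernelInt (α T a b : ℝ) : ℝ :=
  ((T - a) ^ (1 - α) - (T - b) ^ (1 - α)) / (1 - α)

lemma integral_sub_rpow_neg {α : ℝ} (hα1 : α < 1) (T a b : ℝ) :
    ∫ s in a..b, (T - s) ^ (-α) = kernelInt α T a b := by
  rw [intervalIntegral.integral_comp_sub_left (fun u => u ^ (-α)) T,
    integral_rpow (Or.inl (by linarith)), kernelInt, neg_add_eq_sub]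

lemma le_kernelInt {α T a b : ℝ} (hα0 : 0 ≤ α) (hα1 : α < 1) (haT : a < T) (hbT : b ≤ T) :
    (b - a) * (T - a) ^ (-α) ≤ kernelInt α T a b := by
  have h := rpow_le_tangent (x := T - b) (y := T - a) (e := 1 - α)
    (by linarith) (by linarith) (by linarith) (by linarith)
  rw [kernelInt, le_div_iff₀ (by linarith)]
  rw [show (1 - α - 1) = -α by ring] at h
  linarith

lemma kernelInt_le {α T a b : ℝ} (hα0 : 0 ≤ α) (hα1 : α < 1) (hab : a ≤ b) (hbT : b < T) :
    kernelInt α T a b ≤ (b - a) * (T - b) ^ (-α) := by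
  have h := rpow_le_tangent (x := T - a) (y := T - b) (e := 1 - α)
    (by linarith) (by linarith) (by linarith) (by linarith)
  rw [kernelInt, div_le_iff₀ (by linarith)]
  rw [show (1 - α - 1) = -α by ring] at h
  linarith

lemma kernelInt_add_kernelInt (α T a b c : ℝ) :
    kernelInt α T a b + kernelInt α T b c = kernelInt α T a c := by
  unfold kernelInt; ring

lemma deltaL1_eq_sum_range {α : ℝ} (hα1 : α < 1) (t V : ℕ → ℝ) (m : ℕ) :
    deltaL1 α t V m = (1 / Real.Gamma (1 - α)) * ∑ i ∈ Finset.range m,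
      (V (i + 1) - V i) / (t (i + 1) - t i) * kernelInt α (t m) (t i) (t (i + 1)) := by
  have h := Finset.sum_Ico_add' (fun j => (V j - V (j - 1)) / (t j - t (j - 1)) *
    kernelInt α (t m) (t (j - 1)) (t j)) 0 m 1
  simp only [Nat.add_sub_cancel, zero_add] at h
  rw [Finset.range_eq_Ico, h, deltaL1]
  simp only [integral_sub_rpow_neg hα1]
  rfl

/-- Comparison of the product of averages of `s ↦ (α - 1) * s ^ (α - 2)` and
`s ↦ (T - s) ^ (-α)` over `[a, b]` with the increment of the primitive `s ^ (α - 1) * (T - s) ^ (1 - α) / T` of their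
product. -/
lemma slope_mul_kernelInt_ge {α T a b : ℝ} (hα0 : 0 ≤ α) (hα1 : α < 1) (ha : 0 < a) (hab : a < b)
    (hbT : b ≤ T) :
    (b ^ (α - 1) * (T - b) ^ (1 - α) / T - a ^ (α - 1) * (T - a) ^ (1 - α) / T)
      - (1 - α) * (a ^ (α - 2) - b ^ (α - 2)) *
        (kernelInt α T a b - (T - a) ^ (-α) * (b - a))
      ≤ (b ^ (α - 1) - a ^ (α - 1)) / (b - a) * kernelInt α T a b := by
  set σ := (b ^ (α - 1) - a ^ (α - 1)) / (b - a) with hσ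
  set w := (T - a) ^ (-α) with hw
  set D := (1 - α) * (a ^ (α - 2) - b ^ (α - 2)) with hD
  have hσmul : σ * (b - a) = b ^ (α - 1) - a ^ (α - 1) := by
    rw [hσ]; field_simp [(sub_pos.2 hab).ne']
  have hσge : (α - 1) * a ^ (α - 2) ≤ σ := by
    rw [hσ, le_div_iff₀ (sub_pos.2 hab)]
    have h := rpow_neg_tangent_le (x := b) (y := a) (e := 1 - α) (by linarith) ha (by linarith)
    rw [show -(1 - α) = α - 1 by ring, show α - 1 - 1 = α - 2 by ring] at h
    linarith
  let Θ : ℝ → ℝ := fun s => s ^ (α - 1) * (T - s) ^ (1 - α) / T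
    - (σ + D) * (-(T - s) ^ (1 - α) / (1 - α)) - w * (s ^ (α - 1) - (σ + D) * s)
  have hderiv : ∀ s ∈ Ioo a b,
      HasDerivAt Θ (((α - 1) * s ^ (α - 2) - σ - D) * ((T - s) ^ (-α) - w)) s := by
    intro s hs
    have hs0 : 0 < s := ha.trans hs.1
    have hsT : 0 < T - s := by linarith [hs.2]
    have h1 : HasDerivAt (fun s : ℝ => s ^ (α - 1)) ((α - 1) * s ^ (α - 1 - 1)) s :=
      Real.hasDerivAt_rpow_const (Or.inl hs0.ne')
    have h2 : HasDerivAt (fun s : ℝ => (T - s) ^ (1 - α))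
        (-1 * (1 - α) * (T - s) ^ (1 - α - 1)) s :=
      ((hasDerivAt_id s).const_sub T).rpow_const (Or.inl hsT.ne')
    have h3 := (((h1.mul h2).div_const T).sub
      ((h2.neg.div_const (1 - α)).const_mul (σ + D))).sub
      ((h1.sub ((hasDerivAt_id s).const_mul (σ + D))).const_mul w)
    refine h3.congr_deriv ?_
    have e1 : s ^ (α - 1) = s ^ (α - 2) * s := by
      rw [← Real.rpow_add_one hs0.ne']; ring_nf
    have e2 : (T - s) ^ (1 - α) = (T - s) ^ (-α) * (T - s) := by
      rw [← Real.rpow_add_one hsT.ne']; ring_nf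
    have hT : T ≠ 0 := by linarith
    have h1α : 1 - α ≠ 0 := by linarith
    rw [show α - 1 - 1 = α - 2 by ring, show 1 - α - 1 = -α by ring, e1, e2]
    field_simp
    ring
  have hcont : ContinuousOn Θ (Icc a b) := by
    have c1 : ContinuousOn (fun s : ℝ => s ^ (α - 1)) (Icc a b) :=
      continuousOn_id.rpow_const fun s hs => Or.inl (ha.trans_le hs.1).ne'
    have c2 : ContinuousOn (fun s : ℝ => (T - s) ^ (1 - α)) (Icc a b) :=
      (continuousOn_const.sub continuousOn_id).rpow_const fun s hs => Or.inr (by linarith)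
    exact (((c1.mul c2).div_const T).sub
      (continuousOn_const.mul (c2.neg.div_const (1 - α)))).sub
      (continuousOn_const.mul (c1.sub (continuousOn_const.mul continuousOn_id)))
  have hanti : AntitoneOn Θ (Icc a b) := by
    refine antitoneOn_of_deriv_nonpos (convex_Icc a b) hcont ?_ ?_
    · rw [interior_Icc]
      exact fun s hs => (hderiv s hs).differentiableAt.differentiableWithinAt
    · rw [interior_Icc]
      intro s hs
      rw [(hderiv s hs).deriv]
      have hs0 : 0 < s := ha.trans hs.1
      refine mul_nonpos_of_nonpos_of_nonneg ?_ ?_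
      · have : b ^ (α - 2) ≤ s ^ (α - 2) :=
          Real.rpow_le_rpow_of_nonpos hs0 hs.2.le (by linarith)
        have := mul_le_mul_of_nonneg_left this (show 0 ≤ 1 - α by linarith)
        rw [hD]; linarith
      · exact sub_nonneg.2 (Real.rpow_le_rpow_of_nonpos (by linarith [hs.2])
          (by linarith [hs.1]) (by linarith))
  have h := hanti (left_mem_Icc.2 hab.le) (right_mem_Icc.2 hab.le) hab.le
  simp only [Θ] at h
  have hk : kernelInt α T a b =
      -(T - b) ^ (1 - α) / (1 - α) - -(T - a) ^ (1 - α) / (1 - α) := by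
    unfold kernelInt; ring
  have hw0 : w * (b ^ (α - 1) - a ^ (α - 1)) = w * (σ * (b - a)) := by rw [hσmul]
  rw [hk]
  linarith
lemma rpow_sub_rpow_le_of_le_two_mul {α a b : ℝ} (hα0 : 0 ≤ α) (hα1 : α < 1) (ha : 0 < a)
    (hab : a < b) (hb2 : b ≤ 2 * a) :
    (1 - α) * (a ^ (α - 2) - b ^ (α - 2)) ≤ (1 - α) * (16 * (b - a) * b ^ (α - 3)) := by
  have hb : 0 < b := ha.trans hab
  have h := rpow_neg_tangent_le (x := b) (y := a) (e := 2 - α) hb ha (by linarith)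
  rw [show -(2 - α) = α - 2 by ring, show α - 2 - 1 = α - 3 by ring] at h
  have h1 : a ^ (α - 3) ≤ 8 * b ^ (α - 3) := by
    calc a ^ (α - 3) ≤ (b / 2) ^ (α - 3) :=
          Real.rpow_le_rpow_of_nonpos (by linarith) (by linarith) (by linarith)
      _ = 2 ^ (3 - α) * b ^ (α - 3) := by
          rw [Real.div_rpow hb.le (by norm_num), div_eq_mul_inv,
            ← Real.rpow_neg (by norm_num), neg_sub, mul_comm]
      _ ≤ 8 * b ^ (α - 3) := by
          gcongr
          calc (2 : ℝ) ^ (3 - α) ≤ 2 ^ (3 : ℝ) :=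
                Real.rpow_le_rpow_of_exponent_le (by norm_num) (by linarith)
            _ = 8 := by norm_num
  refine mul_le_mul_of_nonneg_left ?_ (by linarith)
  have h2 : (2 - α) * (b - a) * a ^ (α - 3) ≤ 2 * (b - a) * (8 * b ^ (α - 3)) := by
    have : 0 < b - a := by linarith
    gcongr
    linarith
  linarith

lemma sq_mul_rpow_le {α a b q E : ℝ} (hab : a < b) (hb : 0 < b)
    (hE : b - a ≤ E * b ^ (1 - q)) :
    (b - a) ^ 2 * b ^ (α - 3) ≤ E ^ 2 * b ^ (-1 - (2 * q - α)) := by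
  calc (b - a) ^ 2 * b ^ (α - 3) ≤ (E * b ^ (1 - q)) ^ 2 * b ^ (α - 3) := by
        have : 0 < b - a := by linarith
        gcongr
    _ = E ^ 2 * b ^ (-1 - (2 * q - α)) := by
        rw [mul_pow, ← Real.rpow_mul_natCast hb.le, mul_assoc, ← Real.rpow_add hb]
        congr 2
        push_cast
        ring

lemma slope_mul_kernelInt_ge_of_lt {α T a b q E : ℝ} (hα0 : 0 ≤ α) (hα1 : α < 1) (ha : 0 < a)
    (hab : a < b) (hbT : b < T) (hb2 : b ≤ 2 * a) (hE : b - a ≤ E * b ^ (1 - q))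
    (hq : 0 < 2 * q - α) (hq1 : q ≤ 1) :
    (b ^ (α - 1) * (T - b) ^ (1 - α) / T - a ^ (α - 1) * (T - a) ^ (1 - α) / T)
      - (64 * E ^ 2 * T ^ (-α - 1) / (2 * q - α) * (a ^ (-(2 * q - α)) - b ^ (-(2 * q - α)))
        + 128 * E ^ 2 * T ^ (-1 - (2 * q - α)) * ((T - b) ^ (-α) - (T - a) ^ (-α)))
      ≤ (b ^ (α - 1) - a ^ (α - 1)) / (b - a) * kernelInt α T a b := by
  have hb : 0 < b := ha.trans hab
  have hT : 0 < T := hb.trans hbT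
  have hba : 0 < b - a := by linarith
  set β := 2 * q - α with hβ
  refine le_trans (sub_le_sub_left ?_ _) (slope_mul_kernelInt_ge hα0 hα1 ha hab hbT.le)
  have hw : 0 ≤ (T - b) ^ (-α) - (T - a) ^ (-α) := sub_nonneg.2
    (Real.rpow_le_rpow_of_nonpos (by linarith) (by linarith) (by linarith))
  have hu : 0 ≤ a ^ (-β) - b ^ (-β) := sub_nonneg.2
    (Real.rpow_le_rpow_of_nonpos ha hab.le (by linarith))
  have hD0 : 0 ≤ (1 - α) * (16 * (b - a) * b ^ (α - 3)) := by
    have : 0 ≤ 1 - α := by linarith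
    positivity
  have hmain : (1 - α) * (a ^ (α - 2) - b ^ (α - 2)) *
      (kernelInt α T a b - (T - a) ^ (-α) * (b - a)) ≤
      16 * (E ^ 2 * b ^ (-1 - β)) * ((T - b) ^ (-α) - (T - a) ^ (-α)) := by
    have hk0 := le_kernelInt hα0 hα1 (hab.trans hbT) hbT.le
    have hk1 := kernelInt_le hα0 hα1 hab.le hbT
    calc _ ≤ (1 - α) * (16 * (b - a) * b ^ (α - 3)) *
          ((b - a) * ((T - b) ^ (-α) - (T - a) ^ (-α))) := by
          refine mul_le_mul (rpow_sub_rpow_le_of_le_two_mul hα0 hα1 ha hab hb2) ?_ ?_ hD0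
          · linarith
          · linarith
      _ = (1 - α) * (16 * ((b - a) ^ 2 * b ^ (α - 3)) *
          ((T - b) ^ (-α) - (T - a) ^ (-α))) := by ring
      _ ≤ 1 * (16 * ((b - a) ^ 2 * b ^ (α - 3)) * ((T - b) ^ (-α) - (T - a) ^ (-α))) := by
          refine mul_le_mul_of_nonneg_right (by linarith) ?_
          positivity
      _ ≤ _ := by
          rw [one_mul]
          have := sq_mul_rpow_le (α := α) hab hb hE
          gcongr
  refine hmain.trans ?_
  rcases le_or_gt b (T / 2) with hbT2 | hbT2
  · have h1 : (T - b) ^ (-α) - (T - a) ^ (-α) ≤ (b - a) * (4 * T ^ (-α - 1)) := by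
      have h := rpow_neg_tangent_le (x := T - a) (y := T - b) (e := α)
        (by linarith) (by linarith) hα0
      have h2 : (T - b) ^ (-α - 1) ≤ 4 * T ^ (-α - 1) := by
        calc (T - b) ^ (-α - 1) ≤ (T / 2) ^ (-α - 1) :=
              Real.rpow_le_rpow_of_nonpos (by linarith) (by linarith) (by linarith)
          _ = 2 ^ (α + 1) * T ^ (-α - 1) := by
              rw [Real.div_rpow hT.le (by norm_num), div_eq_mul_inv,
                ← Real.rpow_neg (by norm_num), mul_comm]
              ring_nf
          _ ≤ 4 * T ^ (-α - 1) := by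
              gcongr
              calc (2 : ℝ) ^ (α + 1) ≤ 2 ^ (2 : ℝ) :=
                    Real.rpow_le_rpow_of_exponent_le (by norm_num) (by linarith)
                _ = 4 := by norm_num
      have h3 : α * (b - a) * (T - b) ^ (-α - 1) ≤ 1 * (b - a) * (4 * T ^ (-α - 1)) := by
        gcongr
      linarith
    have h2 : (b - a) * b ^ (-1 - β) ≤ (a ^ (-β) - b ^ (-β)) / β := by
      have h := rpow_neg_tangent_le (x := a) (y := b) (e := β) ha hb hq.le
      rw [le_div_iff₀ hq]
      rw [show -1 - β = -β - 1 by ring]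
      linarith
    calc 16 * (E ^ 2 * b ^ (-1 - β)) * ((T - b) ^ (-α) - (T - a) ^ (-α))
        ≤ 16 * (E ^ 2 * b ^ (-1 - β)) * ((b - a) * (4 * T ^ (-α - 1))) := by gcongr
      _ = 64 * E ^ 2 * T ^ (-α - 1) * ((b - a) * b ^ (-1 - β)) := by ring
      _ ≤ 64 * E ^ 2 * T ^ (-α - 1) * ((a ^ (-β) - b ^ (-β)) / β) := by gcongr
      _ = 64 * E ^ 2 * T ^ (-α - 1) / β * (a ^ (-β) - b ^ (-β)) := by ring
      _ ≤ _ := le_add_of_nonneg_right (by positivity)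
  · have h1 : b ^ (-1 - β) ≤ 8 * T ^ (-1 - β) := by
      calc b ^ (-1 - β) ≤ (T / 2) ^ (-1 - β) :=
            Real.rpow_le_rpow_of_nonpos (by linarith) (by linarith) (by linarith)
        _ = 2 ^ (1 + β) * T ^ (-1 - β) := by
            rw [Real.div_rpow hT.le (by norm_num), div_eq_mul_inv,
              ← Real.rpow_neg (by norm_num), mul_comm]
            ring_nf
        _ ≤ 8 * T ^ (-1 - β) := by
            gcongr
            calc (2 : ℝ) ^ (1 + β) ≤ 2 ^ (3 : ℝ) :=
                  Real.rpow_le_rpow_of_exponent_le (by norm_num) (by linarith)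
              _ = 8 := by norm_num
    calc 16 * (E ^ 2 * b ^ (-1 - β)) * ((T - b) ^ (-α) - (T - a) ^ (-α))
        ≤ 16 * (E ^ 2 * (8 * T ^ (-1 - β))) * ((T - b) ^ (-α) - (T - a) ^ (-α)) := by gcongr
      _ = 128 * E ^ 2 * T ^ (-1 - β) * ((T - b) ^ (-α) - (T - a) ^ (-α)) := by ring
      _ ≤ _ := le_add_of_nonneg_left (by positivity)

lemma slope_mul_kernelInt_ge_of_right_eq {α T a q E : ℝ} (hα0 : 0 ≤ α) (hα1 : α < 1) (ha : 0 < a)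
    (haT : a < T) (hT2 : T ≤ 2 * a) (hE : T - a ≤ E * T ^ (1 - q)) :
    -(a ^ (α - 1) * (T - a) ^ (1 - α) / T)
      - 16 * E ^ 2 * T ^ (-1 - (2 * q - α)) * (T - a) ^ (-α)
      ≤ (T ^ (α - 1) - a ^ (α - 1)) / (T - a) * kernelInt α T a T := by
  have hT : 0 < T := ha.trans haT
  have hTa : 0 < T - a := by linarith
  have h1α : 0 < 1 - α := by linarith
  have h := slope_mul_kernelInt_ge hα0 hα1 ha haT le_rfl
  rw [sub_self, Real.zero_rpow h1α.ne', mul_zero, zero_div, zero_sub] at h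
  refine le_trans (sub_le_sub_left ?_ _) h
  have hk : kernelInt α T a T = (T - a) * (T - a) ^ (-α) / (1 - α) := by
    rw [kernelInt, sub_self, Real.zero_rpow h1α.ne', sub_zero, mul_comm (T - a),
      ← Real.rpow_add_one hTa.ne', neg_add_eq_sub]
  have hw : 0 < (T - a) ^ (-α) := Real.rpow_pos_of_pos hTa _
  have hk0 := le_kernelInt hα0 hα1 haT le_rfl
  calc _ ≤ (1 - α) * (16 * (T - a) * T ^ (α - 3)) * ((T - a) * (T - a) ^ (-α) / (1 - α)) := by
        refine mul_le_mul (rpow_sub_rpow_le_of_le_two_mul hα0 hα1 ha haT hT2) ?_ ?_ ?_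
        · rw [hk]; linarith [mul_pos hTa hw]
        · linarith
        · positivity
    _ = 16 * ((T - a) ^ 2 * T ^ (α - 3)) * (T - a) ^ (-α) := by field_simp
    _ ≤ 16 * (E ^ 2 * T ^ (-1 - (2 * q - α))) * (T - a) ^ (-α) := by
        have := sq_mul_rpow_le (α := α) haT hT hE
        gcongr
    _ = _ := by ring

lemma sub_le_sum_Ico {F Φ : ℕ → ℝ} {p n : ℕ} (hpn : p ≤ n)
    (h : ∀ i, p ≤ i → i < n → Φ (i + 1) - Φ i ≤ F i) :
    Φ n - Φ p ≤ ∑ i ∈ Finset.Ico p n, F i := by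
  induction n, hpn using Nat.le_induction with
  | base => simp
  | succ n hn ih =>
    rw [Finset.sum_Ico_succ_top hn]
    have h1 := ih fun i hi hin => h i hi (hin.trans n.lt_succ_self)
    have h2 := h n hn n.lt_succ_self
    linarith

/-- The contribution of the mesh intervals after `t p` to `Γ(1 - α) δ_t^α g^m`. -/
noncomputable def tailSum (α : ℝ) (t g : ℕ → ℝ) (p m : ℕ) : ℝ :=
  ∑ i ∈ Finset.Ico p m,
    (g (i + 1) - g i) / (t (i + 1) - t i) * kernelInt α (t m) (t i) (t (i + 1))

/-- `Γ(1 - α) δ_t^α` at time level `m > p` of the sequence that is linear in `t` up to `t p`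
and equals `g` afterwards. -/
noncomputable def truncSum (α : ℝ) (t g : ℕ → ℝ) (p m : ℕ) : ℝ :=
  g p / t p * kernelInt α (t m) 0 (t p) + tailSum α t g p m

lemma truncSum_linear_combination (α a b : ℝ) (t g k : ℕ → ℝ) (p m : ℕ) :
    truncSum α t (fun j => a * g j - b * k j) p m =
      a * truncSum α t g p m - b * truncSum α t k p m := by
  have h : tailSum α t (fun j => a * g j - b * k j) p m =
      a * tailSum α t g p m - b * tailSum α t k p m := by
    simp only [tailSum, Finset.mul_sum, ← Finset.sum_sub_distrib]
    refine Finset.sum_congr rfl fun i _ => ?_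
    ring
  rw [truncSum, h, truncSum, truncSum]
  ring

/-- The sequence that is linear in `t` up to `t p` and equals `g` afterwards. -/
noncomputable def linearStart (t g : ℕ → ℝ) (p j : ℕ) : ℝ :=
  if j ≤ p then g p / t p * t j else g j

lemma sum_range_linearStart {α : ℝ} {t g : ℕ → ℝ} {p n : ℕ} (T : ℝ) (h0 : t 0 = 0)
    (hmono : ∀ i, i < n → t i < t (i + 1)) (hn : n ≤ p) :
    ∑ i ∈ Finset.range n, (linearStart t g p (i + 1) - linearStart t g p i) /
      (t (i + 1) - t i) * kernelInt α T (t i) (t (i + 1)) =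
      g p / t p * kernelInt α T 0 (t n) := by
  induction n with
  | zero => simp [h0, kernelInt]
  | succ n ih =>
    rw [Finset.sum_range_succ, ih (fun i hi => hmono i (hi.trans n.lt_succ_self)) (by omega),
      linearStart, linearStart, if_pos hn, if_pos (by omega), ← mul_sub,
      mul_div_cancel_right₀ _ (sub_pos.2 (hmono n n.lt_succ_self)).ne', ← mul_add,
      kernelInt_add_kernelInt]

lemma sum_range_linearStart_eq_truncSum {α : ℝ} {t g : ℕ → ℝ} {p m : ℕ} (h0 : t 0 = 0)
    (hmono : ∀ i, i < m → t i < t (i + 1)) (hp : 0 < t p) (hpm : p ≤ m) :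
    ∑ i ∈ Finset.range m, (linearStart t g p (i + 1) - linearStart t g p i) /
      (t (i + 1) - t i) * kernelInt α (t m) (t i) (t (i + 1)) = truncSum α t g p m := by
  have hval : ∀ i, p ≤ i → linearStart t g p i = g i := by
    intro i hi
    rcases hi.eq_or_lt with rfl | hi
    · rw [linearStart, if_pos le_rfl, div_mul_cancel₀ _ hp.ne']
    · rw [linearStart, if_neg (by omega)]
  rw [← Finset.sum_range_add_sum_Ico _ hpm, truncSum, tailSum,
    sum_range_linearStart _ h0 (fun i hi => hmono i (hi.trans_le hpm)) le_rfl]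
  congr 1
  refine Finset.sum_congr rfl fun i hi => ?_
  have := (Finset.mem_Ico.1 hi).1
  rw [hval i this, hval (i + 1) (by omega)]

lemma truncSum_rpow_ge {α q c0 C0 : ℝ} {t : ℕ → ℝ} {p n : ℕ} {τ : ℝ}
    (hα0 : 0 < α) (hα1 : α < 1) (hq1 : q ≤ 1) (hqα : α ≤ q * (2 - α)) (hc0 : 0 < c0)
    (hτ : 0 < τ) (hτp : τ ≤ t p) (hpn : p ≤ n)
    (hmono : ∀ i, i < n + 1 → t i < t (i + 1)) (hle : ∀ i j, i ≤ j → j ≤ n + 1 → t i ≤ t j)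
    (hup : ∀ i, p ≤ i → i < n + 1 → t (i + 1) - t i ≤ C0 * (τ ^ q * t (i + 1) ^ (1 - q)))
    (hlow : c0 * (τ ^ q * t (n + 1) ^ (1 - q)) ≤ t (n + 1) - t n)
    (hθ1 : C0 * (τ / t p) ^ q ≤ 1 / 2)
    (hθ2 : (64 * C0 ^ 2 / (2 * q - α) + 144 * C0 ^ 2 * c0 ^ (-α)) *
      ((τ / t p) ^ (2 * q) + (τ / t p) ^ α) ≤ (1 - α) / 2) :
    (1 - α) / 2 * (t p / t (n + 1)) ^ α / t (n + 1) ≤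
      truncSum α t (fun j => t j ^ (α - 1)) p (n + 1) := by
  have htp : 0 < t p := hτ.trans_le hτp
  have hpos : ∀ i, p ≤ i → i ≤ n + 1 → 0 < t i := fun i hi hin => htp.trans_le (hle p i hi hin)
  have hpT : t p < t (n + 1) := (hle p n hpn (by omega)).trans_lt (hmono n (by omega))
  set T := t (n + 1) with hTdef
  have hT : 0 < T := htp.trans hpT
  have hqpos : 0 < q := by
    by_contra! h
    nlinarith
  have hβ : 0 < 2 * q - α := by nlinarith
  have hC0 : 0 ≤ C0 := by
    have h1 := hup n hpn (by omega)
    have h2 := hmono n (by omega)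
    by_contra! h
    have : 0 < τ ^ q * T ^ (1 - q) := by positivity
    nlinarith
  set β := 2 * q - α with hβdef
  set E := C0 * τ ^ q with hE
  have hupE : ∀ i, p ≤ i → i < n + 1 → t (i + 1) - t i ≤ E * t (i + 1) ^ (1 - q) := by
    intro i hi hin
    rw [hE, mul_assoc]
    exact hup i hi hin
  have hratio : ∀ i, p ≤ i → i < n + 1 → t (i + 1) ≤ 2 * t i := by
    intro i hi hin
    have hti := hpos (i + 1) (by omega) hin
    have h1 : E * t (i + 1) ^ (1 - q) = C0 * (τ / t (i + 1)) ^ q * t (i + 1) := by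
      rw [hE, Real.div_rpow hτ.le hti.le, Real.rpow_sub hti, Real.rpow_one]
      ring
    have h2 : (τ / t (i + 1)) ^ q ≤ (τ / t p) ^ q := by
      have := hle p (i + 1) (by omega) hin
      gcongr
    have h3 : C0 * (τ / t (i + 1)) ^ q * t (i + 1) ≤ 1 / 2 * t (i + 1) := by
      have := mul_le_mul_of_nonneg_left h2 hC0
      gcongr
      linarith
    linarith [hupE i hi hin]
  set A₁ := 64 * E ^ 2 * T ^ (-α - 1) / β with hA₁
  set A₂ := 128 * E ^ 2 * T ^ (-1 - β) with hA₂
  have hA₁0 : 0 ≤ A₁ := by positivity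
  have hA₂0 : 0 ≤ A₂ := by positivity
  have htail : -(t p ^ (α - 1) * (T - t p) ^ (1 - α) / T) - A₁ * t p ^ (-β)
      - 144 * E ^ 2 * T ^ (-1 - β) * (T - t n) ^ (-α)
      ≤ tailSum α t (fun j => t j ^ (α - 1)) p (n + 1) := by
    rw [tailSum, Finset.sum_Ico_succ_top hpn]
    have h1 := sub_le_sum_Ico (F := fun i => (t (i + 1) ^ (α - 1) - t i ^ (α - 1)) /
        (t (i + 1) - t i) * kernelInt α T (t i) (t (i + 1)))
      (Φ := fun i => t i ^ (α - 1) * (T - t i) ^ (1 - α) / T + A₁ * t i ^ (-β)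
        - A₂ * (T - t i) ^ (-α)) hpn (by
      intro i hi hin
      have hiT : t (i + 1) < T :=
        (hle (i + 1) n hin (by omega)).trans_lt (hmono n (by omega))
      have h := slope_mul_kernelInt_ge_of_lt hα0.le hα1 (hpos i hi (by omega))
        (hmono i (by omega)) hiT (hratio i hi (by omega)) (hupE i hi (by omega)) hβ hq1
      refine le_trans (le_of_eq ?_) h
      rw [hA₁, hA₂]
      ring)
    have h2 := slope_mul_kernelInt_ge_of_right_eq hα0.le hα1 (hpos n hpn (by omega))
      (hmono n (by omega)) (hratio n hpn (by omega)) (hupE n hpn (by omega))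
    have h3 : 0 ≤ A₁ * t n ^ (-β) :=
      mul_nonneg hA₁0 (Real.rpow_nonneg (hpos n hpn (by omega)).le _)
    have h4 : 0 ≤ A₂ * (T - t p) ^ (-α) :=
      mul_nonneg hA₂0 (Real.rpow_nonneg (by linarith) _)
    have h5 : A₂ * (T - t n) ^ (-α) + 16 * E ^ 2 * T ^ (-1 - β) * (T - t n) ^ (-α)
        = 144 * E ^ 2 * T ^ (-1 - β) * (T - t n) ^ (-α) := by rw [hA₂]; ring
    linarith
  have hhead : (1 - α) * (t p / T) ^ α / T ≤
      t p ^ (α - 1) / t p * kernelInt α T 0 (t p)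
        - t p ^ (α - 1) * (T - t p) ^ (1 - α) / T := by
    have h1 := le_kernelInt hα0.le hα1 hT hpT.le
    rw [sub_zero, sub_zero] at h1
    have h2 := rpow_le_tangent (x := T - t p) (y := T) (e := 1 - α)
      (by linarith) hT (by linarith) (by linarith)
    rw [show 1 - α - 1 = -α by ring] at h2
    have e1 : (t p / T) ^ α = t p ^ (α - 1) * t p * T ^ (-α) := by
      rw [Real.div_rpow htp.le hT.le, ← Real.rpow_add_one htp.ne', sub_add_cancel,
        Real.rpow_neg hT.le, div_eq_mul_inv]
    have e2 : T ^ (1 - α) = T ^ (-α) * T := by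
      rw [← Real.rpow_add_one hT.ne', neg_add_eq_sub]
    have hg : 0 < t p ^ (α - 1) := Real.rpow_pos_of_pos htp _
    calc (1 - α) * (t p / T) ^ α / T = t p ^ (α - 1) / t p * (t p * T ^ (-α)) -
          t p ^ (α - 1) * (T ^ (1 - α) + (1 - α) * (T - t p - T) * T ^ (-α)) / T := by
          rw [e1, e2]; field_simp; ring
      _ ≤ _ := by gcongr
  have hfar : A₁ * t p ^ (-β) =
      64 * C0 ^ 2 / β * (τ / t p) ^ (2 * q) * ((t p / T) ^ α / T) := by
    rw [hA₁, hE, Real.div_rpow hτ.le htp.le, Real.div_rpow htp.le hT.le, hβdef,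
      show -(2 * q - α) = α - 2 * q by ring, Real.rpow_sub htp, Real.rpow_sub_one hT.ne',
      Real.rpow_neg hT.le, mul_pow, ← Real.rpow_mul_natCast hτ.le,
      show q * ((2 : ℕ) : ℝ) = 2 * q by push_cast; ring]
    ring
  have hnear : 144 * E ^ 2 * T ^ (-1 - β) * (T - t n) ^ (-α) ≤
      144 * C0 ^ 2 * c0 ^ (-α) * (τ / t p) ^ α * ((t p / T) ^ α / T) := by
    have h1 : (T - t n) ^ (-α) ≤ (c0 * (τ ^ q * T ^ (1 - q))) ^ (-α) :=
      Real.rpow_le_rpow_of_nonpos (by positivity) hlow (by linarith)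
    have h2 : (τ / T) ^ (q * (2 - α)) ≤ (τ / T) ^ α :=
      Real.rpow_le_rpow_of_exponent_ge (by positivity)
        ((div_le_one hT).2 (hτp.trans hpT.le)) hqα
    have h3 : (τ / T) ^ α = (τ / t p) ^ α * (t p / T) ^ α := by
      rw [← Real.mul_rpow (by positivity) (by positivity)]
      congr 1
      field_simp
    calc 144 * E ^ 2 * T ^ (-1 - β) * (T - t n) ^ (-α)
        ≤ 144 * E ^ 2 * T ^ (-1 - β) * (c0 * (τ ^ q * T ^ (1 - q))) ^ (-α) := by gcongr
      _ = 144 * C0 ^ 2 * c0 ^ (-α) * ((τ / T) ^ (q * (2 - α)) / T) := by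
          rw [Real.mul_rpow hc0.le (by positivity), Real.mul_rpow (by positivity) (by positivity),
            ← Real.rpow_mul hτ.le, ← Real.rpow_mul hT.le, hE, mul_pow,
            ← Real.rpow_mul_natCast hτ.le, Real.div_rpow hτ.le hT.le]
          have e1 : τ ^ (q * (2 - α)) = τ ^ (q * ((2 : ℕ) : ℝ)) * τ ^ (q * -α) := by
            rw [← Real.rpow_add hτ]; congr 1; push_cast; ring
          have e2 : T ^ (-1 - β) * T ^ ((1 - q) * -α) = (T ^ (q * (2 - α)))⁻¹ / T := by
            rw [← Real.rpow_add hT, ← Real.rpow_neg hT.le, ← Real.rpow_sub_one hT.ne', hβdef]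
            congr 1; ring
          rw [e1]
          linear_combination (144 * (C0 ^ 2 * τ ^ (q * ((2 : ℕ) : ℝ))) * c0 ^ (-α) *
            τ ^ (q * -α)) * e2
      _ ≤ 144 * C0 ^ 2 * c0 ^ (-α) * ((τ / T) ^ α / T) := by gcongr
      _ = _ := by rw [h3]; ring
  have hX : 0 < (t p / T) ^ α / T := by positivity
  have hθa : 0 ≤ (τ / t p) ^ (2 * q) := by positivity
  have hθb : 0 ≤ (τ / t p) ^ α := by positivity
  have hK1 : 0 ≤ 64 * C0 ^ 2 / β := by positivity
  have hK2 : 0 ≤ 144 * C0 ^ 2 * c0 ^ (-α) := by positivity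
  have herr : 64 * C0 ^ 2 / β * (τ / t p) ^ (2 * q) +
      144 * C0 ^ 2 * c0 ^ (-α) * (τ / t p) ^ α ≤ (1 - α) / 2 := by
    linarith [mul_nonneg hK1 hθb, mul_nonneg hK2 hθa]
  have herr' := mul_le_mul_of_nonneg_right herr hX.le
  rw [truncSum]
  have hgoal : (1 - α) / 2 * (t p / T) ^ α / T = (1 - α) * (t p / T) ^ α / T
      - (1 - α) / 2 * ((t p / T) ^ α / T) := by ring
  rw [hgoal]
  linarith

lemma truncSum_antitone_le {α : ℝ} {t k : ℕ → ℝ} {p l m : ℕ} (hα0 : 0 ≤ α) (hα1 : α < 1)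
    (hp : 0 < t p) (hpl : p ≤ l) (hlm : l < m)
    (hmono : ∀ i, i < m → t i < t (i + 1)) (hle : ∀ i j, i ≤ j → j ≤ m → t i ≤ t j)
    (hk : ∀ i, p ≤ i → i < m → k (i + 1) ≤ k i) (hk0 : 0 ≤ k p) (hkm : k m = 0) :
    truncSum α t k p m ≤ -(k l * ((t m - t l) ^ (-α) - (t m - t p) ^ (-α))) := by
  have hlt : ∀ i, i < m → t i < t m := fun i hi =>
    (hmono i hi).trans_le (hle (i + 1) m hi le_rfl)
  have hstep : ∀ v i, v ≤ i → p ≤ i → i < m → (t m - t v) ^ (-α) * (k i - k (i + 1)) ≤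
      -((k (i + 1) - k i) / (t (i + 1) - t i) * kernelInt α (t m) (t i) (t (i + 1))) := by
    intro v i hvi hi him
    have h1 := le_kernelInt hα0 hα1 (hlt i him) (hle (i + 1) m him le_rfl)
    have h2 : 0 < t (i + 1) - t i := sub_pos.2 (hmono i him)
    have h3 : 0 ≤ (k i - k (i + 1)) / (t (i + 1) - t i) :=
      div_nonneg (sub_nonneg.2 (hk i hi him)) h2.le
    have h4 : (t m - t v) ^ (-α) ≤ (t m - t i) ^ (-α) :=
      Real.rpow_le_rpow_of_nonpos (sub_pos.2 (hlt i him))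
        (by linarith [hle v i hvi him.le]) (by linarith)
    calc (t m - t v) ^ (-α) * (k i - k (i + 1))
        ≤ (t m - t i) ^ (-α) * (k i - k (i + 1)) :=
          mul_le_mul_of_nonneg_right h4 (sub_nonneg.2 (hk i hi him))
      _ = (k i - k (i + 1)) / (t (i + 1) - t i) *
          ((t (i + 1) - t i) * (t m - t i) ^ (-α)) := by field_simp
      _ ≤ (k i - k (i + 1)) / (t (i + 1) - t i) * kernelInt α (t m) (t i) (t (i + 1)) := by
          gcongr
      _ = _ := by ring
  have hhead : k p / t p * kernelInt α (t m) 0 (t p) ≤ k p * (t m - t p) ^ (-α) := by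
    have h := kernelInt_le hα0 hα1 hp.le (hlt p (by omega))
    rw [sub_zero] at h
    calc k p / t p * kernelInt α (t m) 0 (t p) ≤ k p / t p * (t p * (t m - t p) ^ (-α)) := by
          gcongr
      _ = _ := by field_simp
  have h1 := sub_le_sum_Ico (Φ := fun i => -((t m - t p) ^ (-α) * k i)) (F := fun i =>
    -((k (i + 1) - k i) / (t (i + 1) - t i) * kernelInt α (t m) (t i) (t (i + 1)))) hpl
    (fun i hi hil => by linarith [hstep p i hi hi (by omega)])
  have h2 := sub_le_sum_Ico (Φ := fun i => -((t m - t l) ^ (-α) * k i)) (F := fun i =>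
    -((k (i + 1) - k i) / (t (i + 1) - t i) * kernelInt α (t m) (t i) (t (i + 1)))) hlm.le
    (fun i hi him => by linarith [hstep l i hi (by omega) him])
  rw [Finset.sum_neg_distrib] at h1 h2
  rw [truncSum, tailSum, ← Finset.sum_Ico_consecutive _ hpl hlm.le]
  simp only [hkm] at h1 h2
  linarith

lemma exists_mesh_point_near_half {t : ℕ → ℝ} {p m : ℕ} (hp : 0 < t p) (hpm : p < m)
    (hpT : t p ≤ t m / 8) (hratio : ∀ i, p ≤ i → i < m → t (i + 1) ≤ 2 * t i) :
    ∃ l, p ≤ l ∧ l < m ∧ t m / 4 ≤ t l ∧ t l ≤ t m / 2 := by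
  classical
  have hex : ∃ i, p ≤ i ∧ t m / 2 < t i := ⟨m, hpm.le, by linarith⟩
  obtain ⟨h1, h2⟩ := Nat.find_spec hex
  have h3 : Nat.find hex ≤ m := Nat.find_min' hex ⟨hpm.le, by linarith⟩
  have h4 : p ≠ Nat.find hex := by
    intro h
    rw [← h] at h2
    linarith
  obtain ⟨l, hl⟩ : ∃ l, Nat.find hex = l + 1 := Nat.exists_eq_succ_of_ne_zero (by omega)
  have h5 := Nat.find_min hex (m := l) (by omega)
  rw [hl] at h1 h2 h3 h4
  have hpl : p ≤ l := by omega
  have hlm : l < m := by omega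
  refine ⟨l, hpl, hlm, ?_, ?_⟩
  · linarith [hratio l hpl hlm]
  · by_contra! h
    exact h5 ⟨hpl, h⟩

lemma truncSum_rpow_sub_le {α γ : ℝ} {t : ℕ → ℝ} {p l m : ℕ} (hα0 : 0 < α) (hα1 : α < 1)
    (hγ : 0 < γ) (hp : 0 < t p) (hpl : p ≤ l) (hlm : l < m)
    (hmono : ∀ i, i < m → t i < t (i + 1)) (hle : ∀ i j, i ≤ j → j ≤ m → t i ≤ t j) :
    truncSum α t (fun j => t j ^ (α - 1) * (t j ^ (-γ) - t m ^ (-γ))) p m ≤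
      -(t l ^ (α - 1) * (t l ^ (-γ) - t m ^ (-γ)) *
        ((t m - t l) ^ (-α) - (t m - t p) ^ (-α))) := by
  have hpos : ∀ i, p ≤ i → i ≤ m → 0 < t i := fun i hi him => hp.trans_le (hle p i hi him)
  have hk : ∀ i, p ≤ i → i ≤ m → 0 ≤ t i ^ (-γ) - t m ^ (-γ) := fun i hi him =>
    sub_nonneg.2 (Real.rpow_le_rpow_of_nonpos (hpos i hi him) (hle i m him le_rfl) (by linarith))
  refine truncSum_antitone_le (k := fun j => t j ^ (α - 1) * (t j ^ (-γ) - t m ^ (-γ)))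
    hα0.le hα1 hp hpl hlm hmono hle ?_ ?_ ?_
  · intro i hi him
    have hti := hpos i hi him.le
    have hlt := (hmono i him).le
    refine mul_le_mul (Real.rpow_le_rpow_of_nonpos hti hlt (by linarith)) ?_
      (hk (i + 1) (by omega) him) (Real.rpow_nonneg hti.le _)
    exact sub_le_sub_right (Real.rpow_le_rpow_of_nonpos hti hlt (by linarith)) _
  · exact mul_nonneg (Real.rpow_nonneg hp.le _) (hk p le_rfl (by omega))
  · simp

lemma rpow_sub_mul_rpow_sub_ge {α γ a b T : ℝ} (hα0 : 0 < α) (hα1 : α < 1) (hγ : 0 < γ)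
    (hbT : b ≤ T / 8) (haT4 : T / 4 ≤ a) (haT2 : a ≤ T / 2) (hT : 0 < T) :
    ((1 / 2) ^ (-γ) - 1) * ((3 / 4) ^ (-α) - (7 / 8) ^ (-α)) * T ^ (-γ - 1) ≤
      a ^ (α - 1) * (a ^ (-γ) - T ^ (-γ)) * ((T - a) ^ (-α) - (T - b) ^ (-α)) := by
  have ha : 0 < a := by linarith
  have h1 : T ^ (α - 1) ≤ a ^ (α - 1) :=
    Real.rpow_le_rpow_of_nonpos ha (by linarith) (by linarith)
  have h2 : ((1 / 2) ^ (-γ) - 1) * T ^ (-γ) ≤ a ^ (-γ) - T ^ (-γ) := by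
    have h : (1 / 2 * T) ^ (-γ) ≤ a ^ (-γ) :=
      Real.rpow_le_rpow_of_nonpos ha (by linarith) (by linarith)
    rw [Real.mul_rpow (by norm_num) hT.le] at h
    linarith
  have h3 : ((3 / 4) ^ (-α) - (7 / 8) ^ (-α)) * T ^ (-α) ≤
      (T - a) ^ (-α) - (T - b) ^ (-α) := by
    have h : (3 / 4 * T) ^ (-α) ≤ (T - a) ^ (-α) :=
      Real.rpow_le_rpow_of_nonpos (by linarith) (by linarith) (by linarith)
    have h' : (T - b) ^ (-α) ≤ (7 / 8 * T) ^ (-α) :=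
      Real.rpow_le_rpow_of_nonpos (by linarith) (by linarith) (by linarith)
    rw [Real.mul_rpow (by norm_num) hT.le] at h h'
    linarith
  have h4 : (0 : ℝ) ≤ (1 / 2) ^ (-γ) - 1 := sub_nonneg.2
    (Real.one_le_rpow_of_pos_of_le_one_of_nonpos (by norm_num) (by norm_num) (by linarith))
  have h5 : (0 : ℝ) ≤ (3 / 4) ^ (-α) - (7 / 8) ^ (-α) := sub_nonneg.2
    (Real.rpow_le_rpow_of_nonpos (by norm_num) (by norm_num) (by linarith))
  have e : T ^ (-γ - 1) = T ^ (α - 1) * T ^ (-γ) * T ^ (-α) := by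
    rw [← Real.rpow_add hT, ← Real.rpow_add hT]
    congr 1
    ring
  calc _ = T ^ (α - 1) * (((1 / 2) ^ (-γ) - 1) * T ^ (-γ)) *
        (((3 / 4) ^ (-α) - (7 / 8) ^ (-α)) * T ^ (-α)) := by rw [e]; ring
    _ ≤ _ := by
      have h6 : 0 ≤ a ^ (-γ) - T ^ (-γ) := le_trans (by positivity) h2
      gcongr

lemma exists_nat_mesh_threshold {α q r c0 A B δ : ℝ} (hα0 : 0 < α) (hq : 0 < q) (hr : 0 < r)
    (hc0 : 0 < c0) (hδ : 0 < δ) :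
    ∃ K : ℕ, 1 ≤ K ∧ A * ((c0 * (K : ℝ) ^ r)⁻¹) ^ q ≤ 1 / 2 ∧
      B * (((c0 * (K : ℝ) ^ r)⁻¹) ^ (2 * q) + ((c0 * (K : ℝ) ^ r)⁻¹) ^ α) ≤ δ := by
  have hθ : Filter.Tendsto (fun K : ℕ => (c0 * (K : ℝ) ^ r)⁻¹) Filter.atTop (nhds 0) :=
    (((tendsto_rpow_atTop hr).comp tendsto_natCast_atTop_atTop).const_mul_atTop
      hc0).inv_tendsto_atTop
  have hpow : ∀ e : ℝ, 0 < e →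
      Filter.Tendsto (fun K : ℕ => ((c0 * (K : ℝ) ^ r)⁻¹) ^ e) Filter.atTop (nhds 0) := by
    intro e he
    have h := hθ.rpow_const (p := e) (Or.inr he.le)
    rwa [Real.zero_rpow he.ne'] at h
  have h1 := (hpow q hq).const_mul A
  have h2 := ((hpow (2 * q) (by linarith)).add (hpow α hα0)).const_mul B
  rw [mul_zero] at h1
  rw [add_zero, mul_zero] at h2
  obtain ⟨K, hK, hK1, hK2⟩ := ((Filter.eventually_ge_atTop 1).and
    ((h1.eventually_le_const (show (0 : ℝ) < 1 / 2 by norm_num)).and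
      (h2.eventually_le_const hδ))).exists
  exact ⟨K, hK, hK1, hK2⟩

lemma mul_rpow_neg_sub_one_le_inv {γ τ s : ℝ} (hγ : 0 ≤ γ) (hτ : 0 < τ) (hs : τ ≤ s) :
    τ ^ γ * s ^ (-γ - 1) ≤ 1 / s := by
  have hs0 : 0 < s := hτ.trans_le hs
  rw [Real.rpow_sub_one hs0.ne', Real.rpow_neg hs0.le, ← mul_div_assoc, ← div_eq_mul_inv]
  gcongr
  exact (div_le_one (by positivity)).2 (Real.rpow_le_rpow hτ.le hs hγ)

/-- Existence of a barrier function with `δ_t^α B̄^j ≳ τ^γ t_j^{-γ-1}` for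
`γ ∈ (0, α)` on quasi-graded meshes with `1 ≤ r ≤ (2-α)/α` (Lemma 2.6). -/
theorem stmt7 (α r γ T c0 C0 : ℝ)
    (hα0 : 0 < α) (hα1 : α < 1)
    (hr1 : 1 ≤ r) (hr2 : r ≤ (2 - α) / α)
    (hγ0 : 0 < γ) (hγα : γ < α)
    (hT : 0 < T) (hc0 : 0 < c0) (hcC : c0 ≤ C0) :
    ∃ c C : ℝ, 0 < c ∧ 0 < C ∧
      ∀ (M : ℕ) (t : ℕ → ℝ), IsMesh T M t → QuasiGraded r c0 C0 M t →
        ∃ B : ℕ → ℝ, B 0 = 0 ∧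
          (∀ j : ℕ, 1 ≤ j → j ≤ M → 0 ≤ B j ∧ B j ≤ C * (t j) ^ (α - 1)) ∧
          (∀ j : ℕ, 1 ≤ j → j ≤ M →
            c * ((t 1) ^ γ * (t j) ^ (-γ - 1)) ≤ deltaL1 α t B j) := by
  have hr : 0 < r := by linarith
  have hC0 : 0 < C0 := by linarith
  have hq : 0 < 1 / r := by positivity
  have hq1 : 1 / r ≤ 1 := (div_le_one hr).2 hr1
  have hqα : α ≤ 1 / r * (2 - α) := by
    rw [le_div_iff₀ hα0] at hr2
    rw [one_div_mul_eq_div, le_div_iff₀ hr]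
    linarith
  obtain ⟨K, hK1, hKa, hKb⟩ := exists_nat_mesh_threshold (A := C0)
    (B := 64 * C0 ^ 2 / (2 * (1 / r) - α) + 144 * C0 ^ 2 * c0 ^ (-α))
    hα0 hq hr hc0 (show 0 < (1 - α) / 2 by linarith)
  have hKr : 0 < (K : ℝ) ^ r := by positivity
  set Λ := C0 * (K : ℝ) ^ r with hΛ
  have hΛ0 : 0 < Λ := by positivity
  set κ := ((1 / 2 : ℝ) ^ (-γ) - 1) * ((3 / 4) ^ (-α) - (7 / 8) ^ (-α)) with hκ
  have hκ0 : 0 < κ := by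
    refine mul_pos (sub_pos.2 ?_) (sub_pos.2 ?_)
    · exact Real.one_lt_rpow_of_pos_of_lt_one_of_neg (by norm_num) (by norm_num) (by linarith)
    · exact Real.rpow_lt_rpow_of_neg (by norm_num) (by norm_num) (by linarith)
  have hΓ : 0 < Real.Gamma (1 - α) := Real.Gamma_pos_of_pos (by linarith)
  have h1α : 0 < 1 - α := by linarith
  set d := min (1 / 2 * Λ ^ (α - 2)) (min ((1 - α) / 32) (1 / 2 * κ)) with hd
  have hd0 : 0 < d := by positivity
  refine ⟨1 / Real.Gamma (1 - α) * d, 1, by positivity, one_pos, ?_⟩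
  rintro M t ⟨hM, h0, hmono, -⟩ ⟨-, hmesh, hstep⟩
  have hle : ∀ i j, i ≤ j → j ≤ M → t i ≤ t j := by
    intro i j hij
    induction j, hij using Nat.le_induction with
    | base => exact fun _ => le_rfl
    | succ j _ ih => exact fun hj => (ih (by omega)).trans (hmono j hj).le
  have hτ : 0 < t 1 := by simpa [h0] using hmono 0 (by omega)
  have hpos : ∀ j, 1 ≤ j → j ≤ M → 0 < t j := fun j h1 hj => hτ.trans_le (hle 1 j h1 hj)
  obtain ⟨p, hp⟩ : ∃ p, p = min K M := ⟨_, rfl⟩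
  have hp1 : 1 ≤ p := by omega
  have hpM : p ≤ M := by omega
  have htp : 0 < t p := hpos p hp1 hpM
  have htpΛ : t p ≤ Λ * t 1 := by
    have hpK : (p : ℝ) ^ r ≤ (K : ℝ) ^ r :=
      Real.rpow_le_rpow (by positivity) (by exact_mod_cast (by omega : p ≤ K)) hr.le
    calc t p ≤ C0 * (t 1 * (p : ℝ) ^ r) := (hmesh p hp1 hpM).2
      _ ≤ C0 * (t 1 * (K : ℝ) ^ r) := by gcongr
      _ = Λ * t 1 := by rw [hΛ]; ring
  set f : ℕ → ℝ := fun j => t j ^ (α - 1) * (1 - 1 / 2 * t 1 ^ γ * t j ^ (-γ)) with hf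
  have hfac : ∀ j, 1 ≤ j → j ≤ M → 1 / 2 ≤ 1 - 1 / 2 * t 1 ^ γ * t j ^ (-γ) ∧
      1 - 1 / 2 * t 1 ^ γ * t j ^ (-γ) ≤ 1 := by
    intro j h1 hj
    have htj := hpos j h1 hj
    have h2 : t 1 ^ γ * t j ^ (-γ) ≤ 1 := by
      rw [Real.rpow_neg htj.le, ← div_eq_mul_inv]
      exact (div_le_one (by positivity)).2 (Real.rpow_le_rpow hτ.le (hle 1 j h1 hj) hγ0.le)
    have h3 : 0 ≤ t 1 ^ γ * t j ^ (-γ) := by positivity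
    constructor <;> linarith
  have hf0 : ∀ j, 1 ≤ j → j ≤ M → 0 ≤ f j ∧ f j ≤ t j ^ (α - 1) := by
    intro j h1 hj
    have htj := Real.rpow_pos_of_pos (hpos j h1 hj) (α - 1)
    obtain ⟨h2, h3⟩ := hfac j h1 hj
    exact ⟨mul_nonneg htj.le (by linarith), mul_le_of_le_one_right htj.le h3⟩
  refine ⟨linearStart t f p, by simp [linearStart, h0], ?_, ?_⟩
  · intro j h1 hj
    rw [one_mul, linearStart]
    split_ifs with hjp
    · have htj := hpos j h1 hj
      obtain ⟨h2, h3⟩ := hf0 p hp1 hpM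
      refine ⟨by positivity, ?_⟩
      calc f p / t p * t j ≤ t p ^ (α - 1) / t p * t j := by gcongr
        _ = t p ^ (α - 2) * t j := by
          rw [← Real.rpow_sub_one htp.ne']; ring_nf
        _ ≤ t j ^ (α - 2) * t j := by
          refine mul_le_mul_of_nonneg_right ?_ htj.le
          exact Real.rpow_le_rpow_of_nonpos htj (hle j p hjp hpM) (by linarith)
        _ = t j ^ (α - 1) := by
          rw [← Real.rpow_add_one htj.ne']; ring_nf
    · exact hf0 j h1 hj
  · intro m hm1 hmM
    have htm := hpos m hm1 hmM
    have hτm := hle 1 m hm1 hmM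
    have hrhs : 0 ≤ t 1 ^ γ * t m ^ (-γ - 1) := by positivity
    have hinv := mul_rpow_neg_sub_one_le_inv hγ0.le hτ hτm
    rw [deltaL1_eq_sum_range hα1, mul_assoc]
    refine mul_le_mul_of_nonneg_left ?_ (by positivity)
    rcases le_or_gt m p with hmp | hpm
    · rw [sum_range_linearStart _ h0 (fun i hi => hmono i (hi.trans_le hmM)) hmp]
      have h1 := le_kernelInt hα0.le hα1 htm le_rfl
      rw [sub_zero] at h1
      have h2 : 1 / 2 * t p ^ (α - 1) ≤ f p := by
        have := mul_le_mul_of_nonneg_left (hfac p hp1 hpM).1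
          (Real.rpow_nonneg htp.le (α - 1))
        rw [hf]
        linarith
      have h3 : Λ ^ (α - 2) * t m ^ (α - 2) ≤ t p ^ (α - 2) := by
        rw [← Real.mul_rpow hΛ0.le htm.le]
        exact Real.rpow_le_rpow_of_nonpos htp (htpΛ.trans (by gcongr)) (by linarith)
      calc d * (t 1 ^ γ * t m ^ (-γ - 1)) ≤ 1 / 2 * Λ ^ (α - 2) * (1 / t m) :=
            mul_le_mul (min_le_left _ _) hinv hrhs (by positivity)
        _ = 1 / 2 * (Λ ^ (α - 2) * t m ^ (α - 2)) * (t m * t m ^ (-α)) := by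
            have e : t m ^ (α - 2) * (t m * t m ^ (-α)) = 1 / t m := by
              rw [mul_comm (t m), ← Real.rpow_add_one htm.ne', ← Real.rpow_add htm, one_div,
                ← Real.rpow_neg_one]
              ring_nf
            rw [← e]
            ring
        _ ≤ 1 / 2 * t p ^ (α - 2) * (t m * t m ^ (-α)) := by gcongr
        _ = 1 / 2 * t p ^ (α - 1) / t p * (t m * t m ^ (-α)) := by
            rw [mul_div_assoc, ← Real.rpow_sub_one htp.ne']
            ring_nf
        _ ≤ f p / t p * kernelInt α (t m) 0 (t m) := by
            have : 0 ≤ f p := (hf0 p hp1 hpM).1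
            gcongr
    · have hpK : p = K := by omega
      have hmono' : ∀ i, i < m → t i < t (i + 1) := fun i hi => hmono i (hi.trans_le hmM)
      have hle' : ∀ i j, i ≤ j → j ≤ m → t i ≤ t j := fun i j hij hj =>
        hle i j hij (hj.trans hmM)
      rw [sum_range_linearStart_eq_truncSum h0 hmono' htp hpm.le]
      have hθ : t 1 / t p ≤ (c0 * (K : ℝ) ^ r)⁻¹ := by
        have h := (hmesh p hp1 hpM).1
        rw [hpK] at h ⊢
        rw [div_le_iff₀ (hpK ▸ htp), inv_mul_eq_div, le_div_iff₀ (by positivity)]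
        linarith
      have hθ0 : 0 < t 1 / t p := by positivity
      have hβ : 0 < 2 * (1 / r) - α := by nlinarith
      have hθ1 : C0 * (t 1 / t p) ^ (1 / r) ≤ 1 / 2 := le_trans (by gcongr) hKa
      have hθ2 := le_trans (b := (64 * C0 ^ 2 / (2 * (1 / r) - α) + 144 * C0 ^ 2 * c0 ^ (-α)) *
        (((c0 * (K : ℝ) ^ r)⁻¹) ^ (2 * (1 / r)) + ((c0 * (K : ℝ) ^ r)⁻¹) ^ α))
        (a := (64 * C0 ^ 2 / (2 * (1 / r) - α) + 144 * C0 ^ 2 * c0 ^ (-α)) *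
        ((t 1 / t p) ^ (2 * (1 / r)) + (t 1 / t p) ^ α)) (by gcongr) hKb
      have hupper : ∀ i, p ≤ i → i < m →
          t (i + 1) - t i ≤ C0 * (t 1 ^ (1 / r) * t (i + 1) ^ (1 - 1 / r)) :=
        fun i _ him => (hstep (i + 1) (by omega) (by omega)).2
      obtain ⟨n, rfl⟩ : ∃ n, m = n + 1 := Nat.exists_eq_succ_of_ne_zero (by omega)
      have hG := truncSum_rpow_ge hα0 hα1 hq1 hqα hc0 hτ (hle 1 p hp1 hpM) (by omega)
        hmono' hle' hupper (hstep (n + 1) hm1 hmM).1 hθ1 hθ2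
      set s := t (n + 1) with hs
      have hcomb : f = fun j => (1 - 1 / 2 * t 1 ^ γ * s ^ (-γ)) * t j ^ (α - 1)
          - 1 / 2 * t 1 ^ γ * (t j ^ (α - 1) * (t j ^ (-γ) - s ^ (-γ))) := by
        funext j
        rw [hf]
        ring
      rw [hcomb, truncSum_linear_combination α _ _ t (fun j => t j ^ (α - 1))
        (fun j => t j ^ (α - 1) * (t j ^ (-γ) - s ^ (-γ)))]
      set G := truncSum α t (fun j => t j ^ (α - 1)) p (n + 1)
      set H := truncSum α t (fun j => t j ^ (α - 1) * (t j ^ (-γ) - s ^ (-γ))) p (n + 1)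
      have hhalf := (hfac (n + 1) hm1 hmM).1
      have hG0 : 0 ≤ G := le_trans (by positivity) hG
      have hτγ : 0 < t 1 ^ γ := by positivity
      have hGhalf := mul_le_mul_of_nonneg_right hhalf hG0
      rcases le_or_gt (t p) (s / 8) with hps | hps
      · have hratio : ∀ i, p ≤ i → i < n + 1 → t (i + 1) ≤ 2 * t i := by
          intro i hi him
          have hti := hpos (i + 1) (by omega) (by omega)
          have h1 : C0 * (t 1 ^ (1 / r) * t (i + 1) ^ (1 - 1 / r)) =
              C0 * (t 1 / t (i + 1)) ^ (1 / r) * t (i + 1) := by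
            rw [Real.div_rpow hτ.le hti.le, Real.rpow_sub hti, Real.rpow_one]
            ring
          have h2 : C0 * (t 1 / t (i + 1)) ^ (1 / r) ≤ C0 * (t 1 / t p) ^ (1 / r) := by
            have := hle' p (i + 1) (by omega) him
            gcongr
          have h3 := mul_le_mul_of_nonneg_right (h2.trans hθ1) hti.le
          linarith [hupper i hi him]
        obtain ⟨l, hpl, hln, hl4, hl2⟩ := exists_mesh_point_near_half htp hpm hps hratio
        have hH := truncSum_rpow_sub_le hα0 hα1 hγ0 htp hpl hln hmono' hle'
        have hl := rpow_sub_mul_rpow_sub_ge hα0 hα1 hγ0 hps hl4 hl2 htm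
        have h1 : κ * s ^ (-γ - 1) ≤ -H := by linarith
        have h2 := mul_le_mul_of_nonneg_left h1 (show 0 ≤ 1 / 2 * t 1 ^ γ by positivity)
        have h3 : d * (t 1 ^ γ * s ^ (-γ - 1)) ≤ 1 / 2 * κ * (t 1 ^ γ * s ^ (-γ - 1)) :=
          mul_le_mul_of_nonneg_right ((min_le_right _ _).trans (min_le_right _ _)) hrhs
        linarith
      · have hH := truncSum_rpow_sub_le hα0 hα1 hγ0 htp le_rfl hpm hmono' hle'
        rw [sub_self, mul_zero, neg_zero] at hH
        have h2 := mul_nonpos_of_nonneg_of_nonpos (show 0 ≤ 1 / 2 * t 1 ^ γ by positivity) hH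
        have h3 : (1 : ℝ) / 8 ≤ (t p / s) ^ α := by
          have h4 : 1 / 8 ≤ t p / s := by rw [le_div_iff₀ htm]; linarith
          calc (1 : ℝ) / 8 ≤ t p / s := h4
            _ = (t p / s) ^ (1 : ℝ) := (Real.rpow_one _).symm
            _ ≤ (t p / s) ^ α := Real.rpow_le_rpow_of_exponent_ge (by positivity)
                ((div_le_one htm).2 (hle' p (n + 1) hpm.le le_rfl)) hα1.le
        calc d * (t 1 ^ γ * s ^ (-γ - 1)) ≤ (1 - α) / 32 * (1 / s) :=
              mul_le_mul ((min_le_right _ _).trans (min_le_left _ _)) hinv hrhs (by positivity)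
          _ = 1 / 2 * ((1 - α) / 2 * (1 / 8) / s) := by ring
          _ ≤ 1 / 2 * ((1 - α) / 2 * (t p / s) ^ α / s) := by gcongr
          _ ≤ 1 / 2 * G := by gcongr
          _ ≤ _ := by linarith
end

section
/- Let α ∈ (0,1), let r satisfy 1 ≤ r ≤ (2−α)/α, and let γ ∈ [α−1, 0]. Let the temporal mesh be quasi-graded with parameter r and constants c_0 ≤ C_0. Then there exists a constant C > 0, depending only on α, γ, r, T, c_0, C_0, such that: if V^0,...,V^M is a real sequence with V^0 = 0 and |δ_t^α V^j| ≤ τ^γ t_j^{−γ−1} for j = 1,...,n (for some n ≤ M), then |V^n| ≤ C t_n^{α−1}(1 + ln(t_n/τ)) in the case γ = 0, and |V^n| ≤ C t_n^{α−1}(τ/t_n)^γ in the case γ ∈ [α−1, 0). -/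
open Real MeasureTheory Set

namespace L1Stability

/-- The mean of `s ↦ (x - s) ^ (-α)` over `[u, v]`, in closed form. -/
noncomputable def kernelMean (α x u v : ℝ) : ℝ :=
  ((x - u) ^ (1 - α) - (x - v) ^ (1 - α)) / ((1 - α) * (v - u))

/-- A primitive of `s ↦ -(1 - α) * s ^ (α - 2) * (x - s) ^ (-α)` vanishing at `x`. -/
noncomputable def primitive (α x s : ℝ) : ℝ := s ^ (α - 1) * (x - s) ^ (1 - α) / x

lemma rpow_le_tangent {e x y : ℝ} (he0 : 0 ≤ e) (he1 : e ≤ 1) (hx : 0 < x) (hy : 0 ≤ y) :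
    y ^ e ≤ x ^ e + e * x ^ (e - 1) * (y - x) := by
  have h := rpow_one_add_le_one_add_mul_self (s := y / x - 1)
    (by have : 0 ≤ y / x := by positivity
        linarith) he0 he1
  have h1 : (1 : ℝ) + (y / x - 1) = y / x := by ring
  rw [h1, Real.div_rpow hy hx.le, div_le_iff₀ (by positivity)] at h
  refine h.trans (le_of_eq ?_)
  rw [Real.rpow_sub_one hx.ne']
  field_simp

lemma tangent_le_rpow {e x y : ℝ} (he : e ≤ 0) (hx : 0 < x) (hy : 0 < y) :
    x ^ e + e * x ^ (e - 1) * (y - x) ≤ y ^ e := by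
  have h : 1 + e * (y / x - 1) ≤ (y / x) ^ e := by
    have hq : 0 < y / x := by positivity
    have h2 : Real.log (y / x) ≤ y / x - 1 := Real.log_le_sub_one_of_pos hq
    rw [Real.rpow_def_of_pos hq]
    nlinarith [Real.add_one_le_exp (Real.log (y / x) * e)]
  rw [Real.div_rpow hy.le hx.le, le_div_iff₀ (by positivity)] at h
  refine le_trans (le_of_eq ?_) h
  rw [Real.rpow_sub_one hx.ne']
  field_simp

lemma integral_kernel {α x u v : ℝ} (hα1 : α < 1) :
    ∫ s in u..v, (x - s) ^ (-α) =
      ((x - u) ^ (1 - α) - (x - v) ^ (1 - α)) / (1 - α) := by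
  rw [intervalIntegral.integral_comp_sub_left (fun s => s ^ (-α)) x,
    integral_rpow (Or.inl (by linarith))]
  ring_nf

lemma deltaL1_eq {α : ℝ} (hα1 : α < 1) (t V : ℕ → ℝ) (m : ℕ) :
    deltaL1 α t V m = (1 / Real.Gamma (1 - α)) *
      ∑ j ∈ Finset.Icc 1 m, (V j - V (j - 1)) * kernelMean α (t m) (t (j - 1)) (t j) := by
  unfold deltaL1 kernelMean
  congr 1
  refine Finset.sum_congr rfl fun j _ => ?_
  rw [integral_kernel hα1, div_mul_div_comm, mul_div_assoc, mul_comm (1 - α)]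

lemma le_kernelMean {α x u v : ℝ} (hα0 : 0 < α) (hα1 : α < 1) (huv : u < v) (hvx : v ≤ x) :
    (x - u) ^ (-α) ≤ kernelMean α x u v := by
  have h := rpow_le_tangent (e := 1 - α) (x := x - u) (y := x - v) (by linarith) (by linarith)
    (by linarith) (by linarith)
  have h1 : 0 < (1 - α) * (v - u) := mul_pos (by linarith) (by linarith)
  rw [kernelMean, le_div_iff₀ h1]
  rw [show 1 - α - 1 = -α by ring] at h
  linarith

lemma kernelMean_le {α x u v : ℝ} (hα0 : 0 < α) (hα1 : α < 1) (huv : u < v) (hvx : v < x) :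
    kernelMean α x u v ≤ (x - v) ^ (-α) := by
  have h := rpow_le_tangent (e := 1 - α) (x := x - v) (y := x - u) (by linarith) (by linarith)
    (by linarith) (by linarith)
  have h1 : 0 < (1 - α) * (v - u) := mul_pos (by linarith) (by linarith)
  rw [kernelMean, div_le_iff₀ h1]
  rw [show 1 - α - 1 = -α by ring] at h
  linarith

lemma kernelMean_pos {α x u v : ℝ} (hα0 : 0 < α) (hα1 : α < 1) (huv : u < v) (hvx : v ≤ x) :
    0 < kernelMean α x u v :=
  (Real.rpow_pos_of_pos (by linarith) _).trans_le (le_kernelMean hα0 hα1 huv hvx)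

lemma hasDerivAt_primitive {α x s : ℝ} (hs : 0 < s) (hsx : s < x) :
    HasDerivAt (primitive α x) (-((1 - α) * s ^ (α - 2) * (x - s) ^ (-α))) s := by
  have hx : 0 < x := hs.trans hsx
  have h1 : HasDerivAt (fun s : ℝ => s ^ (α - 1)) ((α - 1) * s ^ (α - 1 - 1)) s :=
    Real.hasDerivAt_rpow_const (Or.inl hs.ne')
  have h2 : HasDerivAt (fun s : ℝ => (x - s) ^ (1 - α))
      (-1 * (1 - α) * (x - s) ^ (1 - α - 1)) s :=
    ((hasDerivAt_id s).const_sub x).rpow_const (Or.inl (by simp; linarith))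
  refine ((h1.mul h2).div_const x).congr_deriv ?_
  have hxs : 0 < x - s := by linarith
  rw [show α - 1 - 1 = α - 2 by ring, show 1 - α - 1 = -α by ring,
    show α - 1 = (α - 2) + 1 by ring, show 1 - α = -α + 1 by ring,
    Real.rpow_add_one hs.ne', Real.rpow_add_one hxs.ne']
  field_simp
  ring

lemma hasDerivAt_sub_rpow {α x s : ℝ} (hsx : s < x) :
    HasDerivAt (fun s : ℝ => (x - s) ^ (1 - α)) (-((1 - α) * (x - s) ^ (-α))) s := by
  refine (((hasDerivAt_id s).const_sub x).rpow_const (p := 1 - α)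
    (Or.inl (by simp; linarith))).congr_deriv ?_
  simp only [id]
  rw [show 1 - α - 1 = -α by ring]
  ring

lemma continuousOn_primitive {α x u v : ℝ} (hα1 : α < 1) (hu : 0 < u) :
    ContinuousOn (primitive α x) (Set.Icc u v) := by
  have h1 : ContinuousOn (fun s : ℝ => s ^ (α - 1)) (Set.Icc u v) :=
    continuousOn_id.rpow_const fun s hs => Or.inl (hu.trans_le hs.1).ne'
  have h2 : ContinuousOn (fun s : ℝ => (x - s) ^ (1 - α)) (Set.Icc u v) :=
    (continuousOn_const.sub continuousOn_id).rpow_const fun s _ => Or.inr (by linarith)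
  exact (h1.mul h2).div_const x

lemma mul_sub_rpow_le_primitive_sub {α x u v : ℝ} (hα1 : α < 1) (hu : 0 < u) (huv : u ≤ v)
    (hvx : v ≤ x) :
    v ^ (α - 2) * ((x - u) ^ (1 - α) - (x - v) ^ (1 - α)) ≤
      primitive α x u - primitive α x v := by
  have h2 : ContinuousOn (fun s : ℝ => (x - s) ^ (1 - α)) (Set.Icc u v) :=
    (continuousOn_const.sub continuousOn_id).rpow_const fun s _ => Or.inr (by linarith)
  have hanti : AntitoneOn (fun s => primitive α x s - v ^ (α - 2) * (x - s) ^ (1 - α))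
      (Set.Icc u v) := by
    refine antitoneOn_of_hasDerivWithinAt_nonpos (convex_Icc u v)
      ((continuousOn_primitive hα1 hu).sub (h2.const_smul (v ^ (α - 2))))
      (fun s hs => ?_) (fun s hs => ?_)
      (f' := fun s => -((1 - α) * s ^ (α - 2) * (x - s) ^ (-α)) -
        v ^ (α - 2) * (-((1 - α) * (x - s) ^ (-α))))
    · rw [interior_Icc] at hs
      exact ((hasDerivAt_primitive (hu.trans hs.1) (hs.2.trans_le hvx)).sub
        ((hasDerivAt_sub_rpow (hs.2.trans_le hvx)).const_mul _)).hasDerivWithinAt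
    · rw [interior_Icc] at hs
      have h3 : v ^ (α - 2) ≤ s ^ (α - 2) :=
        Real.rpow_le_rpow_of_nonpos (hu.trans hs.1) hs.2.le (by linarith)
      have h4 : 0 ≤ (1 - α) * (x - s) ^ (-α) :=
        mul_nonneg (by linarith) (Real.rpow_nonneg (by linarith [hs.2]) _)
      nlinarith
  have := hanti (Set.left_mem_Icc.2 huv) (Set.right_mem_Icc.2 huv) huv
  simp only at this
  linarith

lemma mul_rpow_sub_le_primitive_sub {α x u v : ℝ} (hα0 : 0 < α) (hα1 : α < 1) (hu : 0 < u)
    (huv : u ≤ v) (hvx : v ≤ x) :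
    (x - u) ^ (-α) * (u ^ (α - 1) - v ^ (α - 1)) ≤ primitive α x u - primitive α x v := by
  have h2 : ContinuousOn (fun s : ℝ => s ^ (α - 1)) (Set.Icc u v) :=
    continuousOn_id.rpow_const fun s hs => Or.inl (hu.trans_le hs.1).ne'
  have hanti : AntitoneOn (fun s => primitive α x s - (x - u) ^ (-α) * s ^ (α - 1))
      (Set.Icc u v) := by
    refine antitoneOn_of_hasDerivWithinAt_nonpos (convex_Icc u v)
      ((continuousOn_primitive hα1 hu).sub (h2.const_smul ((x - u) ^ (-α))))
      (fun s hs => ?_) (fun s hs => ?_)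
      (f' := fun s => -((1 - α) * s ^ (α - 2) * (x - s) ^ (-α)) -
        (x - u) ^ (-α) * ((α - 1) * s ^ (α - 1 - 1)))
    · rw [interior_Icc] at hs
      exact ((hasDerivAt_primitive (hu.trans hs.1) (hs.2.trans_le hvx)).sub
        ((Real.hasDerivAt_rpow_const
          (Or.inl (hu.trans hs.1).ne')).const_mul _)).hasDerivWithinAt
    · rw [interior_Icc] at hs
      have h3 : (x - u) ^ (-α) ≤ (x - s) ^ (-α) :=
        Real.rpow_le_rpow_of_nonpos (by linarith [hs.2]) (by linarith [hs.1]) (by linarith)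
      have h4 : 0 ≤ (1 - α) * s ^ (α - 2) :=
        mul_nonneg (by linarith) (Real.rpow_nonneg (hu.trans hs.1).le _)
      rw [show α - 1 - 1 = α - 2 by ring]
      nlinarith
  have := hanti (Set.left_mem_Icc.2 huv) (Set.right_mem_Icc.2 huv) huv
  simp only at this
  linarith

/-- A constant for the consistency estimate of the L1 kernel applied to `s ^ (α - 1)`. -/
noncomputable def gapConst (α κ : ℝ) : ℝ := 4 * κ ^ (α - 2) + 2 * (κ / 2) ^ (α - 3)

lemma gapConst_pos {α κ : ℝ} (hκ : 0 < κ) : 0 < gapConst α κ := by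
  unfold gapConst; positivity

lemma gap_near {α x u v : ℝ} (hα0 : 0 < α) (hα1 : α < 1) (hu : 0 < u) (huv : u < v)
    (hvx : v ≤ x) :
    (u ^ (α - 1) - v ^ (α - 1)) * kernelMean α x u v - (primitive α x u - primitive α x v) ≤
      2 * u ^ (α - 3) * (v - u) * ((x - u) ^ (1 - α) - (x - v) ^ (1 - α)) := by
  have hv : 0 < v := hu.trans huv
  have h1 := mul_sub_rpow_le_primitive_sub hα1 hu huv.le hvx
  have h2 := tangent_le_rpow (e := α - 1) (by linarith) hu hv
  have h3 := tangent_le_rpow (e := α - 2) (by linarith) hu hv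
  rw [show α - 1 - 1 = α - 2 by ring] at h2
  rw [show α - 2 - 1 = α - 3 by ring] at h3
  have hJ : 0 ≤ (x - u) ^ (1 - α) - (x - v) ^ (1 - α) :=
    sub_nonneg.2 (Real.rpow_le_rpow (by linarith) (by linarith) (by linarith))
  set J := (x - u) ^ (1 - α) - (x - v) ^ (1 - α) with hJdef
  have hd : 0 < (1 - α) * (v - u) := mul_pos (by linarith) (by linarith)
  have h4 : (u ^ (α - 1) - v ^ (α - 1)) * kernelMean α x u v ≤ u ^ (α - 2) * J := by
    rw [kernelMean, ← hJdef, ← mul_div_assoc, div_le_iff₀ hd]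
    nlinarith
  have h5 : 0 < u ^ (α - 3) := by positivity
  have h6 : u ^ (α - 2) - v ^ (α - 2) ≤ 2 * u ^ (α - 3) * (v - u) := by
    have : 0 ≤ α * (u ^ (α - 3) * (v - u)) :=
      mul_nonneg hα0.le (mul_nonneg h5.le (by linarith))
    nlinarith
  nlinarith [mul_le_mul_of_nonneg_right h6 hJ]

lemma gap_far {α x u v : ℝ} (hα0 : 0 < α) (hα1 : α < 1) (hu : 0 < u) (huv : u < v)
    (hvx : v ≤ x / 2) :
    (u ^ (α - 1) - v ^ (α - 1)) * kernelMean α x u v - (primitive α x u - primitive α x v) ≤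
      (v - u) * (u ^ (α - 2) * (v - u) * (x / 2) ^ (-α - 1)) := by
  have hv : 0 < v := hu.trans huv
  have hvx' : v < x := by linarith
  have h1 := mul_rpow_sub_le_primitive_sub hα0 hα1 hu huv.le hvx'.le
  have h2 := tangent_le_rpow (e := α - 1) (by linarith) hu hv
  rw [show α - 1 - 1 = α - 2 by ring] at h2
  have h3 := tangent_le_rpow (e := -α) (x := x - v) (y := x - u) (by linarith)
    (by linarith) (by linarith)
  have h4 := kernelMean_le hα0 hα1 huv hvx'
  have h5 : (x - v) ^ (-α - 1) ≤ (x / 2) ^ (-α - 1) :=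
    Real.rpow_le_rpow_of_nonpos (by linarith) (by linarith) (by linarith)
  have hA : 0 ≤ u ^ (α - 1) - v ^ (α - 1) :=
    sub_nonneg.2 (Real.rpow_le_rpow_of_nonpos hu huv.le (by linarith))
  have h6 : 0 < u ^ (α - 2) := by positivity
  have h7 : 0 < (x - v) ^ (-α - 1) := Real.rpow_pos_of_pos (by linarith) _
  have h8 : u ^ (α - 1) - v ^ (α - 1) ≤ u ^ (α - 2) * (v - u) := by
    have : 0 ≤ α * (u ^ (α - 2) * (v - u)) :=
      mul_nonneg hα0.le (mul_nonneg h6.le (by linarith))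
    nlinarith
  have h9 : (x - v) ^ (-α) - (x - u) ^ (-α) ≤ (x / 2) ^ (-α - 1) * (v - u) := by
    have h10 : 0 ≤ (1 - α) * ((x - v) ^ (-α - 1) * (v - u)) :=
      mul_nonneg (by linarith) (mul_nonneg h7.le (by linarith))
    nlinarith
  calc _ ≤ (u ^ (α - 1) - v ^ (α - 1)) * ((x - v) ^ (-α) - (x - u) ^ (-α)) := by
        nlinarith [mul_le_mul_of_nonneg_left h4 hA]
    _ ≤ (u ^ (α - 2) * (v - u)) * ((x / 2) ^ (-α - 1) * (v - u)) := by
        refine (mul_le_mul_of_nonneg_left h9 hA).trans (mul_le_mul_of_nonneg_right h8 ?_)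
        exact mul_nonneg (Real.rpow_nonneg (by linarith) _) (by linarith)
    _ = _ := by ring

lemma gap_le {α κ x u v : ℝ} (hα0 : 0 < α) (hα1 : α < 1) (hκ : 0 < κ) (hu : 0 < u)
    (huv : u < v) (hvx : v ≤ x) (hκu : κ * v ≤ u) :
    (u ^ (α - 1) - v ^ (α - 1)) * kernelMean α x u v - (primitive α x u - primitive α x v) ≤
      gapConst α κ * ((v - u) * ((v - u) * v ^ (α - 2) * x ^ (-α - 1) +
        x ^ (α - 3) * ((x - u) ^ (1 - α) - (x - v) ^ (1 - α)))) := by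
  have hv : 0 < v := hu.trans huv
  have hx : 0 < x := hv.trans_le hvx
  have hvu : 0 ≤ v - u := by linarith
  have hJ : 0 ≤ (x - u) ^ (1 - α) - (x - v) ^ (1 - α) :=
    sub_nonneg.2 (Real.rpow_le_rpow (by linarith) (by linarith) (by linarith))
  set J := (x - u) ^ (1 - α) - (x - v) ^ (1 - α)
  have hX : 0 ≤ (v - u) * ((v - u) * v ^ (α - 2) * x ^ (-α - 1)) := by positivity
  have hY : 0 ≤ (v - u) * (x ^ (α - 3) * J) := by positivity
  have hc1 : 0 < κ ^ (α - 2) := by positivity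
  have hc2 : 0 < (κ / 2) ^ (α - 3) := by positivity
  rcases le_or_gt v (x / 2) with h | h
  · have h1 : u ^ (α - 2) ≤ κ ^ (α - 2) * v ^ (α - 2) := by
      rw [← Real.mul_rpow hκ.le hv.le]
      exact Real.rpow_le_rpow_of_nonpos (by positivity) hκu (by linarith)
    have h2 : (x / 2) ^ (-α - 1) ≤ 4 * x ^ (-α - 1) := by
      rw [Real.div_rpow hx.le (by norm_num), div_le_iff₀ (by positivity)]
      have h3 : (1 : ℝ) ≤ 4 * 2 ^ (-α - 1) := by
        calc (1 : ℝ) = 4 * 2 ^ (-2 : ℝ) := by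
              rw [Real.rpow_neg (by norm_num)]; norm_num
          _ ≤ 4 * 2 ^ (-α - 1) := by
              gcongr
              · norm_num
              · linarith
      have h4 : 0 < x ^ (-α - 1) := by positivity
      nlinarith
    calc _ ≤ _ := gap_far hα0 hα1 hu huv h
      _ ≤ (v - u) * (κ ^ (α - 2) * v ^ (α - 2) * (v - u) * (4 * x ^ (-α - 1))) := by gcongr
      _ = 4 * κ ^ (α - 2) * ((v - u) * ((v - u) * v ^ (α - 2) * x ^ (-α - 1))) := by ring
      _ ≤ _ := by
        unfold gapConst
        nlinarith [mul_nonneg hc1.le hY, mul_nonneg hc2.le hX, mul_nonneg hc2.le hY]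
  · have h1 : u ^ (α - 3) ≤ (κ / 2) ^ (α - 3) * x ^ (α - 3) := by
      rw [← Real.mul_rpow (by positivity) hx.le]
      exact Real.rpow_le_rpow_of_nonpos (by positivity) (by nlinarith) (by linarith)
    calc _ ≤ _ := gap_near hα0 hα1 hu huv hvx
      _ ≤ 2 * ((κ / 2) ^ (α - 3) * x ^ (α - 3)) * (v - u) * J := by gcongr
      _ = 2 * (κ / 2) ^ (α - 3) * ((v - u) * (x ^ (α - 3) * J)) := by ring
      _ ≤ _ := by
        unfold gapConst
        nlinarith [mul_nonneg hc1.le hY, mul_nonneg hc1.le hX, mul_nonneg hc2.le hX]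

lemma gap_le_telescoping {α κ K θ τ x u v : ℝ} (hα0 : 0 < α) (hα1 : α < 1) (hκ : 0 < κ)
    (hθα : θ < α) (hK : 0 < K) (hτ : 0 < τ) (hθ0 : 0 < θ)
    (hu : 0 < u) (huv : u < v) (hvx : v ≤ x) (hκu : κ * v ≤ u)
    (hstep : v - u ≤ K * (τ ^ θ * v ^ (1 - θ))) :
    (u ^ (α - 1) - v ^ (α - 1)) * kernelMean α x u v - (primitive α x u - primitive α x v) ≤
      gapConst α κ * K * τ ^ θ * (x ^ (-α - 1) / (α - θ) * (v ^ (α - θ) - u ^ (α - θ)) +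
        x ^ (α - 2 - θ) * ((x - u) ^ (1 - α) - (x - v) ^ (1 - α))) := by
  have hv : 0 < v := hu.trans huv
  have hx : 0 < x := hv.trans_le hvx
  have hvu : 0 ≤ v - u := by linarith
  have hJ : 0 ≤ (x - u) ^ (1 - α) - (x - v) ^ (1 - α) :=
    sub_nonneg.2 (Real.rpow_le_rpow (by linarith) (by linarith) (by linarith))
  have hg := gapConst_pos (α := α) hκ
  refine (gap_le hα0 hα1 hκ hu huv hvx hκu).trans ?_
  set J := (x - u) ^ (1 - α) - (x - v) ^ (1 - α)
  rw [mul_assoc (gapConst α κ), mul_assoc (gapConst α κ)]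
  refine mul_le_mul_of_nonneg_left ?_ hg.le
  have h1 : (v - u) * v ^ (α - θ - 1) ≤ (v ^ (α - θ) - u ^ (α - θ)) / (α - θ) := by
    have := rpow_le_tangent (e := α - θ) (by linarith) (by linarith) hv hu.le
    rw [le_div_iff₀ (by linarith)]
    linarith
  have h2 : (v - u) * v ^ (α - 2) ≤ K * τ ^ θ * v ^ (α - θ - 1) := by
    calc _ ≤ K * (τ ^ θ * v ^ (1 - θ)) * v ^ (α - 2) := by gcongr
      _ = K * τ ^ θ * (v ^ (1 - θ) * v ^ (α - 2)) := by ring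
      _ = _ := by rw [← Real.rpow_add hv]; ring_nf
  have h3 : (v - u) * x ^ (α - 3) ≤ K * τ ^ θ * x ^ (α - 2 - θ) := by
    calc _ ≤ K * (τ ^ θ * v ^ (1 - θ)) * x ^ (α - 3) := by gcongr
      _ ≤ K * (τ ^ θ * x ^ (1 - θ)) * x ^ (α - 3) := by
          gcongr
          linarith
      _ = K * τ ^ θ * (x ^ (1 - θ) * x ^ (α - 3)) := by ring
      _ = _ := by rw [← Real.rpow_add hx]; ring_nf
  calc _ = (v - u) * ((v - u) * v ^ (α - 2)) * x ^ (-α - 1) + ((v - u) * x ^ (α - 3)) * J := by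
        ring
    _ ≤ (v - u) * (K * τ ^ θ * v ^ (α - θ - 1)) * x ^ (-α - 1) +
        (K * τ ^ θ * x ^ (α - 2 - θ)) * J := by gcongr
    _ = K * τ ^ θ * x ^ (-α - 1) * ((v - u) * v ^ (α - θ - 1)) +
        (K * τ ^ θ * x ^ (α - 2 - θ)) * J := by ring
    _ ≤ K * τ ^ θ * x ^ (-α - 1) * ((v ^ (α - θ) - u ^ (α - θ)) / (α - θ)) +
        (K * τ ^ θ * x ^ (α - 2 - θ)) * J := by gcongr
    _ = _ := by ring

lemma rpow_mul_le_kernelMean_sub_primitive {α x u v : ℝ} (hα0 : 0 < α) (hα1 : α < 1)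
    (hu : 0 < u) (huv : u < v) (hvx : v ≤ x) :
    u ^ α * x ^ (-α - 1) ≤ u ^ (α - 1) * kernelMean α x u v - primitive α x u := by
  have hx : 0 < x := by linarith
  have hxu : 0 < x - u := by linarith
  have h1 := le_kernelMean hα0 hα1 huv hvx
  have h2 : x ^ (-α) ≤ (x - u) ^ (-α) :=
    Real.rpow_le_rpow_of_nonpos hxu (by linarith) (by linarith)
  have e1 : u ^ α = u ^ (α - 1) * u := by rw [← Real.rpow_add_one hu.ne']; ring_nf
  have e2 : x ^ (-α - 1) = x ^ (-α) / x := Real.rpow_sub_one hx.ne' _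
  have e3 : (x - u) ^ (1 - α) = (x - u) ^ (-α) * (x - u) := by
    rw [← Real.rpow_add_one hxu.ne']; ring_nf
  calc u ^ α * x ^ (-α - 1) = u ^ (α - 1) * u * (x ^ (-α) / x) := by rw [e1, e2]
    _ ≤ u ^ (α - 1) * u * ((x - u) ^ (-α) / x) := by gcongr
    _ = u ^ (α - 1) * (x - u) ^ (-α) - primitive α x u := by
        rw [primitive, e3]; field_simp; ring
    _ ≤ _ := by gcongr

lemma primitive_add_le {α x u : ℝ} (hα0 : 0 < α) (hα1 : α < 1) (hu : 0 < u) (hux : u ≤ x) :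
    primitive α x u + (1 - α) * (u ^ α * x ^ (-α - 1)) ≤ u ^ (α - 1) * x ^ (-α) := by
  have hx : 0 < x := by linarith
  have h := rpow_le_tangent (e := 1 - α) (by linarith) (by linarith) hx (sub_nonneg.2 hux)
  rw [show 1 - α - 1 = -α by ring] at h
  have e1 : u ^ α = u ^ (α - 1) * u := by rw [← Real.rpow_add_one hu.ne']; ring_nf
  have e2 : x ^ (-α - 1) = x ^ (-α) / x := Real.rpow_sub_one hx.ne' _
  have e3 : x ^ (1 - α) = x ^ (-α) * x := by
    rw [← Real.rpow_add_one hx.ne']; ring_nf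
  rw [e3] at h
  calc _ ≤ u ^ (α - 1) * (x ^ (-α) * x + (1 - α) * x ^ (-α) * (x - u - x)) / x +
        (1 - α) * (u ^ α * x ^ (-α - 1)) := by
        unfold primitive; gcongr
    _ = _ := by rw [e1, e2]; field_simp; ring

/-- The running sum `∑ i ≤ j, τ_i * τ ^ γ * t_i ^ (-γ - 1)`. -/
noncomputable def weight (γ : ℝ) (t : ℕ → ℝ) (j : ℕ) : ℝ :=
  ∑ i ∈ Finset.Icc 1 j, (t i - t (i - 1)) * (t 1 ^ γ * t i ^ (-γ - 1))

/-- The barrier `t ^ (α - 1) * weight`, frozen on the levels `1, ..., Q` and vanishing at `0`. -/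
noncomputable def barrier (α γ : ℝ) (t : ℕ → ℝ) (Q j : ℕ) : ℝ :=
  if j = 0 then 0 else t (max j Q) ^ (α - 1) * weight γ t (max j Q)

/-- The L1 sum without the factor `1 / Γ(1 - α)`, truncated at level `l`. -/
noncomputable def kernelSum (α : ℝ) (t V : ℕ → ℝ) (m l : ℕ) : ℝ :=
  ∑ j ∈ Finset.Icc 1 l, (V j - V (j - 1)) * kernelMean α (t m) (t (j - 1)) (t j)

lemma weight_succ (γ : ℝ) (t : ℕ → ℝ) (j : ℕ) :
    weight γ t (j + 1) =
      weight γ t j + (t (j + 1) - t j) * (t 1 ^ γ * t (j + 1) ^ (-γ - 1)) := by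
  unfold weight
  rw [Finset.sum_Icc_succ_top (by omega)]
  simp

lemma kernelSum_succ (α : ℝ) (t V : ℕ → ℝ) (m l : ℕ) :
    kernelSum α t V m (l + 1) =
      kernelSum α t V m l + (V (l + 1) - V l) * kernelMean α (t m) (t l) (t (l + 1)) := by
  unfold kernelSum
  rw [Finset.sum_Icc_succ_top (by omega)]
  simp

section Mesh

variable {t : ℕ → ℝ} {m : ℕ}

lemma mesh_mono (hmono : ∀ j, j < m → t j < t (j + 1)) {i j : ℕ} (hij : i ≤ j) (hj : j ≤ m) :
    t i ≤ t j := by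
  induction j, hij using Nat.le_induction with
  | base => exact le_rfl
  | succ k _ ih => exact (ih (by omega)).trans (hmono k (by omega)).le

lemma mesh_pos (ht0 : t 0 = 0) (hmono : ∀ j, j < m → t j < t (j + 1)) {j : ℕ} (hj1 : 1 ≤ j)
    (hj : j ≤ m) : 0 < t j := by
  have h1 := hmono 0 (by omega)
  have h2 := mesh_mono hmono hj1 hj
  rw [ht0] at h1
  exact h1.trans_le h2

lemma le_weight {γ : ℝ} (hγ : -1 < γ) (ht0 : t 0 = 0) (hmono : ∀ j, j < m → t j < t (j + 1))
    {j : ℕ} (hj1 : 1 ≤ j) (hj : j ≤ m) : t 1 ^ γ * t j ^ (-γ) ≤ weight γ t j := by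
  have hpos := mesh_pos ht0 hmono hj1 hj
  have h1pos := mesh_pos ht0 hmono le_rfl (hj1.trans hj)
  have key : ∀ i, i ≤ j → t i * (t 1 ^ γ * t j ^ (-γ - 1)) ≤ weight γ t i := by
    intro i
    induction i with
    | zero => intro _; simp [ht0, weight]
    | succ k ih =>
      intro hk
      rw [weight_succ]
      have h1 := ih (by omega)
      have h2 : 0 < t (k + 1) - t k := sub_pos.2 (hmono k (by omega))
      have h3 : t j ^ (-γ - 1) ≤ t (k + 1) ^ (-γ - 1) :=
        Real.rpow_le_rpow_of_nonpos (mesh_pos ht0 hmono (by omega) (by omega))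
          (mesh_mono hmono hk hj) (by linarith)
      have h4 : (t (k + 1) - t k) * (t 1 ^ γ * t j ^ (-γ - 1)) ≤
          (t (k + 1) - t k) * (t 1 ^ γ * t (k + 1) ^ (-γ - 1)) := by gcongr
      linarith
  refine le_trans (le_of_eq ?_) (key j le_rfl)
  rw [Real.rpow_sub_one hpos.ne']
  field_simp

lemma weight_pos {γ : ℝ} (hγ : -1 < γ) (ht0 : t 0 = 0) (hmono : ∀ j, j < m → t j < t (j + 1))
    {j : ℕ} (hj1 : 1 ≤ j) (hj : j ≤ m) : 0 < weight γ t j := by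
  have hpos := mesh_pos ht0 hmono hj1 hj
  have h1pos := mesh_pos ht0 hmono le_rfl (hj1.trans hj)
  exact lt_of_lt_of_le (by positivity) (le_weight hγ ht0 hmono hj1 hj)

lemma weight_mono {γ : ℝ} (ht0 : t 0 = 0) (hmono : ∀ j, j < m → t j < t (j + 1))
    {i j : ℕ} (hij : i ≤ j) (hj : j ≤ m) : weight γ t i ≤ weight γ t j := by
  induction j, hij using Nat.le_induction with
  | base => exact le_rfl
  | succ k _ ih =>
    rw [weight_succ]
    have h1 := mesh_pos ht0 hmono (j := k + 1) (by omega) hj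
    have h2 := mesh_pos ht0 hmono (j := 1) le_rfl (by omega)
    have h3 : 0 < t (k + 1) - t k := sub_pos.2 (hmono k (by omega))
    have h4 : 0 ≤ (t (k + 1) - t k) * (t 1 ^ γ * t (k + 1) ^ (-γ - 1)) := by positivity
    linarith [ih (by omega)]

lemma weight_one {γ : ℝ} (ht0 : t 0 = 0) (h1 : 0 < t 1) : weight γ t 1 = 1 := by
  have : weight γ t 1 = (t 1 - t 0) * (t 1 ^ γ * t 1 ^ (-γ - 1)) := by simp [weight]
  rw [this, ht0, sub_zero, ← Real.rpow_add h1, show γ + (-γ - 1) = -1 by ring,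
    Real.rpow_neg_one, mul_inv_cancel₀ h1.ne']

lemma sub_div_le_log {u v : ℝ} (hu : 0 < u) (hv : 0 < v) :
    (v - u) / v ≤ Real.log (v / u) := by
  have h := Real.log_le_sub_one_of_pos (div_pos hu hv)
  rw [Real.log_div hu.ne' hv.ne'] at h
  rw [Real.log_div hv.ne' hu.ne', sub_div, div_self hv.ne']
  linarith

lemma weight_le_log {γ : ℝ} (hγ : γ ≤ 0) (ht0 : t 0 = 0)
    (hmono : ∀ j, j < m → t j < t (j + 1)) {j : ℕ} (hj1 : 1 ≤ j) (hj : j ≤ m) :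
    weight γ t j ≤ t 1 ^ γ * t j ^ (-γ) * (1 + Real.log (t j / t 1)) := by
  have h1pos := mesh_pos ht0 hmono le_rfl (hj1.trans hj)
  have hpos := mesh_pos ht0 hmono hj1 hj
  have key : ∀ i, 1 ≤ i → i ≤ j →
      weight γ t i ≤ t 1 ^ γ * t j ^ (-γ) * (1 + Real.log (t i / t 1)) := by
    intro i hi1
    induction i, hi1 using Nat.le_induction with
    | base =>
      intro _
      rw [weight_one ht0 h1pos, div_self h1pos.ne', Real.log_one, add_zero, mul_one]
      calc (1 : ℝ) = t 1 ^ γ * t 1 ^ (-γ) := by rw [← Real.rpow_add h1pos]; simp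
        _ ≤ _ := by
          gcongr
          · linarith
          · exact mesh_mono hmono hj1 hj
    | succ k hk ih =>
      intro hkj
      rw [weight_succ]
      have hkpos := mesh_pos ht0 hmono hk (by omega)
      have hk1pos := mesh_pos ht0 hmono (j := k + 1) (by omega) (by omega)
      have h2 := sub_div_le_log hkpos hk1pos
      have h3 : Real.log (t (k + 1) / t 1) =
          Real.log (t k / t 1) + Real.log (t (k + 1) / t k) := by
        rw [← Real.log_mul (by positivity) (by positivity)]
        congr 1
        field_simp
      have h4 : 0 < t (k + 1) - t k := sub_pos.2 (hmono k (by omega))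
      have h5 : t (k + 1) ^ (-γ) ≤ t j ^ (-γ) :=
        Real.rpow_le_rpow hk1pos.le (mesh_mono hmono hkj hj) (by linarith)
      have h6 : (t (k + 1) - t k) * (t 1 ^ γ * t (k + 1) ^ (-γ - 1)) ≤
          t 1 ^ γ * t j ^ (-γ) * Real.log (t (k + 1) / t k) := by
        calc _ = t 1 ^ γ * t (k + 1) ^ (-γ) * ((t (k + 1) - t k) / t (k + 1)) := by
              rw [Real.rpow_sub_one hk1pos.ne']; field_simp
          _ ≤ _ := by gcongr
      rw [h3]
      linarith [ih (by omega)]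
  exact key j hj1 le_rfl

lemma weight_le_rpow {γ : ℝ} (hγ : γ < 0) (hγ1 : -1 < γ) (ht0 : t 0 = 0)
    (hmono : ∀ j, j < m → t j < t (j + 1)) {j : ℕ} (hj1 : 1 ≤ j) (hj : j ≤ m) :
    weight γ t j ≤ t 1 ^ γ * t j ^ (-γ) / (-γ) := by
  have h1pos := mesh_pos ht0 hmono le_rfl (hj1.trans hj)
  have key : ∀ i, i ≤ j → weight γ t i ≤ t 1 ^ γ * t i ^ (-γ) / (-γ) := by
    intro i
    induction i with
    | zero =>
      intro _
      simp [ht0, weight, Real.zero_rpow (neg_ne_zero.2 hγ.ne)]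
    | succ k ih =>
      intro hkj
      rw [weight_succ]
      have hk : 0 ≤ t k := by rw [← ht0]; exact mesh_mono hmono (Nat.zero_le _) (by omega)
      have h2 := rpow_le_tangent (e := -γ) (by linarith) (by linarith)
        (mesh_pos ht0 hmono (j := k + 1) (by omega) (by omega)) hk
      have h3 := ih (by omega)
      have h4 : 0 < t 1 ^ γ := by positivity
      have h5 : (t (k + 1) - t k) * t (k + 1) ^ (-γ - 1) ≤
          (t (k + 1) ^ (-γ) - t k ^ (-γ)) / (-γ) := by
        rw [le_div_iff₀ (by linarith)]
        linarith
      have h6 := mul_le_mul_of_nonneg_left h5 h4.le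
      calc _ ≤ t 1 ^ γ * t k ^ (-γ) / (-γ) +
            t 1 ^ γ * ((t (k + 1) ^ (-γ) - t k ^ (-γ)) / (-γ)) := by linarith
        _ = _ := by ring
  exact key j le_rfl

lemma kernelSum_barrier_initial {α γ : ℝ} {Q l : ℕ} (hl1 : 1 ≤ l) (hlQ : l ≤ Q) :
    kernelSum α t (barrier α γ t Q) m l =
      t Q ^ (α - 1) * weight γ t Q * kernelMean α (t m) (t 0) (t 1) := by
  induction l, hl1 using Nat.le_induction with
  | base => simp [kernelSum, barrier, hlQ]
  | succ k hk ih =>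
    have hk0 : k ≠ 0 := by omega
    rw [kernelSum_succ, ih (by omega)]
    simp [barrier, hk0, max_eq_right hlQ, max_eq_right (show k ≤ Q by omega)]

lemma le_kernelSum_barrier_initial {α γ : ℝ} (hα0 : 0 < α) (hα1 : α < 1) (hγ : -1 < γ)
    (ht0 : t 0 = 0) {Q n l : ℕ} (hmono : ∀ j, j < n → t j < t (j + 1)) (hm1 : 1 ≤ m)
    (hmn : m ≤ n) (hQn : Q ≤ n) (hl1 : 1 ≤ l) (hlQ : l ≤ Q) :
    t Q ^ (α - 1) * weight γ t Q * t m ^ (-α) ≤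
      kernelSum α t (barrier α γ t Q) m l := by
  rw [kernelSum_barrier_initial hl1 hlQ]
  have hQ := mesh_pos ht0 hmono (hl1.trans hlQ) hQn
  have hw := weight_pos hγ ht0 hmono (hl1.trans hlQ) hQn
  have h := le_kernelMean (x := t m) hα0 hα1 (hmono 0 (by omega)) (mesh_mono hmono hm1 hmn)
  rw [ht0, sub_zero, zero_add, ← ht0] at h
  gcongr

lemma le_kernelSum_barrier {α γ κ K θ : ℝ} (hα0 : 0 < α) (hα1 : α < 1) (hγ1 : α - 1 ≤ γ)
    (hκ : 0 < κ) (hκ1 : κ ≤ 1) (hK : 0 < K) (hθ0 : 0 < θ) (hθα : θ < α) (ht0 : t 0 = 0)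
    (hmono : ∀ j, j < m → t j < t (j + 1))
    (hratio : ∀ j, 2 ≤ j → j ≤ m → κ * t j ≤ t (j - 1))
    (hstep : ∀ j, 1 ≤ j → j ≤ m → t j - t (j - 1) ≤ K * (t 1 ^ θ * t j ^ (1 - θ)))
    {Q : ℕ} (hQ1 : 1 ≤ Q) (hQm : Q ≤ m) :
    (1 - α) * κ ^ α * t 1 ^ γ * t m ^ (-γ - 1) -
      weight γ t m * (gapConst α κ * K * (1 / (α - θ) + 1)) * t 1 ^ θ * t m ^ (-1 - θ) ≤
      kernelSum α t (barrier α γ t Q) m m := by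
  have hx := mesh_pos ht0 hmono (hQ1.trans hQm) le_rfl
  have hτ := mesh_pos ht0 hmono le_rfl (hQ1.trans hQm)
  have hD : 0 < gapConst α κ * K * t 1 ^ θ := by
    have := gapConst_pos (α := α) hκ
    positivity
  have hwm := weight_pos (γ := γ) (by linarith) ht0 hmono (hQ1.trans hQm) le_rfl
  have hκα : κ ^ α ≤ 1 := Real.rpow_le_one hκ.le hκ1 hα0.le
  have hαθ : 0 < α - θ := by linarith
  set D := gapConst α κ * K * t 1 ^ θ with hDdef
  set c := (1 - α) * κ ^ α * t 1 ^ γ * t m ^ (-γ - 2) with hc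
  have key : ∀ l, Q ≤ l → l ≤ m →
      primitive α (t m) (t l) * weight γ t l + c * t l -
        weight γ t m * (D * (t m ^ (-α - 1) / (α - θ) * t l ^ (α - θ) +
          t m ^ (α - 2 - θ) * (t m ^ (1 - α) - (t m - t l) ^ (1 - α)))) ≤
      kernelSum α t (barrier α γ t Q) m l := by
    intro l hl
    induction l, hl using Nat.le_induction with
    | base =>
      intro _
      have hQ := mesh_pos ht0 hmono hQ1 hQm
      have hQx := mesh_mono hmono hQm le_rfl
      have hwQ := weight_pos (γ := γ) (by linarith) ht0 hmono hQ1 hQm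
      refine le_trans ?_ (le_kernelSum_barrier_initial (γ := γ) (l := Q) hα0 hα1 (by linarith)
        ht0 hmono (hQ1.trans hQm) le_rfl hQm hQ1 le_rfl)
      have h1 := primitive_add_le hα0 hα1 hQ hQx
      have h2 : 0 ≤ t m ^ (1 - α) - (t m - t Q) ^ (1 - α) :=
        sub_nonneg.2 (Real.rpow_le_rpow (by linarith) (by linarith) (by linarith))
      have h3 : 0 ≤ weight γ t m * (D * (t m ^ (-α - 1) / (α - θ) * t Q ^ (α - θ) +
          t m ^ (α - 2 - θ) * (t m ^ (1 - α) - (t m - t Q) ^ (1 - α)))) := by positivity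
      have h4 : c * t Q ≤ (1 - α) * (t Q ^ α * t m ^ (-α - 1)) * weight γ t Q := by
        have h5 : t m ^ (α - γ - 1) ≤ t Q ^ (α - γ - 1) :=
          Real.rpow_le_rpow_of_nonpos hQ hQx (by linarith)
        have h6 := le_weight (γ := γ) (by linarith) ht0 hmono hQ1 hQm
        have h7 : 0 < 1 - α := by linarith
        calc c * t Q ≤ (1 - α) * 1 * t 1 ^ γ * t m ^ (-γ - 2) * t Q := by
              rw [hc]; gcongr
          _ = (1 - α) * t 1 ^ γ * t m ^ (-α - 1) * t Q * t m ^ (α - γ - 1) := by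
              rw [show -γ - 2 = (-α - 1) + (α - γ - 1) by ring, Real.rpow_add hx]; ring
          _ ≤ (1 - α) * t 1 ^ γ * t m ^ (-α - 1) * t Q * t Q ^ (α - γ - 1) := by gcongr
          _ = (1 - α) * (t Q ^ α * t m ^ (-α - 1)) * (t 1 ^ γ * t Q ^ (-γ)) := by
              rw [show α - γ - 1 = α + (-γ) - 1 by ring, Real.rpow_sub_one hQ.ne',
                Real.rpow_add hQ]
              field_simp
          _ ≤ _ := by gcongr
      have h8 := mul_le_mul_of_nonneg_right h1 hwQ.le
      nlinarith
    | succ k hk ih =>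
      intro hkm
      have ih := ih (by omega)
      have hu := mesh_pos ht0 hmono (hQ1.trans hk) (by omega : k ≤ m)
      have huv := hmono k (by omega)
      have hv := hu.trans huv
      have hvx := mesh_mono hmono hkm le_rfl
      have hκu : κ * t (k + 1) ≤ t k := by simpa using hratio (k + 1) (by omega) hkm
      have hst : t (k + 1) - t k ≤ K * (t 1 ^ θ * t (k + 1) ^ (1 - θ)) := by
        simpa using hstep (k + 1) (by omega) hkm
      have hgap := gap_le_telescoping hα0 hα1 hκ hθα hK hτ hθ0 hu huv hvx hκu hst
      have hmain := rpow_mul_le_kernelMean_sub_primitive hα0 hα1 hu huv hvx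
      have hw1 := weight_mono (γ := γ) ht0 hmono hkm le_rfl
      have hw0 := weight_pos (γ := γ) (by linarith) ht0 hmono (by omega : 1 ≤ k + 1) hkm
      have hws := weight_succ γ t k
      have hk0 : k ≠ 0 := by omega
      rw [kernelSum_succ]
      simp only [barrier, hk0, if_false, Nat.add_eq_zero_iff, one_ne_zero, and_false,
        max_eq_left hk, max_eq_left (show Q ≤ k + 1 by omega)] at ih ⊢
      set x := t m
      set u := t k
      set v := t (k + 1)
      set E := D * (x ^ (-α - 1) / (α - θ) * (v ^ (α - θ) - u ^ (α - θ)) +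
        x ^ (α - 2 - θ) * ((x - u) ^ (1 - α) - (x - v) ^ (1 - α))) with hE
      have hE0 : 0 ≤ E := by
        have h1 : 0 ≤ v ^ (α - θ) - u ^ (α - θ) :=
          sub_nonneg.2 (Real.rpow_le_rpow hu.le huv.le hαθ.le)
        have h2 : 0 ≤ (x - u) ^ (1 - α) - (x - v) ^ (1 - α) :=
          sub_nonneg.2 (Real.rpow_le_rpow (by linarith) (by linarith) (by linarith))
        positivity
      set d := (v - u) * (t 1 ^ γ * v ^ (-γ - 1)) with hd
      have hd0 : 0 ≤ d := by
        have : 0 < v - u := by linarith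
        positivity
      have hdc : c * (v - u) ≤ d * (u ^ α * x ^ (-α - 1)) := by
        have h1 : κ ^ α * v ^ α ≤ u ^ α := by
          rw [← Real.mul_rpow hκ.le hv.le]
          exact Real.rpow_le_rpow (by positivity) hκu hα0.le
        have h2 : x ^ (α - γ - 1) ≤ v ^ (α - γ - 1) :=
          Real.rpow_le_rpow_of_nonpos hv hvx (by linarith)
        have h3 : 0 < v - u := by linarith
        calc c * (v - u) ≤ 1 * κ ^ α * t 1 ^ γ * x ^ (-γ - 2) * (v - u) := by
              rw [hc]; gcongr; linarith
          _ = κ ^ α * t 1 ^ γ * x ^ (-α - 1) * (v - u) * x ^ (α - γ - 1) := by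
              rw [show -γ - 2 = (-α - 1) + (α - γ - 1) by ring, Real.rpow_add hx]; ring
          _ ≤ κ ^ α * t 1 ^ γ * x ^ (-α - 1) * (v - u) * v ^ (α - γ - 1) := by gcongr
          _ = (v - u) * (t 1 ^ γ * v ^ (-γ - 1)) * ((κ ^ α * v ^ α) * x ^ (-α - 1)) := by
              rw [show α - γ - 1 = α + (-γ - 1) by ring, Real.rpow_add hv]; ring
          _ ≤ _ := by rw [hd]; gcongr
      have h1 := mul_le_mul_of_nonneg_left hmain hd0
      have h2 := mul_le_mul_of_nonneg_left hgap hw0.le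
      have h3 := mul_le_mul_of_nonneg_right hw1 hE0
      have h4 : (v ^ (α - 1) * weight γ t (k + 1) - u ^ (α - 1) * weight γ t k) *
          kernelMean α x u v =
          -(weight γ t (k + 1) * ((u ^ (α - 1) - v ^ (α - 1)) * kernelMean α x u v)) +
          d * (u ^ (α - 1) * kernelMean α x u v) := by
        rw [hws]; ring
      have h5 : primitive α x v * weight γ t (k + 1) - primitive α x u * weight γ t k =
          -(weight γ t (k + 1) * (primitive α x u - primitive α x v)) +
          d * primitive α x u := by
        rw [hws]; ring
      have h6 : weight γ t m * (D * (x ^ (-α - 1) / (α - θ) * v ^ (α - θ) +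
            x ^ (α - 2 - θ) * (x ^ (1 - α) - (x - v) ^ (1 - α)))) -
          weight γ t m * (D * (x ^ (-α - 1) / (α - θ) * u ^ (α - θ) +
            x ^ (α - 2 - θ) * (x ^ (1 - α) - (x - u) ^ (1 - α)))) = weight γ t m * E := by
        rw [hE]; ring
      linarith
  refine le_trans (le_of_eq ?_) (key m hQm le_rfl)
  have e1 : (t m - t m) ^ (1 - α) = 0 := by
    rw [sub_self, Real.zero_rpow (by linarith)]
  have e2 : primitive α (t m) (t m) = 0 := by simp [primitive, e1, -sub_self]
  have e3 : t m ^ (-γ - 2) * t m = t m ^ (-γ - 1) := by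
    rw [← Real.rpow_add_one hx.ne']; ring_nf
  have e4 : t m ^ (-α - 1) * t m ^ (α - θ) = t m ^ (-1 - θ) := by
    rw [← Real.rpow_add hx]; ring_nf
  have e5 : t m ^ (α - 2 - θ) * t m ^ (1 - α) = t m ^ (-1 - θ) := by
    rw [← Real.rpow_add hx]; ring_nf
  rw [e1, e2, sub_zero, div_mul_eq_mul_div, e4, e5, hc, mul_assoc _ _ (t m), e3]
  ring

end Mesh

lemma kernelMean_mono {α x u v w : ℝ} (hα0 : 0 < α) (hα1 : α < 1) (huv : u < v) (hvw : v < w)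
    (hwx : w ≤ x) : kernelMean α x u v ≤ kernelMean α x v w :=
  (kernelMean_le hα0 hα1 huv (hvw.trans_le hwx)).trans (le_kernelMean hα0 hα1 hvw hwx)

/-- Discrete comparison principle for the L1 operator. -/
lemma nonneg_of_kernelSum_nonneg {α : ℝ} (hα0 : 0 < α) (hα1 : α < 1) {t W : ℕ → ℝ} {n : ℕ}
    (hmono : ∀ j, j < n → t j < t (j + 1)) (hW0 : W 0 = 0)
    (hW : ∀ m, 1 ≤ m → m ≤ n → 0 ≤ kernelSum α t W m m) :
    ∀ m, m ≤ n → 0 ≤ W m := by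
  intro m
  induction m using Nat.strong_induction_on with
  | _ m ih =>
    intro hmn
    rcases Nat.eq_zero_or_pos m with rfl | hm
    · exact hW0.ge
    have key : ∀ l, 1 ≤ l → l ≤ m →
        kernelSum α t W m l ≤ W l * kernelMean α (t m) (t (l - 1)) (t l) := by
      intro l hl
      induction l, hl using Nat.le_induction with
      | base => intro _; simp [kernelSum, hW0]
      | succ k hk ihk =>
        intro hkm
        obtain ⟨i, rfl⟩ : ∃ i, k = i + 1 := ⟨k - 1, by omega⟩
        rw [kernelSum_succ]
        have h1 := ihk (by omega)
        have h2 := ih (i + 1) (by omega) (by omega)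
        have h3 := kernelMean_mono hα0 hα1 (hmono i (by omega)) (hmono (i + 1) (by omega))
          (mesh_mono hmono hkm hmn)
        simp only [Nat.add_sub_cancel] at h1 ⊢
        nlinarith [mul_le_mul_of_nonneg_left h3 h2]
    have h1 := (hW m hm hmn).trans (key m hm le_rfl)
    obtain ⟨i, rfl⟩ : ∃ i, m = i + 1 := ⟨m - 1, by omega⟩
    simp only [Nat.add_sub_cancel] at h1
    exact nonneg_of_mul_nonneg_left h1
      (kernelMean_pos hα0 hα1 (hmono i (by omega)) le_rfl)

lemma weight_le_rpow_mul {γ θ : ℝ} (hγ : γ ≤ 0) (hθ : 0 < θ) {t : ℕ → ℝ} {m : ℕ}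
    (ht0 : t 0 = 0) (hmono : ∀ j, j < m → t j < t (j + 1)) (hm : 1 ≤ m) :
    weight γ t m ≤ t 1 ^ γ * t m ^ (-γ) * ((1 + 1 / θ) * (t m / t 1) ^ θ) := by
  have hτ := mesh_pos ht0 hmono le_rfl hm
  have hx := mesh_pos ht0 hmono hm le_rfl
  have h1 : 1 ≤ t m / t 1 := (one_le_div hτ).2 (mesh_mono hmono hm le_rfl)
  have h2 := Real.log_le_rpow_div (x := t m / t 1) (by positivity) hθ
  have h3 := Real.one_le_rpow h1 hθ.le
  refine (weight_le_log hγ ht0 hmono hm le_rfl).trans ?_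
  gcongr
  calc _ ≤ (t m / t 1) ^ θ + (t m / t 1) ^ θ / θ := by linarith
    _ = _ := by ring

lemma QuasiGraded.ratio {r c0 C0 T : ℝ} (hr1 : 1 ≤ r) (hc0 : 0 < c0) (hcC : c0 ≤ C0) {M : ℕ}
    {t : ℕ → ℝ} (hM : IsMesh T M t) (h : QuasiGraded r c0 C0 M t) {j : ℕ} (hj : 2 ≤ j)
    (hjM : j ≤ M) : c0 / (C0 * 2 ^ r) * t j ≤ t (j - 1) := by
  obtain ⟨i, rfl⟩ : ∃ i, j = i + 1 := ⟨j - 1, by omega⟩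
  have hτ := mesh_pos hM.2.1 hM.2.2.1 le_rfl (show 1 ≤ M by omega)
  have hC0 : 0 < C0 := hc0.trans_le hcC
  have hi : (1 : ℝ) ≤ i := by exact_mod_cast (show 1 ≤ i by omega)
  have h1 := (h.2.1 (i + 1) (by omega) hjM).2
  have h2 := (h.2.1 i (by omega) (by omega)).1
  rw [Nat.add_sub_cancel]
  have h3 : ((i + 1 : ℕ) : ℝ) ^ r ≤ 2 ^ r * (i : ℝ) ^ r := by
    rw [← Real.mul_rpow (by norm_num) (by linarith)]
    apply Real.rpow_le_rpow (by positivity) _ (by linarith)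
    push_cast
    linarith
  calc c0 / (C0 * 2 ^ r) * t (i + 1)
      ≤ c0 / (C0 * 2 ^ r) * (C0 * (t 1 * (2 ^ r * (i : ℝ) ^ r))) := by
        gcongr
        exact h1.trans (by gcongr)
    _ = c0 * (t 1 * (i : ℝ) ^ r) := by field_simp
    _ ≤ _ := h2

lemma QuasiGraded.step {r c0 C0 T θ : ℝ} (hC0 : 0 < C0) (hθ : θ ≤ 1 / r)
    {M : ℕ} {t : ℕ → ℝ} (hM : IsMesh T M t) (h : QuasiGraded r c0 C0 M t) {j : ℕ} (hj : 1 ≤ j)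
    (hjM : j ≤ M) : t j - t (j - 1) ≤ C0 * (t 1 ^ θ * t j ^ (1 - θ)) := by
  have hτ := mesh_pos hM.2.1 hM.2.2.1 le_rfl (show 1 ≤ M by omega)
  have hv := mesh_pos hM.2.1 hM.2.2.1 hj hjM
  refine (h.2.2 j hj hjM).2.trans ?_
  have h1 : t 1 ^ (1 / r - θ) ≤ t j ^ (1 / r - θ) :=
    Real.rpow_le_rpow hτ.le (mesh_mono hM.2.2.1 hj hjM) (by linarith)
  have e1 : t 1 ^ (1 / r) = t 1 ^ θ * t 1 ^ (1 / r - θ) := by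
    rw [← Real.rpow_add hτ]; ring_nf
  have e2 : t j ^ (1 - θ) = t j ^ (1 / r - θ) * t j ^ (1 - 1 / r) := by
    rw [← Real.rpow_add hv]; ring_nf
  rw [e1, e2, mul_assoc]
  gcongr

lemma exists_barrier_bound {α r γ c0 C0 : ℝ} (hα0 : 0 < α) (hα1 : α < 1) (hr1 : 1 ≤ r)
    (hγ1 : α - 1 ≤ γ) (hγ2 : γ ≤ 0) (hc0 : 0 < c0) (hcC : c0 ≤ C0) :
    ∃ c : ℝ, 0 < c ∧ ∃ P : ℕ, 1 ≤ P ∧ ∀ (T : ℝ) (M : ℕ) (t : ℕ → ℝ), IsMesh T M t →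
      QuasiGraded r c0 C0 M t → ∀ n m : ℕ, 1 ≤ m → m ≤ n → n ≤ M →
        c * (t 1 ^ γ * t m ^ (-γ - 1)) ≤ kernelSum α t (barrier α γ t (min P n)) m m := by
  have hC0 : 0 < C0 := hc0.trans_le hcC
  have hr0 : 0 < r := by linarith
  obtain ⟨θ, hθ0, hθα, hθr⟩ : ∃ θ, 0 < θ ∧ θ < α ∧ θ ≤ 1 / r := by
    refine ⟨α / 2 / r, by positivity, ?_, ?_⟩
    · rw [div_lt_iff₀ hr0]; nlinarith
    · gcongr; linarith
  set κ := c0 / (C0 * 2 ^ r) with hκdef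
  have hκ : 0 < κ := by positivity
  have hκ1 : κ ≤ 1 := by
    rw [hκdef, div_le_one (by positivity)]
    have : (1 : ℝ) ≤ 2 ^ r := Real.one_le_rpow (by norm_num) hr0.le
    nlinarith
  set c1 := (1 - α) * κ ^ α with hc1def
  have hc1 : 0 < c1 := mul_pos (by linarith) (by positivity)
  set C2 := gapConst α κ * C0 * (1 / (α - θ) + 1) with hC2def
  have hC2 : 0 < C2 := by
    have h1 := gapConst_pos (α := α) hκ
    have h2 : 0 < α - θ := by linarith
    positivity
  obtain ⟨X, hX⟩ : ∃ X : ℝ, ∀ y, X ≤ y → C2 * (1 + 1 / (θ / 2)) * y ^ (-(θ / 2)) ≤ c1 / 2 := by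
    have h1 := (tendsto_rpow_neg_atTop (half_pos hθ0)).const_mul (C2 * (1 + 1 / (θ / 2)))
    rw [mul_zero] at h1
    exact Filter.eventually_atTop.1 (h1.eventually_le_const (half_pos hc1))
  obtain ⟨P, hP⟩ := exists_nat_ge (max 1 (X / c0))
  have hP1 : 1 ≤ P := by exact_mod_cast (le_max_left _ _).trans hP
  have hPX : X / c0 ≤ P := (le_max_right _ _).trans hP
  have hP0 : (0 : ℝ) < P := by exact_mod_cast hP1
  refine ⟨min (c1 / 2) ((C0 * (P : ℝ) ^ r) ^ (α - 1)), by positivity, P, hP1, ?_⟩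
  intro T M t hM hG n m hm hmn hnM
  have ht0 := hM.2.1
  have hmonoM := hM.2.2.1
  have hmono : ∀ j, j < n → t j < t (j + 1) := fun j hj => hmonoM j (by omega)
  have hmono' : ∀ j, j < m → t j < t (j + 1) := fun j hj => hmonoM j (by omega)
  have hτ := mesh_pos ht0 hmono' le_rfl hm
  have hx := mesh_pos ht0 hmono' hm le_rfl
  have hτx := mesh_mono hmono' hm le_rfl
  have hf : 0 < t 1 ^ γ * t m ^ (-γ - 1) := by positivity
  rcases le_or_gt m (min P n) with hmQ | hmQ
  · set Q := min P n
    have hQn : Q ≤ n := min_le_right _ _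
    have hQP : Q ≤ P := min_le_left _ _
    have hQ1 : 1 ≤ Q := hm.trans hmQ
    have hQ := mesh_pos ht0 hmono hQ1 hQn
    refine le_trans ?_ (le_kernelSum_barrier_initial (γ := γ) (l := m) hα0 hα1 (by linarith) ht0
      hmono hm hmn hQn hm hmQ)
    have hw : 1 ≤ weight γ t Q := by
      rw [← weight_one (γ := γ) ht0 hτ]
      exact weight_mono ht0 hmono hQ1 hQn
    have htQ : t Q ≤ C0 * (P : ℝ) ^ r * t 1 := by
      refine (hG.2.1 Q hQ1 (hQn.trans hnM)).2.trans ?_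
      calc _ ≤ C0 * (t 1 * (P : ℝ) ^ r) := by gcongr
        _ = _ := by ring
    have h1 : (C0 * (P : ℝ) ^ r) ^ (α - 1) * t 1 ^ (α - 1) ≤ t Q ^ (α - 1) := by
      rw [← Real.mul_rpow (by positivity) hτ.le]
      exact Real.rpow_le_rpow_of_nonpos hQ htQ (by linarith)
    have h2 : t m ^ (α - 1 - γ) ≤ t 1 ^ (α - 1 - γ) :=
      Real.rpow_le_rpow_of_nonpos hτ hτx (by linarith)
    calc _ ≤ (C0 * (P : ℝ) ^ r) ^ (α - 1) * (t 1 ^ γ * t m ^ (-γ - 1)) := by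
          gcongr; exact min_le_right _ _
      _ = (C0 * (P : ℝ) ^ r) ^ (α - 1) * (t 1 ^ γ * t m ^ (α - 1 - γ)) * t m ^ (-α) := by
          rw [show -γ - 1 = (α - 1 - γ) + (-α) by ring, Real.rpow_add hx]; ring
      _ ≤ (C0 * (P : ℝ) ^ r) ^ (α - 1) * (t 1 ^ γ * t 1 ^ (α - 1 - γ)) * t m ^ (-α) := by
          gcongr
      _ = (C0 * (P : ℝ) ^ r) ^ (α - 1) * t 1 ^ (α - 1) * t m ^ (-α) := by
          rw [← Real.rpow_add hτ]; ring_nf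
      _ ≤ t Q ^ (α - 1) * 1 * t m ^ (-α) := by rw [mul_one]; gcongr
      _ ≤ _ := by gcongr
  · have hQ : min P n = P := min_eq_left (by omega)
    rw [hQ] at hmQ ⊢
    have hmP : (P : ℝ) ≤ m := by exact_mod_cast hmQ.le
    have hm1 : (1 : ℝ) ≤ m := by exact_mod_cast hm
    have hy : X ≤ t m / t 1 := by
      rw [div_le_iff₀ hc0] at hPX
      rw [le_div_iff₀ hτ]
      have h1 := (hG.2.1 m hm (hmn.trans hnM)).1
      have h2 : (m : ℝ) ≤ (m : ℝ) ^ r := by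
        simpa using Real.rpow_le_rpow_of_exponent_le hm1 hr1
      calc X * t 1 ≤ P * c0 * t 1 := by gcongr
        _ ≤ (m : ℝ) ^ r * c0 * t 1 := by
          gcongr
          exact hmP.trans h2
        _ ≤ t m := by linarith
    have h1 := hX _ hy
    have h2 := weight_le_rpow_mul hγ2 (half_pos hθ0) ht0 hmono' hm
    have h3 := le_kernelSum_barrier hα0 hα1 hγ1 hκ hκ1 hC0 hθ0 hθα ht0 hmono'
      (fun j hj hjm => QuasiGraded.ratio hr1 hc0 hcC hM hG hj (by omega))
      (fun j hj hjm => QuasiGraded.step hC0 hθr hM hG hj (by omega)) hP1 hmQ.le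
    refine le_trans ?_ h3
    have h4 : weight γ t m * C2 * t 1 ^ θ * t m ^ (-1 - θ) ≤
        c1 / 2 * (t 1 ^ γ * t m ^ (-γ - 1)) := by
      have e1 : (t m / t 1) ^ (θ / 2) * (t 1 ^ θ * t m ^ (-1 - θ)) =
          (t m / t 1) ^ (-(θ / 2)) * t m ^ (-1 : ℝ) := by
        have e2 : t 1 ^ θ * t m ^ (-1 - θ) = (t m / t 1) ^ (-θ) * t m ^ (-1 : ℝ) := by
          rw [Real.div_rpow hx.le hτ.le, Real.rpow_neg hτ.le, div_inv_eq_mul,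
            show -1 - θ = -θ + -1 by ring, Real.rpow_add hx]
          ring
        rw [e2, ← mul_assoc, ← Real.rpow_add (by positivity)]
        ring_nf
      calc _ ≤ t 1 ^ γ * t m ^ (-γ) * ((1 + 1 / (θ / 2)) * (t m / t 1) ^ (θ / 2)) * C2 *
            t 1 ^ θ * t m ^ (-1 - θ) := by gcongr
        _ = t 1 ^ γ * t m ^ (-γ) * (C2 * (1 + 1 / (θ / 2))) *
            ((t m / t 1) ^ (θ / 2) * (t 1 ^ θ * t m ^ (-1 - θ))) := by ring
        _ = t 1 ^ γ * (t m ^ (-γ) * t m ^ (-1 : ℝ)) *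
            (C2 * (1 + 1 / (θ / 2)) * (t m / t 1) ^ (-(θ / 2))) := by rw [e1]; ring
        _ ≤ t 1 ^ γ * (t m ^ (-γ) * t m ^ (-1 : ℝ)) * (c1 / 2) := by gcongr
        _ = _ := by rw [← Real.rpow_add hx]; ring_nf
    have h5 := mul_le_mul_of_nonneg_right
      (min_le_left (c1 / 2) ((C0 * (P : ℝ) ^ r) ^ (α - 1))) hf.le
    linarith

lemma abs_le_of_kernelSum_bound {α : ℝ} (hα0 : 0 < α) (hα1 : α < 1) {t V B f : ℕ → ℝ} {n : ℕ}
    {c : ℝ} (hc : 0 < c) (hmono : ∀ j, j < n → t j < t (j + 1)) (hV0 : V 0 = 0) (hB0 : B 0 = 0)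
    (hB : ∀ m, 1 ≤ m → m ≤ n → c * f m ≤ kernelSum α t B m m)
    (hV : ∀ m, 1 ≤ m → m ≤ n → |deltaL1 α t V m| ≤ f m) :
    |V n| ≤ Real.Gamma (1 - α) / c * B n := by
  have hΓ : 0 < Real.Gamma (1 - α) := Real.Gamma_pos_of_pos (by linarith)
  set A := Real.Gamma (1 - α) / c with hA
  have hkey : ∀ σ : ℝ, |σ| = 1 → 0 ≤ A * B n + σ * V n := by
    intro σ hσ
    refine nonneg_of_kernelSum_nonneg hα0 hα1 (W := fun j => A * B j + σ * V j) hmono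
      (by simp [hV0, hB0]) (fun m hm hmn => ?_) n le_rfl
    have e1 : kernelSum α t (fun j => A * B j + σ * V j) m m =
        A * kernelSum α t B m m + σ * kernelSum α t V m m := by
      simp only [kernelSum, Finset.mul_sum, ← Finset.sum_add_distrib]
      exact Finset.sum_congr rfl fun j _ => by ring
    have h1 := hV m hm hmn
    have e2 : kernelSum α t V m m = Real.Gamma (1 - α) * deltaL1 α t V m := by
      rw [deltaL1_eq hα1, kernelSum]
      field_simp
    have h2 : |σ * kernelSum α t V m m| ≤ Real.Gamma (1 - α) * f m := by
      rw [e2, abs_mul, abs_mul, hσ, one_mul, abs_of_pos hΓ]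
      gcongr
    have h3 : Real.Gamma (1 - α) * f m ≤ A * kernelSum α t B m m := by
      calc _ = A * (c * f m) := by rw [hA]; field_simp
        _ ≤ _ := by
          have := hB m hm hmn
          gcongr
    rw [e1]
    linarith [neg_le_of_abs_le h2]
  rw [abs_le]
  constructor
  · linarith [hkey 1 (by simp)]
  · linarith [hkey (-1) (by simp)]

end L1Stability

/-- Stability of the L1 operator for `γ ∈ [α-1, 0]` on quasi-graded meshes
(Lemma 2.7). -/
theorem stmt8 (α r γ T c0 C0 : ℝ)
    (hα0 : 0 < α) (hα1 : α < 1)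
    (hr1 : 1 ≤ r) (hr2 : r ≤ (2 - α) / α)
    (hγ1 : α - 1 ≤ γ) (hγ2 : γ ≤ 0)
    (hT : 0 < T) (hc0 : 0 < c0) (hcC : c0 ≤ C0) :
    ∃ C : ℝ, 0 < C ∧
      ∀ (M : ℕ) (t : ℕ → ℝ), IsMesh T M t → QuasiGraded r c0 C0 M t →
        ∀ (V : ℕ → ℝ) (n : ℕ), 1 ≤ n → n ≤ M → V 0 = 0 →
          (∀ j : ℕ, 1 ≤ j → j ≤ n →
            |deltaL1 α t V j| ≤ (t 1) ^ γ * (t j) ^ (-γ - 1)) →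
          (γ = 0 → |V n| ≤ C * ((t n) ^ (α - 1) * (1 + Real.log (t n / t 1)))) ∧
          (γ < 0 → |V n| ≤ C * ((t n) ^ (α - 1) * (t 1 / t n) ^ γ)) := by
  obtain ⟨c, hc, P, hP, hbarrier⟩ :=
    L1Stability.exists_barrier_bound hα0 hα1 hr1 hγ1 hγ2 hc0 hcC
  have hΓ : 0 < Real.Gamma (1 - α) := Real.Gamma_pos_of_pos (by linarith)
  have hA : 0 < Real.Gamma (1 - α) / c := by positivity
  have hg : 0 ≤ (-γ)⁻¹ := inv_nonneg.2 (by linarith)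
  refine ⟨Real.Gamma (1 - α) / c * (1 + (-γ)⁻¹), by positivity, ?_⟩
  intro M t hM hG V n hn hnM hV0 hV
  have ht0 := hM.2.1
  have hmono : ∀ j, j < n → t j < t (j + 1) := fun j hj => hM.2.2.1 j (by omega)
  have hτ := L1Stability.mesh_pos ht0 hmono le_rfl hn
  have hx := L1Stability.mesh_pos ht0 hmono hn le_rfl
  have hmain := L1Stability.abs_le_of_kernelSum_bound hα0 hα1 hc hmono hV0
    (B := L1Stability.barrier α γ t (min P n)) (by simp [L1Stability.barrier])
    (fun m hm hmn => hbarrier T M t hM hG n m hm hmn hnM) hV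
  have hBn : L1Stability.barrier α γ t (min P n) n =
      t n ^ (α - 1) * L1Stability.weight γ t n := by
    simp [L1Stability.barrier, show n ≠ 0 by omega]
  rw [hBn] at hmain
  constructor
  · rintro rfl
    have hw := L1Stability.weight_le_log le_rfl ht0 hmono hn le_rfl
    simp only [neg_zero, Real.rpow_zero, mul_one, one_mul] at hw
    simp only [neg_zero, inv_zero, add_zero, mul_one]
    exact hmain.trans (by gcongr)
  · intro hγ
    have hw := L1Stability.weight_le_rpow hγ (by linarith) ht0 hmono hn le_rfl
    refine hmain.trans ?_
    calc _ ≤ Real.Gamma (1 - α) / c *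
          (t n ^ (α - 1) * (t 1 ^ γ * t n ^ (-γ) / (-γ))) := by gcongr
      _ = Real.Gamma (1 - α) / c * (-γ)⁻¹ * (t n ^ (α - 1) * (t 1 / t n) ^ γ) := by
          rw [Real.div_rpow hτ.le hx.le, Real.rpow_neg hx.le]
          ring
      _ ≤ _ := by
          gcongr
          linarith
end
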